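/- Scattering interpretation of total reflection (Remark 2.6): Under assumption (A), m > 0, E in region II, and a unique simple real zero t₁(E) of m²c⁴ − (V(x)−E)², define the incoming solution u^in = ω_in^− + α_out^− ω_out^− and the (unique bounded) outgoing solution u^out = ω_out^− + α_in^− ω_in^−. If a bounded solution u of (H − E)u = 0 is written u = A·u^in and u = B·u^out, then B = 𝕊·A where the scalar scattering matrix is 𝕊 = α_out^− = −i(1 + hφ(h))·exp{(2i/h)(∫_{−∞}^{t₁(E)} Q⁻(t,E) dt + √(E⁻)·t₁(E))}, with φ a classical analytic symbol of non-negative order, Q⁻(t,E) = √((−m²c⁴ + (V(t)−E)²)/c²) − √(E⁻) and E⁻ = (−m²c⁴ + (V⁻ − E)²)/c². -/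

import Mathlib

open Complex Filter Topology MeasureTheory Set

noncomputable section

/-- The sector `𝒮 = {x ∈ ℂ : |Im x| < ε|Re x| + η}`. -/
def Sector (ε η : ℝ) : Set ℂ := {x : ℂ | |x.im| < ε * |x.re| + η}

/-- Assumption (A): `V` is real on the real axis, analytic in a sector `𝒮`
around the real axis, and tends to constants `V^±` at `±∞` in `𝒮` at rate
`⟨x⟩^{-δ}`, `δ > 1`, with `V⁻ < V⁺`. -/
structure AssumptionA (V : ℂ → ℂ) (Vm Vp : ℝ) : Prop where
  lt : Vm < Vp
  real_on_real : ∀ x : ℝ, (V x).im = 0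
  sector : ∃ ε > (0 : ℝ), ∃ η > (0 : ℝ), ∃ δ > (1 : ℝ),
    AnalyticOnNhd ℂ V (Sector ε η) ∧
    (∃ C R : ℝ, ∀ x ∈ Sector ε η, R ≤ x.re →
      ‖V x - (Vp : ℂ)‖ ≤ C * (1 + ‖x‖ ^ 2) ^ (-(δ / 2))) ∧
    (∃ C R : ℝ, ∀ x ∈ Sector ε η, x.re ≤ -R →
      ‖V x - (Vm : ℂ)‖ ≤ C * (1 + ‖x‖ ^ 2) ^ (-(δ / 2)))

/-- `u = (u₁,u₂)` solves the one-dimensional Dirac equation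
`(-i h c σ₁ d/dx + m c² σ₃ + V(x) I₂) u = E u` on `ℝ`. -/
structure IsDiracSolution (hp m c : ℝ) (V : ℂ → ℂ) (E : ℝ) (u : ℝ → ℂ × ℂ) : Prop where
  diff1 : Differentiable ℝ fun x : ℝ => (u x).1
  diff2 : Differentiable ℝ fun x : ℝ => (u x).2
  eq1 : ∀ x : ℝ,
    -Complex.I * (hp : ℂ) * (c : ℂ) * deriv (fun y : ℝ => (u y).2) x
      + ((m : ℂ) * (c : ℂ) ^ 2 + V x) * (u x).1 = (E : ℂ) * (u x).1
  eq2 : ∀ x : ℝ,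
    -Complex.I * (hp : ℂ) * (c : ℂ) * deriv (fun y : ℝ => (u y).1) x
      + (-((m : ℂ) * (c : ℂ) ^ 2) + V x) * (u x).2 = (E : ℂ) * (u x).2

/-- `Φ(λ) = sgn(λ) √(λ² − m²c⁴)`. -/
def PhiF (m c lam : ℝ) : ℝ := Real.sign lam * Real.sqrt (lam ^ 2 - m ^ 2 * c ^ 4)

/-- `A(λ) = ((λ + mc²)/(λ − mc²))^{1/4}`. -/
def AmpF (m c lam : ℝ) : ℝ := ((lam + m * c ^ 2) / (lam - m * c ^ 2)) ^ ((1 : ℝ) / 4)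

/-- `u(x)` behaves exactly like `e^{θ x} v` along the filter `l`,
i.e. `u(x) e^{-θ x} → v`. -/
def JostAsymp (u : ℝ → ℂ × ℂ) (θ : ℂ) (v : ℂ × ℂ) (l : Filter ℝ) : Prop :=
  Tendsto (fun x : ℝ => (u x).1 * Complex.exp (-(θ * (x : ℂ)))) l (𝓝 v.1) ∧
  Tendsto (fun x : ℝ => (u x).2 * Complex.exp (-(θ * (x : ℂ)))) l (𝓝 v.2)

/-- `u` behaves exactly like `exp(s (i/(hc)) Φ(E−V₀) x) · (A(E−V₀), s' A(E−V₀)⁻¹)`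
along `l`.  The Jost solutions `ω_in^±` correspond to `s = s' = ∓1`, `l = at±∞`,
and `ω_out^±` to `s = s' = ±1`, `l = at±∞`. -/
def JostCond (hp m c E V0 s s' : ℝ) (l : Filter ℝ) (u : ℝ → ℂ × ℂ) : Prop :=
  JostAsymp u ((s : ℂ) * Complex.I / ((hp : ℂ) * (c : ℂ)) * ((PhiF m c (E - V0) : ℝ) : ℂ))
    (((AmpF m c (E - V0) : ℝ) : ℂ), (s' : ℂ) * (((AmpF m c (E - V0) : ℝ) : ℂ))⁻¹) l

/-- `B^± = ((mc² + E − V^±)/(mc² − E + V^±))^{1/4}`. -/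
def Bsym (m c E W : ℝ) : ℝ := ((m * c ^ 2 + E - W) / (m * c ^ 2 - E + W)) ^ ((1 : ℝ) / 4)

/-- The decaying Jost solution `ω_d^±` (for `s = ±1`, `l = at±∞`):
`ω_d^± ~ exp(∓ (1/(hc)) √(m²c⁴ − (V^± − E)²) x) (∓ i B^±, (B^±)⁻¹)`. -/
def DecayCond (hp m c E W s : ℝ) (l : Filter ℝ) (u : ℝ → ℂ × ℂ) : Prop :=
  JostAsymp u (-(s : ℂ) * ((Real.sqrt (m ^ 2 * c ^ 4 - (W - E) ^ 2) : ℝ) : ℂ) / ((hp : ℂ) * (c : ℂ)))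
    (-(s : ℂ) * Complex.I * ((Bsym m c E W : ℝ) : ℂ), (((Bsym m c E W : ℝ) : ℂ))⁻¹) l

/-- The defining relation `(ω_in^−, ω_in^+) = (ω_out^+, ω_out^−) · 𝕊` of the
scattering matrix. -/
def ScatRel (ωinm ωinp ωoutp ωoutm : ℝ → ℂ × ℂ) (S : Matrix (Fin 2) (Fin 2) ℂ) : Prop :=
  (∀ x : ℝ, ωinm x = S 0 0 • ωoutp x + S 1 0 • ωoutm x) ∧
  (∀ x : ℝ, ωinp x = S 0 1 • ωoutp x + S 1 1 • ωoutm x)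

/-- A classical analytic symbol (of non-negative order `mo`) in the semiclassical
parameter `h`: there are coefficients `a j` with `‖a j‖ ≤ C^{j+1} j^j` such that
`f(h) − ∑_{0 ≤ j ≤ h⁻¹/(e C₁)} a j h^{mo+j}` is `O(e^{-ρ/h})` for every `C₁ > C`. -/
def IsCAS (f : ℝ → ℂ) : Prop :=
  ∃ (mo : ℕ) (a : ℕ → ℂ) (C : ℝ), 0 < C ∧
    (∀ j : ℕ, ‖a j‖ ≤ C ^ (j + 1) * (j : ℝ) ^ j) ∧
    ∀ C₁ : ℝ, C < C₁ → ∃ ρ > (0 : ℝ), ∃ M : ℝ,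
      ∀ h : ℝ, 0 < h → h < 1 →
        ‖f h - ∑ j ∈ Finset.range (⌊1 / (h * Real.exp 1 * C₁)⌋₊ + 1), a j * (h : ℂ) ^ (mo + j)‖
          ≤ M * Real.exp (-ρ / h)

/-- `E^± = (−m²c⁴ + (V^± − E)²)/c²`. -/
def Esym (m c E W : ℝ) : ℝ := (-(m ^ 2 * c ^ 4) + (W - E) ^ 2) / c ^ 2

/-- `Q^±(t,E) = √((−m²c⁴ + (V(t) − E)²)/c²) − √(E^±)` (here `W = V^±`). -/
def Qsym (m c E W : ℝ) (V : ℂ → ℂ) (t : ℝ) : ℝ :=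
  Real.sqrt ((-(m ^ 2 * c ^ 4) + ((V t).re - E) ^ 2) / c ^ 2) - Real.sqrt (Esym m c E W)

/-- `Q₋^±(t,E) = √((m²c⁴ − (V(t) − E)²)/c²) − √(−E^±)` (here `W = V^±`). -/
def Qminus (m c E W : ℝ) (V : ℂ → ℂ) (t : ℝ) : ℝ :=
  Real.sqrt ((m ^ 2 * c ^ 4 - ((V t).re - E) ^ 2) / c ^ 2) - Real.sqrt (-(Esym m c E W))

/-- The classical action `S(E)` between the turning points. -/
def SAct (m c E : ℝ) (V : ℂ → ℂ) (t₁ t₂ : ℝ) : ℝ :=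
  ∫ t in t₁..t₂, Real.sqrt ((m ^ 2 * c ^ 4 - ((V t).re - E) ^ 2) / c ^ 2)

/-- The phase `T(E)`. -/
def TPhase (m c E Vm Vp : ℝ) (V : ℂ → ℂ) (t₁ t₂ : ℝ) : ℝ :=
  (∫ t in Set.Iic t₁, Qsym m c E Vm V t) - (∫ t in Set.Ici t₂, Qsym m c E Vp V t)
    + t₁ * Real.sqrt (Esym m c E Vm) + t₂ * Real.sqrt (Esym m c E Vp)

/-- The Wronskian of two vectors in `ℂ²`. -/
def Wron (u v : ℂ × ℂ) : ℂ := u.1 * v.2 - u.2 * v.1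

end

section Gevrey

lemma iteratedDeriv_eq_zero_of_norm_le_pow {D : ℂ → ℂ} (hD : AnalyticAt ℂ D 0) {N : ℕ} {K δ : ℝ}
    (hδ : 0 < δ) (hK : ∀ h : ℂ, ‖h‖ < δ → ‖D h‖ ≤ K * ‖h‖ ^ N) {j : ℕ} (hj : j < N) :
    iteratedDeriv j D 0 = 0 := by
  suffices h : (N : ℕ∞) ≤ analyticOrderAt D 0 from
    (natCast_le_analyticOrderAt_iff_iteratedDeriv_eq_zero hD).1 h j hj
  by_contra! hlt
  obtain ⟨k, hk⟩ := ENat.ne_top_iff_exists.1 (ne_top_of_lt hlt)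
  rw [← hk] at hlt
  have hkN : k < N := by exact_mod_cast hlt
  obtain ⟨g, hg, hg0, hge⟩ := (hD.analyticOrderAt_eq_natCast).1 hk.symm
  have hbd : ∀ᶠ h in 𝓝[≠] (0 : ℂ), ‖g h‖ ≤ K * ‖h‖ ^ (N - k) := by
    have h1 : ∀ᶠ h in 𝓝[≠] (0 : ℂ), D h = (h - 0) ^ k • g h := hge.filter_mono nhdsWithin_le_nhds
    have h2 : ∀ᶠ h in 𝓝[≠] (0 : ℂ), ‖h‖ < δ :=
      ((continuous_norm.tendsto' (0 : ℂ) 0 norm_zero).eventually (gt_mem_nhds hδ)).filter_mono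
        nhdsWithin_le_nhds
    filter_upwards [h1, h2, self_mem_nhdsWithin] with h e1 e2 e3
    have hpos : 0 < ‖h‖ := norm_pos_iff.2 e3
    have := hK h e2
    rw [e1, sub_zero, norm_smul, norm_pow, ← Nat.add_sub_of_le hkN.le, pow_add] at this
    have hp : 0 < ‖h‖ ^ k := pow_pos hpos k
    have h3 : ‖h‖ ^ k * ‖g h‖ ≤ ‖h‖ ^ k * (K * ‖h‖ ^ (N - k)) := by linarith
    exact le_of_mul_le_mul_left h3 hp
  have hlim : Tendsto (fun h : ℂ => K * ‖h‖ ^ (N - k)) (𝓝[≠] 0) (𝓝 0) := by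
    have : Continuous fun h : ℂ => K * ‖h‖ ^ (N - k) := by fun_prop
    have h0 := this.tendsto 0
    simp only [norm_zero, zero_pow (Nat.sub_ne_zero_of_lt hkN), mul_zero] at h0
    exact h0.mono_left nhdsWithin_le_nhds
  have hlim2 : Tendsto (fun h : ℂ => ‖g h‖) (𝓝[≠] 0) (𝓝 ‖g 0‖) :=
    (hg.continuousAt.norm.tendsto).mono_left nhdsWithin_le_nhds
  have := le_of_tendsto_of_tendsto hlim2 hlim hbd
  exact hg0 (norm_le_zero_iff.1 this)

lemma inv_mul_exp_le {r h : ℝ} (hr : 0 < r) (hh : 0 < h) :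
    1 / h * Real.exp (-(2 * r) / h) ≤ 1 / r * Real.exp (-r / h) := by
  have h1 : r / h ≤ Real.exp (r / h) := by linarith [Real.add_one_le_exp (r / h)]
  have h2 : Real.exp (-(2 * r) / h) = Real.exp (-r / h) * (Real.exp (r / h))⁻¹ := by
    rw [← Real.exp_neg, ← Real.exp_add]; congr 1; ring
  have h3 : 0 < Real.exp (r / h) := Real.exp_pos _
  rw [h2, show 1 / h = 1 / r * (r / h) by field_simp]
  have h4 : r / h * (Real.exp (r / h))⁻¹ ≤ 1 := by
    rw [← div_eq_mul_inv, div_le_one h3]; exact h1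
  have h5 : 0 < Real.exp (-r / h) := Real.exp_pos _
  have h6 : 0 < 1 / r := by positivity
  calc 1 / r * (r / h) * (Real.exp (-r / h) * (Real.exp (r / h))⁻¹)
      = 1 / r * Real.exp (-r / h) * (r / h * (Real.exp (r / h))⁻¹) := by ring
    _ ≤ 1 / r * Real.exp (-r / h) * 1 := by gcongr
    _ = _ := by ring

/-- Approximation by functions holomorphic and bounded on discs of radius `ρ / N`, up to
exponentially small errors for `N ∼ ρ / (4 h)`, yields a classical analytic symbol. -/
theorem exists_isCAS_of_approx {g : ℝ → ℂ} {G : ℕ → ℂ → ℂ} {ρ M σ h₀ : ℝ} (hρ : 0 < ρ)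
    (hσ : 0 < σ) (hh₀ : 0 < h₀)
    (hG : ∀ N : ℕ, 1 ≤ N → DifferentiableOn ℂ (G N) (Metric.ball 0 (ρ / N)))
    (hM : ∀ N : ℕ, 1 ≤ N → ∀ h ∈ Metric.ball (0 : ℂ) (ρ / N), ‖G N h‖ ≤ M)
    (hstab : ∀ N : ℕ, 1 ≤ N → ∃ K : ℝ, ∃ δ > (0 : ℝ), ∀ h : ℂ, ‖h‖ < δ →
      ‖G (N + 1) h - G N h‖ ≤ K * ‖h‖ ^ N)
    (hG0 : ∀ N : ℕ, 1 ≤ N → G N 0 = 1)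
    (happ : ∀ h : ℝ, 0 < h → h < h₀ → ∀ N : ℕ, 1 ≤ N → N * h ≤ ρ / 4 → ρ / 4 < (N + 1) * h →
      ‖g h - G N h‖ ≤ M * Real.exp (-σ / h)) :
    ∃ φ : ℝ → ℂ, IsCAS φ ∧ ∃ h₁ > (0 : ℝ), ∀ h : ℝ, 0 < h → h < h₁ → g h = 1 + h * φ h := by
  set c : ℕ → ℕ → ℂ := fun N j => ((j.factorial : ℂ))⁻¹ * iteratedDeriv j (G N) 0 with hc
  have hM0 : 0 ≤ M := (norm_nonneg _).trans
    (hM 1 le_rfl 0 (Metric.mem_ball_self (by positivity)))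
  have hcb : ∀ N : ℕ, 1 ≤ N → ∀ j, ‖c N j‖ ≤ M * (2 * N / ρ) ^ j := by
    intro N hN j
    have hNpos : (0 : ℝ) < N := by exact_mod_cast hN
    have hsub : Metric.closedBall (0 : ℂ) (ρ / (2 * N)) ⊆ Metric.ball 0 (ρ / N) := by
      apply Metric.closedBall_subset_ball
      apply div_lt_div_of_pos_left hρ hNpos; linarith
    have := Complex.norm_iteratedDeriv_le_of_forall_mem_sphere_norm_le (c := (0 : ℂ))
      (R := ρ / (2 * N)) (C := M) (f := G N) j (by positivity)
      ((hG N hN).diffContOnCl_ball hsub)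
      (fun z hz => hM N hN z (hsub (Metric.sphere_subset_closedBall hz)))
    simp only [hc, norm_mul, norm_inv, Complex.norm_natCast]
    have hf : (0 : ℝ) < j.factorial := by exact_mod_cast j.factorial_pos
    rw [inv_mul_le_iff₀ hf]
    refine this.trans (le_of_eq ?_)
    rw [div_pow, div_pow]; field_simp
  have hsum : ∀ N : ℕ, 1 ≤ N → ∀ h ∈ Metric.ball (0 : ℂ) (ρ / N),
      HasSum (fun j => c N j * h ^ j) (G N h) := by
    intro N hN h hh
    have := Complex.hasSum_taylorSeries_on_ball (hG N hN) hh
    have e1 : (fun n : ℕ => (n.factorial : ℂ)⁻¹ • (h - 0) ^ n • iteratedDeriv n (G N) 0)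
        = fun j => c N j * h ^ j := by
      ext j
      simp only [hc, sub_zero, smul_eq_mul]; ring
    rwa [e1] at this
  have han : ∀ N : ℕ, 1 ≤ N → AnalyticAt ℂ (G N) 0 := fun N hN => by
    have hNpos : (0 : ℝ) < N := by exact_mod_cast hN
    exact (hG N hN).analyticAt (Metric.isOpen_ball.mem_nhds (Metric.mem_ball_self (by positivity)))
  have hst1 : ∀ N : ℕ, 1 ≤ N → ∀ j < N, c (N + 1) j = c N j := by
    intro N hN j hj
    obtain ⟨K, δ, hδ, hK⟩ := hstab N hN
    have h1 := han N hN
    have h2 := han (N + 1) (by omega)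
    have := iteratedDeriv_eq_zero_of_norm_le_pow (h2.sub h1) hδ (by simpa using hK) hj
    have h3 : iteratedDeriv j (G (N + 1) - G N) 0
        = iteratedDeriv j (G (N + 1)) 0 - iteratedDeriv j (G N) 0 :=
      iteratedDeriv_sub (h2.contDiffAt) (h1.contDiffAt)
    rw [h3, sub_eq_zero] at this
    simp only [hc, this]
  have hst : ∀ j N : ℕ, j + 1 ≤ N → c N j = c (j + 1) j := by
    intro j N hN
    induction N, hN using Nat.le_induction with
    | base => rfl
    | succ n hn ih => rw [hst1 n (by omega) j (by omega), ih]
  set b : ℕ → ℂ := fun j => c (j + 2) (j + 1) with hb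
  have hc0 : ∀ N : ℕ, 1 ≤ N → c N 0 = 1 := fun N hN => by simp [hc, hG0 N hN]
  set C : ℝ := max M 1 * (12 / ρ) with hC
  have hCpos : 0 < C := by positivity
  have hbb : ∀ j, ‖b j‖ ≤ C ^ (j + 1) * (j : ℝ) ^ j := by
    intro j
    have h1 := hcb (j + 2) (by omega) (j + 1)
    have hMM : M ≤ (max M 1) ^ (j + 1) :=
      (le_max_left M 1).trans (le_self_pow₀ (le_max_right M 1) (by omega))
    have h2 : (2 * ((j + 2 : ℕ) : ℝ) / ρ) ^ (j + 1) ≤ (12 / ρ) ^ (j + 1) * (j : ℝ) ^ j := by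
      rcases Nat.eq_zero_or_pos j with rfl | hj
      · norm_num; gcongr; norm_num
      · have hj1 : (1 : ℝ) ≤ j := by exact_mod_cast hj
        have h3 : (2 * ((j + 2 : ℕ) : ℝ) / ρ) ≤ (6 / ρ) * j := by
          rw [div_mul_eq_mul_div]
          apply div_le_div_of_nonneg_right _ hρ.le
          push_cast; linarith
        have h4 : (j : ℝ) ≤ 2 ^ (j + 1) := by
          have : j < 2 ^ j := Nat.lt_two_pow_self
          have h5 : (j : ℝ) < 2 ^ j := by exact_mod_cast this
          rw [pow_succ]; linarith
        calc (2 * ((j + 2 : ℕ) : ℝ) / ρ) ^ (j + 1) ≤ ((6 / ρ) * j) ^ (j + 1) := by gcongr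
          _ = (6 / ρ) ^ (j + 1) * (j : ℝ) ^ j * j := by rw [mul_pow]; ring
          _ ≤ (6 / ρ) ^ (j + 1) * (j : ℝ) ^ j * 2 ^ (j + 1) := by gcongr
          _ = (12 / ρ) ^ (j + 1) * (j : ℝ) ^ j := by
            rw [show (12 : ℝ) / ρ = 6 / ρ * 2 by ring, mul_pow]; ring
    calc ‖b j‖ ≤ M * (2 * ((j + 2 : ℕ) : ℝ) / ρ) ^ (j + 1) := h1
      _ ≤ (max M 1) ^ (j + 1) * ((12 / ρ) ^ (j + 1) * (j : ℝ) ^ j) := by gcongr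
      _ = _ := by rw [hC, mul_pow]; ring
  set h₁ : ℝ := min h₀ (min (ρ / 24) (1 / 2)) with hh₁
  have hh₁pos : 0 < h₁ := by positivity
  set φ : ℝ → ℂ := fun h => if h < h₁ then (g h - 1) / h else 0 with hφ
  refine ⟨φ, ⟨0, b, C, hCpos, hbb, ?_⟩, h₁, hh₁pos, ?_⟩
  · intro C₁ hC₁
    have hC₁pos : 0 < C₁ := hCpos.trans hC₁
    set r : ℝ := min σ (Real.log 2 / (Real.exp 1 * C₁)) / 2 with hr
    have hlog2 : 0 < Real.log 2 := Real.log_pos (by norm_num)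
    have hrpos : 0 < r := by positivity
    set K : ℕ := ⌊1 / (h₁ * Real.exp 1 * C₁)⌋₊ + 1 with hK
    set Sb : ℝ := ∑ j ∈ Finset.range K, ‖b j‖ with hSb
    have hSb0 : 0 ≤ Sb := Finset.sum_nonneg fun _ _ => norm_nonneg _
    refine ⟨r, hrpos, 3 * M / r + Sb * Real.exp (r / h₁), ?_⟩
    intro h hpos hlt1
    have hexpos : 0 < Real.exp (-r / h) := Real.exp_pos _
    by_cases hlt : h < h₁
    · simp only [hφ, if_pos hlt, zero_add]
      have hh0 : h < h₀ := hlt.trans_le (min_le_left _ _)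
      have hh24 : h < ρ / 24 := hlt.trans_le ((min_le_right _ _).trans (min_le_left _ _))
      set m : ℕ := ⌊1 / (h * Real.exp 1 * C₁)⌋₊ with hm
      set N : ℕ := ⌊ρ / 4 / h⌋₊ with hN
      have hN1 : N * h ≤ ρ / 4 := by
        have := Nat.floor_le (show 0 ≤ ρ / 4 / h by positivity)
        rwa [le_div_iff₀ hpos] at this
      have hN2 : ρ / 4 < (N + 1) * h := by
        have := Nat.lt_floor_add_one (ρ / 4 / h)
        rwa [div_lt_iff₀ hpos] at this
      have he : (1 : ℝ) ≤ Real.exp 1 := Real.one_le_exp (by norm_num)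
      have hmle : (m : ℝ) ≤ 1 / (h * Real.exp 1 * C₁) := Nat.floor_le (by positivity)
      have hmlt : 1 / (h * Real.exp 1 * C₁) < m + 1 := Nat.lt_floor_add_one _
      have hmN : m + 2 ≤ N := by
        have hCge : 12 / ρ ≤ C₁ := by
          refine le_trans ?_ hC₁.le
          rw [hC]
          have : (1 : ℝ) ≤ max M 1 := le_max_right _ _
          have h12 : 0 < 12 / ρ := by positivity
          nlinarith
        have h1 : 12 / ρ * h ≤ h * Real.exp 1 * C₁ := by
          have : 12 / ρ * h * 1 ≤ C₁ * h * Real.exp 1 := by gcongr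
          linarith
        have h2 : 1 / (h * Real.exp 1 * C₁) ≤ 1 / (12 / ρ * h) := by
          apply one_div_le_one_div_of_le (by positivity) h1
        have h3 : 1 / (12 / ρ * h) * h = ρ / 12 := by field_simp
        have h4 : (m : ℝ) * h ≤ ρ / 12 := by
          rw [← h3]; gcongr; exact hmle.trans h2
        have h5 : ((m : ℝ) + 3) * h < (N + 1) * h := by nlinarith
        have h6 := lt_of_mul_lt_mul_right h5 hpos.le
        have h7 : m + 3 < N + 1 := by exact_mod_cast h6
        omega
      have hNone : 1 ≤ N := by omega
      have hNpos : (0 : ℝ) < N := by exact_mod_cast hNone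
      have hball : (h : ℂ) ∈ Metric.ball (0 : ℂ) (ρ / N) := by
        rw [mem_ball_zero_iff, Complex.norm_real, Real.norm_of_nonneg hpos.le, lt_div_iff₀ hNpos]
        linarith
      have herr := happ h hpos hh0 N hNone hN1 hN2
      have hS := hsum N hNone h hball
      have hterm : ∀ j, ‖c N j * (h : ℂ) ^ j‖ ≤ M * (1 / 2) ^ j := by
        intro j
        rw [norm_mul, norm_pow, Complex.norm_real, Real.norm_of_nonneg hpos.le]
        calc ‖c N j‖ * h ^ j ≤ M * (2 * N / ρ) ^ j * h ^ j := by gcongr; exact hcb N hNone j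
          _ = M * (2 * N / ρ * h) ^ j := by rw [mul_pow]; ring
          _ ≤ M * (1 / 2) ^ j := by
            gcongr
            rw [div_mul_eq_mul_div, div_le_iff₀ hρ]; linarith
      have htail : ‖G N h - ∑ j ∈ Finset.range (m + 2), c N j * (h : ℂ) ^ j‖
          ≤ 2 * M * (1 / 2) ^ (m + 2) := by
        have h1 := (hasSum_nat_add_iff' (m + 2)).2 hS
        have h2 : HasSum (fun i => M * (1 / 2 : ℝ) ^ (i + (m + 2))) (2 * M * (1 / 2) ^ (m + 2)) := by
          have := (hasSum_geometric_of_lt_one (r := (1 / 2 : ℝ)) (by norm_num)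
            (by norm_num)).mul_left (M * (1 / 2) ^ (m + 2))
          have e1 : (fun i => M * (1 / 2) ^ (m + 2) * (1 / 2 : ℝ) ^ i)
              = fun i => M * (1 / 2 : ℝ) ^ (i + (m + 2)) := by
            ext i; rw [pow_add]; ring
          have e2 : M * (1 / 2 : ℝ) ^ (m + 2) * (1 - 1 / 2)⁻¹ = 2 * M * (1 / 2) ^ (m + 2) := by
            norm_num; ring
          rwa [e1, e2] at this
        rw [← h1.tsum_eq]
        exact tsum_of_norm_bounded h2 fun i => hterm _
      have hid : (g h - 1) / h - ∑ j ∈ Finset.range (m + 1), b j * (h : ℂ) ^ j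
          = ((g h - G N h) + (G N h - ∑ j ∈ Finset.range (m + 2), c N j * (h : ℂ) ^ j)) / h := by
        have hne : (h : ℂ) ≠ 0 := by exact_mod_cast hpos.ne'
        have h1 : ∑ j ∈ Finset.range (m + 2), c N j * (h : ℂ) ^ j
            = (h : ℂ) * (∑ j ∈ Finset.range (m + 1), b j * (h : ℂ) ^ j) + 1 := by
          rw [Finset.sum_range_succ', hc0 N hNone, Finset.mul_sum]
          simp only [pow_zero, mul_one]
          congr 1
          refine Finset.sum_congr rfl fun j hj => ?_
          have hj' := Finset.mem_range.1 hj
          rw [hst (j + 1) N (by omega)]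
          simp only [hb]; ring
        rw [h1]; field_simp; ring
      rw [hid, norm_div, Complex.norm_real, Real.norm_of_nonneg hpos.le]
      have hpow : (1 / 2 : ℝ) ^ (m + 2) ≤ Real.exp (-(2 * r) / h) := by
        have h1 : (1 / 2 : ℝ) ^ (m + 2) = Real.exp (-(Real.log 2 * ((m : ℝ) + 2))) := by
          rw [Real.exp_neg, ← Real.rpow_def_of_pos (by norm_num : (0 : ℝ) < 2), one_div, inv_pow]
          congr 1
          rw [← Real.rpow_natCast]; push_cast; rfl
        rw [h1, Real.exp_le_exp]
        have h2 : 2 * r ≤ Real.log 2 / (Real.exp 1 * C₁) := by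
          rw [hr]; linarith [min_le_right σ (Real.log 2 / (Real.exp 1 * C₁))]
        have h3 : 2 * r / h ≤ Real.log 2 * ((m : ℝ) + 2) := by
          calc 2 * r / h ≤ Real.log 2 / (Real.exp 1 * C₁) / h := by gcongr
            _ = Real.log 2 * (1 / (h * Real.exp 1 * C₁)) := by field_simp
            _ ≤ Real.log 2 * ((m : ℝ) + 2) := by gcongr; linarith
        rw [neg_div]; linarith
      have hexp : Real.exp (-σ / h) ≤ Real.exp (-(2 * r) / h) := by
        rw [Real.exp_le_exp]
        have : 2 * r ≤ σ := by
          rw [hr]; linarith [min_le_left σ (Real.log 2 / (Real.exp 1 * C₁))]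
        gcongr
      calc _ ≤ (M * Real.exp (-σ / h) + 2 * M * (1 / 2) ^ (m + 2)) / h := by
            gcongr; exact (norm_add_le _ _).trans (add_le_add herr htail)
        _ ≤ (M * Real.exp (-(2 * r) / h) + 2 * M * Real.exp (-(2 * r) / h)) / h := by gcongr
        _ = 3 * M * (1 / h * Real.exp (-(2 * r) / h)) := by ring
        _ ≤ 3 * M * (1 / r * Real.exp (-r / h)) :=
          mul_le_mul_of_nonneg_left (inv_mul_exp_le hrpos hpos) (by positivity)
        _ = 3 * M / r * Real.exp (-r / h) := by ring
        _ ≤ _ := by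
          apply mul_le_mul_of_nonneg_right _ hexpos.le
          have := Real.exp_pos (r / h₁)
          nlinarith
    · push Not at hlt
      simp only [hφ, if_neg (not_lt.2 hlt), zero_add, zero_sub, norm_neg]
      calc _ ≤ ∑ j ∈ Finset.range (⌊1 / (h * Real.exp 1 * C₁)⌋₊ + 1), ‖b j‖ := by
            refine (norm_sum_le _ _).trans (Finset.sum_le_sum fun j _ => ?_)
            rw [norm_mul, norm_pow, Complex.norm_real, Real.norm_of_nonneg hpos.le]
            exact mul_le_of_le_one_right (norm_nonneg _) (pow_le_one₀ hpos.le hlt1.le)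
        _ ≤ Sb := by
            apply Finset.sum_le_sum_of_subset_of_nonneg _ (fun _ _ _ => norm_nonneg _)
            apply Finset.range_mono
            rw [hK]
            gcongr
        _ ≤ Sb * (Real.exp (r / h₁) * Real.exp (-r / h)) := by
            apply le_mul_of_one_le_right hSb0
            rw [← Real.exp_add]
            apply Real.one_le_exp
            have : r / h ≤ r / h₁ := by gcongr
            rw [neg_div]; linarith
        _ = Sb * Real.exp (r / h₁) * Real.exp (-r / h) := by ring
        _ ≤ _ := by
            apply mul_le_mul_of_nonneg_right _ hexpos.le
            have : 0 ≤ 3 * M / r := by positivity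
            linarith
  · intro h hpos hlt
    simp only [hφ, if_pos hlt]
    have hne : (h : ℂ) ≠ 0 := by exact_mod_cast hpos.ne'
    field_simp; ring

end Gevrey

section Approximants

/-- Iterates of the map `q ↦ h w (∂_z q + ν - ν q²)` started at `0`, as functions of `(z, h)`. -/
noncomputable def riccatiIter (w ν : ℂ → ℂ) : ℕ → ℂ × ℂ → ℂ
  | 0 => 0
  | n + 1 => fun x => x.2 * w x.1 *
      (fderiv ℂ (riccatiIter w ν n) x (1, 0) + ν x.1 - ν x.1 * riccatiIter w ν n x ^ 2)

variable {w ν : ℂ → ℂ} {U : Set ℂ}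

lemma riccatiIter_analytic (hw : AnalyticOnNhd ℂ w U) (hν : AnalyticOnNhd ℂ ν U)
    (n : ℕ) : AnalyticOnNhd ℂ (riccatiIter w ν n) (U ×ˢ univ) := by
  induction n with
  | zero => exact analyticOnNhd_const
  | succ n ih =>
    have h1 : AnalyticOnNhd ℂ (fun x : ℂ × ℂ => w x.1) (U ×ˢ univ) := fun x hx =>
      (hw x.1 hx.1).comp analyticAt_fst
    have h2 : AnalyticOnNhd ℂ (fun x : ℂ × ℂ => ν x.1) (U ×ˢ univ) := fun x hx =>
      (hν x.1 hx.1).comp analyticAt_fst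
    have h3 : AnalyticOnNhd ℂ (fun x => fderiv ℂ (riccatiIter w ν n) x (1, 0)) (U ×ˢ univ) :=
      fun x hx =>
      ((ContinuousLinearMap.apply ℂ ℂ ((1 : ℂ), (0 : ℂ))).analyticAt _).comp (ih.fderiv x hx)
    intro x hx
    have := ((analyticAt_snd (p := x)).mul (h1 x hx)).mul
      (((h3 x hx).add (h2 x hx)).sub ((h2 x hx).mul ((ih x hx).pow 2)))
    exact this

lemma riccatiIter_hasDerivAt (hw : AnalyticOnNhd ℂ w U)
    (hν : AnalyticOnNhd ℂ ν U) (n : ℕ) {z : ℂ} (hz : z ∈ U) (h : ℂ) :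
    HasDerivAt (fun z => riccatiIter w ν n (z, h)) (fderiv ℂ (riccatiIter w ν n) (z, h) (1, 0)) z :=
  by
  have h1 := ((riccatiIter_analytic hw hν n) (z, h) ⟨hz, mem_univ _⟩).differentiableAt.hasFDerivAt
  have h2 : HasDerivAt (fun z : ℂ => (z, h)) ((1 : ℂ), (0 : ℂ)) z :=
    (hasDerivAt_id z).prodMk (hasDerivAt_const z h)
  exact h1.comp_hasDerivAt z h2

lemma riccatiIter_succ (n : ℕ) (x : ℂ × ℂ) : riccatiIter w ν (n + 1) x = x.2 * w x.1 *
      (fderiv ℂ (riccatiIter w ν n) x (1, 0) + ν x.1 - ν x.1 * riccatiIter w ν n x ^ 2) := rfl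

set_option maxHeartbeats 800000 in
/-- Uniform bounds for the Riccati iterates on the points whose `r`-neighbourhood lies in `U`. -/
lemma exists_riccatiIter_bound {C κ r : ℝ} {ω : ℂ → ℝ}
    (hw : AnalyticOnNhd ℂ w U) (hν : AnalyticOnNhd ℂ ν U) (hC : 1 ≤ C) (hκ : 1 ≤ κ) (hr : 0 < r)
    (hω0 : ∀ z, 0 ≤ ω z) (hω1 : ∀ z, ω z ≤ 1)
    (hω : ∀ z z', ‖z' - z‖ ≤ r → ω z' ≤ κ * ω z)
    (hwb : ∀ z ∈ U, ‖w z‖ ≤ C) (hνb : ∀ z ∈ U, ‖ν z‖ ≤ C * ω z) :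
    ∃ ρ > 0, ∃ B : ℝ, 1 ≤ B ∧ ρ * B ≤ 1 / 2 ∧ ∀ N : ℕ, 1 ≤ N → ∀ h : ℂ, ‖h‖ * N ≤ ρ →
      ∀ z, Metric.closedBall z r ⊆ U →
      (∀ n ≤ N + 1, ‖riccatiIter w ν n (z, h)‖ ≤ B * ‖h‖ * ω z) ∧
      (∀ n ≤ N, ‖riccatiIter w ν (n + 1) (z, h) - riccatiIter w ν n (z, h)‖
        ≤ B * ‖h‖ * ω z * (‖h‖ * N / (2 * ρ)) ^ n) := by
  set B : ℝ := 3 * C ^ 2 with hB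
  have hCC : 1 ≤ C ^ 2 := one_le_pow₀ hC
  have hB1 : 1 ≤ B := by rw [hB]; linarith
  set Z : ℝ := 6 * C * κ / r + 4 * C * B + 2 * B with hZ
  have hZ1 : 1 ≤ Z := by
    have : 0 ≤ 6 * C * κ / r := by positivity
    have : 0 ≤ 4 * C * B := by positivity
    rw [hZ]; linarith
  set ρ : ℝ := 1 / Z with hρdef
  have hZpos : 0 < Z := by linarith
  have hρ : 0 < ρ := by positivity
  have hρZ : ρ * Z = 1 := by rw [hρdef]; field_simp
  have hρ1 : ρ ≤ 1 := by rw [hρdef, div_le_one hZpos]; exact hZ1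
  have hsplit : ρ * (6 * C * κ / r) + ρ * (4 * C * B) + ρ * (2 * B) = 1 := by
    rw [← hρZ, hZ]; ring
  have hs1 : 0 ≤ ρ * (6 * C * κ / r) := by positivity
  have hs2 : 0 ≤ ρ * (4 * C * B) := by positivity
  have hs3 : 0 ≤ ρ * (2 * B) := by positivity
  refine ⟨ρ, hρ, B, hB1, by linarith, ?_⟩
  intro N hN h hh
  have hN1 : (1 : ℝ) ≤ N := by exact_mod_cast hN
  have hhρ : ‖h‖ ≤ ρ := by nlinarith [norm_nonneg h]
  set s : ℝ := r / (N + 1) with hs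
  have hspos : 0 < s := by positivity
  have hsr : s ≤ r := by rw [hs]; apply div_le_self hr.le; linarith
  have hinv : 1 / s ≤ 2 * N / r := by
    rw [hs, one_div_div]; gcongr; linarith
  -- Cauchy estimate with a fixed loss of width
  have cauchy : ∀ (F : ℂ → ℂ) (F' : ℂ) (t K : ℝ) (z : ℂ), 0 ≤ t → 0 ≤ K →
      (∀ z ∈ U, DifferentiableAt ℂ F z) → HasDerivAt F F' z →
      (∀ z, Metric.closedBall z t ⊆ U → ‖F z‖ ≤ K * ω z) → Metric.closedBall z (t + s) ⊆ U →
      ‖F'‖ ≤ K * κ * ω z * (2 * N / r) := by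
    intro F F' t K z ht hK hF hF' hb hz
    rw [← hF'.deriv]
    have hsub : Metric.closedBall z s ⊆ U :=
      (Metric.closedBall_subset_closedBall (by linarith)).trans hz
    have := Complex.norm_deriv_le_of_forall_mem_sphere_norm_le (c := z) (R := s)
      (C := K * (κ * ω z)) (f := F) hspos
      ((show DifferentiableOn ℂ F U from fun z hz =>
        (hF z hz).differentiableWithinAt).diffContOnCl_ball hsub)
      (fun z' hz' => by
        have hd : ‖z' - z‖ = s := by simpa [dist_eq_norm] using hz'
        refine (hb z' ?_).trans ?_
        · refine (Metric.closedBall_subset_closedBall' ?_).trans hz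
          rw [dist_eq_norm, hd]
        · gcongr
          exact hω z z' (by rw [hd]; exact hsr))
    refine this.trans ?_
    rw [div_eq_mul_one_div]
    have h0 := hω0 z
    calc K * (κ * ω z) * (1 / s) ≤ K * (κ * ω z) * (2 * N / r) := by gcongr
      _ = _ := by ring
  have hdiff : ∀ n, ∀ z ∈ U, DifferentiableAt ℂ (fun z => riccatiIter w ν n (z, h)) z :=
    fun n z hz => (riccatiIter_hasDerivAt hw hν n hz h).differentiableAt
  have memU : ∀ t z, 0 ≤ t → Metric.closedBall z t ⊆ U → z ∈ U := fun t z ht hz =>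
    hz (Metric.mem_closedBall_self ht)
  have key : ∀ n : ℕ, ∀ z, Metric.closedBall z (n * s) ⊆ U →
      ‖riccatiIter w ν n (z, h)‖ ≤ B * ‖h‖ * ω z := by
    intro n
    induction n with
    | zero =>
      intro z _
      have := hω0 z
      simp only [riccatiIter, Pi.zero_apply, norm_zero]
      positivity
    | succ n ih =>
      intro z hz
      have hz' : Metric.closedBall z (n * s + s) ⊆ U := by
        convert hz using 2; push_cast; ring
      have hzU := memU _ z (by positivity) hz
      have hw0 := hω0 z
      have hw1 := hω1 z
      have h1 := cauchy _ _ (n * s) (B * ‖h‖) z (by positivity) (by positivity) (hdiff n)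
        (riccatiIter_hasDerivAt hw hν n hzU h) ih hz'
      have h2 := ih z ((Metric.closedBall_subset_closedBall (by linarith)).trans hz')
      have h3 : ‖ν z * riccatiIter w ν n (z, h) ^ 2‖ ≤ C * ω z * (B * ‖h‖) ^ 2 := by
        rw [norm_mul, norm_pow]
        have : ‖riccatiIter w ν n (z, h)‖ ≤ B * ‖h‖ := h2.trans
          (mul_le_of_le_one_right (by positivity) hw1)
        gcongr
        exact hνb z hzU
      rw [riccatiIter_succ, norm_mul, norm_mul]
      calc ‖h‖ * ‖w z‖ * ‖_‖
          ≤ ‖h‖ * C * (B * ‖h‖ * κ * ω z * (2 * N / r) + C * ω z + C * ω z * (B * ‖h‖) ^ 2) := by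
            gcongr
            · exact hwb z hzU
            · exact (norm_sub_le _ _).trans (add_le_add ((norm_add_le _ _).trans
                (add_le_add h1 (hνb z hzU))) h3)
        _ = ‖h‖ * ω z * (B * (‖h‖ * N) * (2 * C * κ / r) + C ^ 2 + C ^ 2 * B ^ 2 * ‖h‖ ^ 2) := by
            ring
        _ ≤ ‖h‖ * ω z * (B * ρ * (2 * C * κ / r) + C ^ 2 + C ^ 2 * B ^ 2 * ρ ^ 2) := by
            gcongr
        _ ≤ ‖h‖ * ω z * B := by
            gcongr
            have e1 : ρ * (2 * C * κ / r) ≤ 1 / 3 := by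
              have : ρ * (6 * C * κ / r) = 3 * (ρ * (2 * C * κ / r)) := by ring
              linarith
            have e2 : C ^ 2 * B ^ 2 * ρ ^ 2 ≤ C ^ 2 / 4 * 1 := by
              have : ρ * B ≤ 1 / 2 := by linarith
              have h5 : (ρ * B) ^ 2 ≤ (1 / 2) ^ 2 := by gcongr
              nlinarith
            nlinarith
        _ = B * ‖h‖ * ω z := by ring
  have key2 : ∀ n : ℕ, ∀ z, Metric.closedBall z ((n + 1) * s) ⊆ U →
      ‖riccatiIter w ν (n + 1) (z, h) - riccatiIter w ν n (z, h)‖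
        ≤ B * ‖h‖ * (‖h‖ * N / (2 * ρ)) ^ n * ω z := by
    intro n
    induction n with
    | zero =>
      intro z hz
      have := key 1 z (by convert hz using 2; push_cast; ring)
      simpa [riccatiIter] using this
    | succ n ih =>
      intro z hz
      push_cast at hz
      have hz' : Metric.closedBall z ((n + 1) * s + s) ⊆ U := by
        convert hz using 2; ring
      have hzU := memU _ z (by positivity) hz
      have hw0 := hω0 z
      have hw1 := hω1 z
      have hd1 := (riccatiIter_hasDerivAt hw hν (n + 1) hzU h).sub
        (riccatiIter_hasDerivAt hw hν n hzU h)
      have h1 := cauchy _ _ ((n + 1) * s) (B * ‖h‖ * (‖h‖ * N / (2 * ρ)) ^ n) z (by positivity)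
        (by positivity) (fun z hz => (hdiff (n + 1) z hz).sub (hdiff n z hz)) hd1 ih hz'
      have h2 := ih z ((Metric.closedBall_subset_closedBall (by linarith)).trans hz')
      have h3 := key (n + 1) z ((Metric.closedBall_subset_closedBall
        (by push_cast; linarith)).trans hz')
      have h4 := key n z ((Metric.closedBall_subset_closedBall
        (by linarith)).trans hz')
      have e : riccatiIter w ν (n + 1 + 1) (z, h) - riccatiIter w ν (n + 1) (z, h)
          = h * w z * ((fderiv ℂ (riccatiIter w ν (n + 1)) (z, h) (1, 0)
              - fderiv ℂ (riccatiIter w ν n) (z, h) (1, 0))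
            - ν z * (riccatiIter w ν (n + 1) (z, h) + riccatiIter w ν n (z, h))
              * (riccatiIter w ν (n + 1) (z, h) - riccatiIter w ν n (z, h))) := by
        linear_combination riccatiIter_succ (w := w) (ν := ν) (n + 1) (z, h)
          - riccatiIter_succ (w := w) (ν := ν) n (z, h)
      set Y := B * ‖h‖ * (‖h‖ * N / (2 * ρ)) ^ n with hY
      have hY0 : 0 ≤ Y := by positivity
      have h5 : ‖ν z * (riccatiIter w ν (n + 1) (z, h) + riccatiIter w ν n (z, h))
              * (riccatiIter w ν (n + 1) (z, h) - riccatiIter w ν n (z, h))‖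
          ≤ C * (2 * B * ‖h‖) * (Y * ω z) := by
        rw [norm_mul, norm_mul]
        have a1 : ‖riccatiIter w ν (n + 1) (z, h) + riccatiIter w ν n (z, h)‖ ≤ 2 * B * ‖h‖ := by
          refine (norm_add_le _ _).trans ?_
          have : B * ‖h‖ * ω z ≤ B * ‖h‖ := mul_le_of_le_one_right (by positivity) hw1
          linarith
        have a2 : ‖ν z‖ ≤ C := (hνb z hzU).trans (mul_le_of_le_one_right (by linarith) hw1)
        gcongr
      rw [e, norm_mul, norm_mul]
      calc ‖h‖ * ‖w z‖ * ‖_‖ ≤ ‖h‖ * C * (Y * κ * ω z * (2 * N / r)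
              + C * (2 * B * ‖h‖) * (Y * ω z)) := by
            gcongr
            · exact hwb z hzU
            · exact (norm_sub_le _ _).trans (add_le_add h1 h5)
        _ = Y * ω z * (‖h‖ * (N * (2 * C * κ / r) + 2 * C ^ 2 * B * ‖h‖)) := by ring
        _ ≤ Y * ω z * (‖h‖ * N / (2 * ρ)) := by
            refine mul_le_mul_of_nonneg_left ?_ (by positivity)
            rw [show ‖h‖ * N / (2 * ρ) = ‖h‖ * (N / (2 * ρ)) by ring]
            refine mul_le_mul_of_nonneg_left ?_ (norm_nonneg h)
            rw [le_div_iff₀ (by positivity)]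
            have e1 : ρ * (2 * C * κ / r) ≤ 1 / 3 := by
              have : ρ * (6 * C * κ / r) = 3 * (ρ * (2 * C * κ / r)) := by ring
              linarith
            have e3 : C ^ 2 * ρ ≤ 1 / 6 := by
              have : ρ * (2 * B) = 6 * (C ^ 2 * ρ) := by rw [hB]; ring
              linarith
            have e4 : B * ‖h‖ ≤ 1 / 2 := by
              have : B * ‖h‖ ≤ B * ρ := by gcongr
              linarith
            have e5 : (C ^ 2 * ρ) * (B * ‖h‖) ≤ 1 / 6 * (1 / 2) := by gcongr
            nlinarith
        _ = _ := by rw [hY, pow_succ]; ring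
  intro z hz
  refine ⟨fun n hn => key n z ((Metric.closedBall_subset_closedBall ?_).trans hz), fun n hn => ?_⟩
  · have : (n : ℝ) ≤ N + 1 := by exact_mod_cast hn
    calc n * s ≤ (N + 1) * s := by gcongr
      _ = r := by rw [hs]; field_simp
  · have : (n : ℝ) ≤ N := by exact_mod_cast hn
    have h1 := key2 n z ((Metric.closedBall_subset_closedBall
      (show (n + 1) * s ≤ r by
        calc (n + 1) * s ≤ (N + 1) * s := by gcongr
          _ = r := by rw [hs]; field_simp)).trans hz)
    linarith

end Approximants

section Segment

/-- Energy estimate for a triangular-dominated linear system. -/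
lemma energy_estimate {x y : ℝ → ℂ} {P k Q R : ℝ → ℂ} {κ : ℝ → ℝ} {s₀ s₁ ε μ : ℝ}
    (hs : s₀ ≤ s₁) (hε : 0 < ε) (hε1 : ε ≤ 1) (hμ : 0 ≤ μ) (hκ : ContinuousOn κ (Icc s₀ s₁))
    (hx : ContinuousOn x (Icc s₀ s₁)) (hy : ContinuousOn y (Icc s₀ s₁))
    (hx' : ∀ s ∈ Ioo s₀ s₁, HasDerivAt x (-(k s * y s)) s)
    (hy' : ∀ s ∈ Ioo s₀ s₁, HasDerivAt y ((-2 * P s + 2 * k s * Q s) * y s - R s * x s) s)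
    (hk : ∀ s ∈ Icc s₀ s₁, ‖k s‖ ≤ κ s) (hQ1 : ∀ s ∈ Icc s₀ s₁, ‖Q s‖ ≤ 1)
    (hR : ∀ s ∈ Icc s₀ s₁, ‖R s‖ ≤ ε * κ s) (hP : ∀ s ∈ Icc s₀ s₁, -μ ≤ (P s).re) :
    ∀ s ∈ Icc s₀ s₁, ‖x s‖ ^ 2 + ‖y s‖ ^ 2 / ε ^ 2 ≤
      Real.exp (6 * (∫ t in s₀..s, κ t) + 4 * μ * (s - s₀)) *
        (‖x s₀‖ ^ 2 + ‖y s₀‖ ^ 2 / ε ^ 2) := by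
  set L : ℝ → ℝ := fun s => ∫ t in s₀..s, κ t with hL
  have hLc : ContinuousOn L (Icc s₀ s₁) := by
    have := intervalIntegral.continuousOn_primitive_interval (μ := volume) (f := κ) (a := s₀)
      (b := s₁) (by rw [uIcc_of_le hs]; exact hκ.integrableOn_Icc)
    rwa [uIcc_of_le hs] at this
  have hLd : ∀ s ∈ Ioo s₀ s₁, HasDerivAt L (κ s) s := fun s hs' => by
    apply intervalIntegral.integral_hasDerivAt_right
    · apply ContinuousOn.intervalIntegrable
      rw [uIcc_of_le hs'.1.le]
      exact hκ.mono (Icc_subset_Icc_right hs'.2.le)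
    · exact (hκ.mono Ioo_subset_Icc_self).stronglyMeasurableAtFilter isOpen_Ioo s hs'
    · exact (hκ.mono Ioo_subset_Icc_self).continuousAt (isOpen_Ioo.mem_nhds hs')
  set F : ℝ → ℝ := fun s => Real.exp (-(6 * L s + 4 * μ * (s - s₀))) *
    (‖x s‖ ^ 2 + ‖y s‖ ^ 2 / ε ^ 2) with hF
  have hanti : AntitoneOn F (Icc s₀ s₁) := by
    have hder : ∀ s ∈ Ioo s₀ s₁, HasDerivAt F
        (Real.exp (-(6 * L s + 4 * μ * (s - s₀))) * (-(6 * κ s + 4 * μ * 1)) *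
          (‖x s‖ ^ 2 + ‖y s‖ ^ 2 / ε ^ 2) +
        Real.exp (-(6 * L s + 4 * μ * (s - s₀))) * (2 * inner ℝ (x s) (-(k s * y s)) +
          2 * inner ℝ (y s) ((-2 * P s + 2 * k s * Q s) * y s - R s * x s) / ε ^ 2)) s := by
      intro s hs'
      have h1 : HasDerivAt (fun s => -(6 * L s + 4 * μ * (s - s₀))) (-(6 * κ s + 4 * μ * 1)) s :=
        (((hLd s hs').const_mul 6).add (((hasDerivAt_id s).sub_const s₀).const_mul (4 * μ))).neg
      exact h1.exp.mul ((hx' s hs').norm_sq.add ((hy' s hs').norm_sq.div_const _))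
    apply antitoneOn_of_deriv_nonpos (convex_Icc _ _)
    · apply ContinuousOn.mul
      · apply Real.continuous_exp.comp_continuousOn
        fun_prop
      · exact (hx.norm.pow 2).add ((hy.norm.pow 2).div_const _)
    · rw [interior_Icc]
      exact fun s hs' => (hder s hs').differentiableAt.differentiableWithinAt
    · rw [interior_Icc]
      intro s hs'
      have hsI := Ioo_subset_Icc_self hs'
      rw [(hder s hs').deriv, mul_assoc, ← mul_add]
      apply mul_nonpos_of_nonneg_of_nonpos (Real.exp_pos _).le
      set X := ‖x s‖ with hX
      set Y := ‖y s‖ / ε with hY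
      have hX0 : 0 ≤ X := norm_nonneg _
      have hY0 : 0 ≤ Y := by positivity
      have hYy : ‖y s‖ = ε * Y := by rw [hY]; field_simp
      have hκ0 : 0 ≤ κ s := (norm_nonneg _).trans (hk s hsI)
      have i1 : inner ℝ (x s) (-(k s * y s)) ≤ κ s * (X * Y) := by
        refine (real_inner_le_norm _ _).trans ?_
        rw [norm_neg, norm_mul, hYy]
        calc X * (‖k s‖ * (ε * Y)) ≤ X * (κ s * (1 * Y)) := by
              gcongr; exact hk s hsI
          _ = _ := by ring
      have i2 : inner ℝ (y s) ((-2 * P s + 2 * k s * Q s) * y s - R s * x s) / ε ^ 2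
          ≤ 2 * μ * Y ^ 2 + 2 * κ s * Y ^ 2 + κ s * (X * Y) := by
        have e : (-2 * P s + 2 * k s * Q s) * y s - R s * x s
            = (-2 * P s) * y s + (2 * k s * Q s) * y s + (-(R s * x s)) := by ring
        rw [e, inner_add_right, inner_add_right, div_le_iff₀ (by positivity)]
        have j1 : inner ℝ (y s) ((-2 * P s) * y s) ≤ 2 * μ * Y ^ 2 * ε ^ 2 := by
          have : inner ℝ (y s) ((-2 * P s) * y s) = -2 * (P s).re * ‖y s‖ ^ 2 := by
            rw [Complex.inner, Complex.sq_norm, Complex.normSq_apply]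
            simp only [Complex.mul_re, Complex.mul_im, Complex.conj_re, Complex.conj_im,
              Complex.neg_re, Complex.neg_im, Complex.re_ofNat, Complex.im_ofNat]
            ring
          rw [this, hYy]
          have := hP s hsI
          have h2 : 0 ≤ (ε * Y) ^ 2 := by positivity
          nlinarith
        have j2 : inner ℝ (y s) ((2 * k s * Q s) * y s) ≤ 2 * κ s * Y ^ 2 * ε ^ 2 := by
          refine (real_inner_le_norm _ _).trans ?_
          rw [norm_mul, norm_mul, norm_mul, hYy]
          simp only [Complex.norm_ofNat]
          calc ε * Y * (2 * ‖k s‖ * ‖Q s‖ * (ε * Y)) ≤ ε * Y * (2 * κ s * 1 * (ε * Y)) := by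
                gcongr
                · exact hk s hsI
                · exact hQ1 s hsI
            _ = _ := by ring
        have j3 : inner ℝ (y s) (-(R s * x s)) ≤ κ s * (X * Y) * ε ^ 2 := by
          refine (real_inner_le_norm _ _).trans ?_
          rw [norm_neg, norm_mul, hYy]
          calc ε * Y * (‖R s‖ * X) ≤ ε * Y * (ε * κ s * X) := by
                gcongr; exact hR s hsI
            _ = _ := by ring
        linarith
      have e2 : ‖y s‖ ^ 2 / ε ^ 2 = Y ^ 2 := by rw [hY, div_pow]
      rw [e2, mul_div_assoc]
      nlinarith [sq_nonneg (X - Y), mul_nonneg hκ0 (sq_nonneg (X - Y)), mul_nonneg hκ0 (sq_nonneg X), mul_nonneg hμ (sq_nonneg X),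
        mul_nonneg hκ0 (sq_nonneg Y)]
  intro s hs'
  have := hanti (left_mem_Icc.2 hs) hs' hs'.1
  simp only [hF, Real.exp_neg] at this
  have hL0 : L s₀ = 0 := by simp [hL]
  rw [hL0] at this
  simp only [sub_self, mul_zero, add_zero, Real.exp_zero, inv_one, one_mul] at this
  rwa [inv_mul_le_iff₀ (Real.exp_pos _)] at this

/-- The factor by which the approximate solution has to be multiplied along a segment. -/
lemma segment_estimate {a b P k Q R : ℝ → ℂ} {κ : ℝ → ℝ} {s₀ s₁ ε μ K X₀ : ℝ}
    (hs : s₀ ≤ s₁) (hε : 0 < ε) (hε1 : ε ≤ 1) (hμ : 0 ≤ μ)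
    (hPc : ContinuousOn P (Icc s₀ s₁))
    (hkc : ContinuousOn k (Icc s₀ s₁)) (hκ : ContinuousOn κ (Icc s₀ s₁))
    (ha : ∀ s ∈ Icc s₀ s₁, HasDerivAt a (P s * a s - k s * b s) s)
    (hb : ∀ s ∈ Icc s₀ s₁, HasDerivAt b (-P s * b s - k s * a s) s)
    (hQ : ∀ s ∈ Icc s₀ s₁,
      HasDerivAt Q (R s - 2 * P s * Q s - k s + k s * Q s ^ 2) s)
    (hk : ∀ s ∈ Icc s₀ s₁, ‖k s‖ ≤ κ s) (hQ1 : ∀ s ∈ Icc s₀ s₁, ‖Q s‖ ≤ 1)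
    (hR : ∀ s ∈ Icc s₀ s₁, ‖R s‖ ≤ ε * κ s) (hP : ∀ s ∈ Icc s₀ s₁, -μ ≤ (P s).re)
    (hK : ∫ t in s₀..s₁, κ t ≤ K)
    (ha0 : ‖a s₀‖ ≤ X₀) (hb0 : ‖b s₀ - Q s₀ * a s₀‖ ≤ ε * X₀) :
    ‖a s₁ * Complex.exp (-∫ t in s₀..s₁, (P t - k t * Q t)) - a s₀‖
      ≤ ε * (K * (2 * Real.exp (3 * K + 2 * μ * (s₁ - s₀))) * X₀) ∧
    ‖(b s₁ - Q s₁ * a s₁) * Complex.exp (-∫ t in s₀..s₁, (P t - k t * Q t))‖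
      ≤ ε * (2 * Real.exp (3 * K + 2 * μ * (s₁ - s₀)) * X₀) := by
  have hX0 : 0 ≤ X₀ := (norm_nonneg _).trans ha0
  have hac : ContinuousOn a (Icc s₀ s₁) := fun s hs' => (ha s hs').continuousAt.continuousWithinAt
  have hbc : ContinuousOn b (Icc s₀ s₁) := fun s hs' => (hb s hs').continuousAt.continuousWithinAt
  have hQc : ContinuousOn Q (Icc s₀ s₁) := fun s hs' => (hQ s hs').continuousAt.continuousWithinAt
  have hGc : ContinuousOn (fun t => P t - k t * Q t) (Icc s₀ s₁) := hPc.sub (hkc.mul hQc)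
  set D : ℝ → ℂ := fun s => ∫ t in s₀..s, (P t - k t * Q t) with hD
  have hDc : ContinuousOn D (Icc s₀ s₁) := by
    have := intervalIntegral.continuousOn_primitive_interval (μ := volume)
      (f := fun t => P t - k t * Q t) (a := s₀)
      (b := s₁) (by rw [uIcc_of_le hs]; exact hGc.integrableOn_Icc)
    rwa [uIcc_of_le hs] at this
  have hDd : ∀ s ∈ Ioo s₀ s₁, HasDerivAt D (P s - k s * Q s) s := fun s hs' => by
    apply intervalIntegral.integral_hasDerivAt_right
    · apply ContinuousOn.intervalIntegrable
      rw [uIcc_of_le hs'.1.le]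
      exact hGc.mono (Icc_subset_Icc_right hs'.2.le)
    · exact (hGc.mono Ioo_subset_Icc_self).stronglyMeasurableAtFilter isOpen_Ioo s hs'
    · exact (hGc.mono Ioo_subset_Icc_self).continuousAt (isOpen_Ioo.mem_nhds hs')
  have hEc : ContinuousOn (fun s => Complex.exp (-D s)) (Icc s₀ s₁) := hDc.neg.cexp
  set x : ℝ → ℂ := fun s => a s * Complex.exp (-D s) with hx
  set y : ℝ → ℂ := fun s => (b s - Q s * a s) * Complex.exp (-D s) with hy
  have hxc : ContinuousOn x (Icc s₀ s₁) := hac.mul hEc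
  have hyc : ContinuousOn y (Icc s₀ s₁) := (hbc.sub (hQc.mul hac)).mul hEc
  have hx' : ∀ s ∈ Ioo s₀ s₁, HasDerivAt x (-(k s * y s)) s := fun s hs' => by
    have hsI := Ioo_subset_Icc_self hs'
    have := (ha s hsI).mul (hDd s hs').neg.cexp
    refine this.congr_deriv ?_
    change (P s * a s - k s * b s) * Complex.exp (-D s) +
      a s * (Complex.exp (-D s) * (-(P s - k s * Q s))) = _
    simp only [hy]; ring
  have hy' : ∀ s ∈ Ioo s₀ s₁,
      HasDerivAt y ((-2 * P s + 2 * k s * Q s) * y s - R s * x s) s := fun s hs' => by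
    have hsI := Ioo_subset_Icc_self hs'
    have := ((hb s hsI).sub ((hQ s hsI).mul (ha s hsI))).mul (hDd s hs').neg.cexp
    refine this.congr_deriv ?_
    change (-P s * b s - k s * a s - ((R s - 2 * P s * Q s - k s + k s * Q s ^ 2) * a s +
      Q s * (P s * a s - k s * b s))) * Complex.exp (-D s) +
      (b s - Q s * a s) * (Complex.exp (-D s) * (-(P s - k s * Q s))) = _
    simp only [hy, hx]; ring
  have hen := energy_estimate hs hε hε1 hμ hκ hxc hyc hx' hy' hk hQ1 hR hP
  have hD0 : D s₀ = 0 := by simp [hD]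
  have hx0 : x s₀ = a s₀ := by simp [hx, hD0]
  have hy0 : y s₀ = b s₀ - Q s₀ * a s₀ := by simp [hy, hD0]
  set Λ : ℝ := 2 * Real.exp (3 * K + 2 * μ * (s₁ - s₀)) with hΛ
  have hκi : ∀ s ∈ Icc s₀ s₁, ∫ t in s₀..s, κ t ≤ K := by
    intro s hs'
    refine le_trans ?_ hK
    apply intervalIntegral.integral_mono_interval le_rfl hs'.1 hs'.2
    · filter_upwards [ae_restrict_mem measurableSet_Ioc] with t ht
      exact (norm_nonneg _).trans (hk t (Ioc_subset_Icc_self ht))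
    · apply ContinuousOn.intervalIntegrable; rwa [uIcc_of_le hs]
  have hbound : ∀ s ∈ Icc s₀ s₁, ‖y s‖ ≤ ε * (Λ * X₀) := by
    intro s hs'
    have h1 := hen s hs'
    have h2 : ‖x s₀‖ ^ 2 + ‖y s₀‖ ^ 2 / ε ^ 2 ≤ 2 * X₀ ^ 2 := by
      rw [hx0, hy0]
      have e1 : ‖a s₀‖ ^ 2 ≤ X₀ ^ 2 := by gcongr
      have e2 : ‖b s₀ - Q s₀ * a s₀‖ ^ 2 / ε ^ 2 ≤ X₀ ^ 2 := by
        rw [div_le_iff₀ (by positivity), ← mul_pow]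
        exact pow_le_pow_left₀ (norm_nonneg _) (by linarith) 2
      linarith
    have h3 : Real.exp (6 * (∫ t in s₀..s, κ t) + 4 * μ * (s - s₀))
        ≤ Real.exp (3 * K + 2 * μ * (s₁ - s₀)) ^ 2 := by
      rw [← Real.exp_nat_mul, Real.exp_le_exp]
      have := hκi s hs'
      have h4 : μ * (s - s₀) ≤ μ * (s₁ - s₀) := by gcongr; exact hs'.2
      push_cast; linarith
    have h5 : (‖y s‖ / ε) ^ 2 ≤ (Λ * X₀) ^ 2 := by
      calc (‖y s‖ / ε) ^ 2 ≤ ‖x s‖ ^ 2 + ‖y s‖ ^ 2 / ε ^ 2 := by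
            rw [div_pow]; linarith [sq_nonneg ‖x s‖]
        _ ≤ Real.exp (3 * K + 2 * μ * (s₁ - s₀)) ^ 2 * (2 * X₀ ^ 2) := by
            refine h1.trans ?_; gcongr
        _ ≤ (Λ * X₀) ^ 2 := by
            rw [hΛ]
            have : 0 ≤ (Real.exp (3 * K + 2 * μ * (s₁ - s₀)) * X₀) ^ 2 := sq_nonneg _
            nlinarith
    have h6 := abs_le_of_sq_le_sq h5 (by positivity)
    have h7 : ‖y s‖ / ε ≤ Λ * X₀ := (le_abs_self _).trans h6
    rw [div_le_iff₀ hε] at h7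
    linarith
  refine ⟨?_, hbound s₁ (right_mem_Icc.2 hs)⟩
  have hint : IntervalIntegrable (fun s => -(k s * y s)) volume s₀ s₁ := by
    apply ContinuousOn.intervalIntegrable; rw [uIcc_of_le hs]; exact (hkc.mul hyc).neg
  have hftc := intervalIntegral.integral_eq_sub_of_hasDerivAt_of_le hs hxc hx' hint
  rw [hx0] at hftc
  change ‖x s₁ - a s₀‖ ≤ _
  rw [← hftc]
  have hg : IntervalIntegrable (fun s => κ s * (ε * (Λ * X₀))) volume s₀ s₁ := by
    apply ContinuousOn.intervalIntegrable; rw [uIcc_of_le hs]; exact hκ.mul continuousOn_const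
  refine (intervalIntegral.norm_integral_le_of_norm_le hs ?_ hg).trans ?_
  · filter_upwards with s hs'
    have hsI := Ioc_subset_Icc_self hs'
    rw [norm_neg, norm_mul]
    gcongr
    · exact (norm_nonneg _).trans (hk s hsI)
    · exact hk s hsI
    · exact hbound s hsI
  · rw [intervalIntegral.integral_mul_const]
    calc _ ≤ K * (ε * (Λ * X₀)) := by gcongr
      _ = _ := by ring

end Segment

section LinearODE

open Metric in
/-- A bounded holomorphic linear differential equation on a disc has a holomorphic solution with
prescribed value at the centre. -/
lemma exists_holomorphic_solution {F : Type*} [NormedAddCommGroup F] [NormedSpace ℂ F]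
    [CompleteSpace F] {M : ℂ → F →L[ℂ] F} {t₁ : ℂ} {R L : ℝ} (hR : 0 < R) (hL : 0 ≤ L)
    (hM : DifferentiableOn ℂ M (ball t₁ R)) (hML : ∀ z ∈ ball t₁ R, ‖M z‖ ≤ L) (v : F) :
    ∃ U : ℂ → F, U t₁ = v ∧ ∀ z ∈ ball t₁ R, HasDerivAt U (M z (U z)) z := by
  have step : ∀ X : {X : ℂ → F // DifferentiableOn ℂ X (ball t₁ R)},
      ∃ Y : {X : ℂ → F // DifferentiableOn ℂ X (ball t₁ R)}, Y.1 t₁ = 0 ∧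
        ∀ z ∈ ball t₁ R, HasDerivAt Y.1 (M z (X.1 z)) z := by
    rintro ⟨X, hX⟩
    have h1 : DifferentiableOn ℂ (fun z => M z (X z)) (ball t₁ R) := hM.clm_apply hX
    obtain ⟨Y, hY0, hY⟩ := h1.isExactOn_ball.with_val_at t₁ (0 : F)
    exact ⟨⟨Y, fun z hz => (hY z hz).differentiableAt.differentiableWithinAt⟩, hY0, hY⟩
  choose Y hY0 hY using step
  set X : ℕ → {X : ℂ → F // DifferentiableOn ℂ X (ball t₁ R)} := fun n =>
    Nat.rec ⟨fun _ => v, differentiableOn_const v⟩ (fun _ X => Y X) n with hX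
  have hXs : ∀ n, X (n + 1) = Y (X n) := fun n => rfl
  have hb : ∀ n, ∀ z ∈ ball t₁ R,
      ‖(X n).1 z‖ ≤ ‖v‖ * (L ^ n * ‖z - t₁‖ ^ n / n.factorial) := by
    intro n
    induction n with
    | zero => intro z _; simp [hX]
    | succ n ih =>
      intro z hz
      set γ : ℝ → ℂ := fun s => t₁ + s * (z - t₁) with hγ
      have hzn : ‖z - t₁‖ < R := by rwa [mem_ball, dist_eq_norm] at hz
      have hγn : ∀ s ∈ Icc (0 : ℝ) 1, ‖γ s - t₁‖ = s * ‖z - t₁‖ := fun s hs => by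
        simp [hγ, abs_of_nonneg hs.1]
      have hγb : ∀ s ∈ Icc (0 : ℝ) 1, γ s ∈ ball t₁ R := fun s hs => by
        rw [mem_ball, dist_eq_norm, hγn s hs]
        nlinarith [norm_nonneg (z - t₁), hs.1, hs.2]
      have hγd : ∀ s : ℝ, HasDerivAt γ (z - t₁) s := fun s => by
        have := ((Complex.ofRealCLM.hasDerivAt (x := s)).mul_const (z - t₁)).const_add t₁
        exact this.congr_deriv (by simp)
      have hd : ∀ s ∈ Icc (0 : ℝ) 1, HasDerivAt (fun s => (X (n + 1)).1 (γ s))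
          ((z - t₁) • M (γ s) ((X n).1 (γ s))) s := fun s hs => by
        rw [hXs]
        exact (hY (X n) (γ s) (hγb s hs)).scomp s (hγd s)
      have := image_norm_le_of_norm_deriv_right_le_deriv_boundary (a := (0 : ℝ)) (b := 1)
        (f := fun s => (X (n + 1)).1 (γ s))
        (B := fun s => ‖v‖ * (L ^ (n + 1) * ‖z - t₁‖ ^ (n + 1) / (n + 1).factorial) * s ^ (n + 1))
        (B' := fun s => ‖v‖ * (L ^ (n + 1) * ‖z - t₁‖ ^ (n + 1) / (n + 1).factorial) *
          (((n + 1 : ℕ) : ℝ) * s ^ n))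
        (fun s hs => (hd s hs).continuousAt.continuousWithinAt)
        (fun s hs => (hd s (Ico_subset_Icc_self hs)).hasDerivWithinAt)
        (by simp [hγ, hXs, hY0])
        (fun s => (hasDerivAt_pow (n + 1) s).const_mul _)
        (fun s hs => by
          have hs' := Ico_subset_Icc_self hs
          rw [norm_smul]
          have h1 := (M (γ s)).le_of_opNorm_le (hML _ (hγb s hs')) ((X n).1 (γ s))
          have h2 := ih (γ s) (hγb s hs')
          rw [hγn s hs'] at h2
          calc ‖z - t₁‖ * ‖M (γ s) ((X n).1 (γ s))‖
              ≤ ‖z - t₁‖ * (L * (‖v‖ * (L ^ n * (s * ‖z - t₁‖) ^ n / n.factorial))) := by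
                gcongr; exact h1.trans (by gcongr)
            _ = _ := by
                rw [Nat.factorial_succ, mul_pow]; push_cast
                field_simp; ring)
        (show (1 : ℝ) ∈ Icc (0 : ℝ) 1 by simp)
      simpa [hγ] using this
  have hsum : Summable fun n : ℕ => ‖v‖ * ((L * R) ^ n / n.factorial) :=
    (Real.summable_pow_div_factorial (L * R)).mul_left _
  have hb' : ∀ n, ∀ z ∈ ball t₁ R, ‖(X n).1 z‖ ≤ ‖v‖ * ((L * R) ^ n / n.factorial) := by
    intro n z hz
    refine (hb n z hz).trans ?_
    have hzn : ‖z - t₁‖ ≤ R := by rw [mem_ball, dist_eq_norm] at hz; exact hz.le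
    rw [mul_pow]; gcongr
  have hsX : ∀ z ∈ ball t₁ R, Summable fun n => (X n).1 z := fun z hz =>
    .of_norm_bounded hsum fun n => hb' n z hz
  set g' : ℕ → ℂ → F := fun n z => Nat.casesOn n 0 fun k => M z ((X k).1 z) with hg'
  have hd : ∀ z ∈ ball t₁ R, HasDerivAt (fun z => ∑' n, (X n).1 z) (∑' n, g' n z) z := by
    intro z hz
    refine hasDerivAt_tsum_of_isPreconnected (t := ball t₁ R)
      (u := fun n => Nat.casesOn n 0 fun k => L * (‖v‖ * ((L * R) ^ k / k.factorial))) ?_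
      isOpen_ball (convex_ball t₁ R).isPreconnected ?_ ?_ (mem_ball_self hR)
      (hsX _ (mem_ball_self hR)) hz
    · rw [← summable_nat_add_iff 1]
      exact hsum.mul_left L
    · rintro (_ | k) y hy
      · exact hasDerivAt_const y v
      · exact hY (X k) y hy
    · rintro (_ | k) y hy
      · simp [hg']
      · exact ((M y).le_of_opNorm_le (hML y hy) _).trans
          (mul_le_mul_of_nonneg_left (hb' k y hy) hL)
  refine ⟨fun z => ∑' n, (X n).1 z, ?_, fun z hz => ?_⟩
  · change ∑' n, (X n).1 t₁ = v
    rw [tsum_eq_single 0]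
    · rfl
    · intro n hn
      obtain ⟨k, rfl⟩ := Nat.exists_eq_succ_of_ne_zero hn
      exact hY0 (X k)
  · refine (hd z hz).congr_deriv ?_
    have hs' : Summable fun n => g' n z := by
      rw [← summable_nat_add_iff 1]
      exact (M z).summable (hsX z hz)
    rw [hs'.tsum_eq_zero_add, (M z).map_tsum (hsX z hz)]
    simp [hg']

open Metric in
/-- A solution on the real line of a first order system with holomorphic off-diagonal coefficients
extends holomorphically to a disc. -/
lemma exists_holomorphic_extension {f g : ℂ → ℂ} {t₁ R L : ℝ} (hR : 0 < R)
    (hf : DifferentiableOn ℂ f (ball (t₁ : ℂ) R)) (hg : DifferentiableOn ℂ g (ball (t₁ : ℂ) R))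
    (hfL : ∀ z ∈ ball (t₁ : ℂ) R, ‖f z‖ ≤ L) (hgL : ∀ z ∈ ball (t₁ : ℂ) R, ‖g z‖ ≤ L)
    {u₁ u₂ : ℝ → ℂ} (hu₁ : ∀ x : ℝ, HasDerivAt u₁ (f x * u₂ x) x)
    (hu₂ : ∀ x : ℝ, HasDerivAt u₂ (g x * u₁ x) x) :
    ∃ U₁ U₂ : ℂ → ℂ, (∀ z ∈ ball (t₁ : ℂ) R, HasDerivAt U₁ (f z * U₂ z) z) ∧
      (∀ z ∈ ball (t₁ : ℂ) R, HasDerivAt U₂ (g z * U₁ z) z) ∧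
      ∀ x : ℝ, |x - t₁| < R → U₁ x = u₁ x ∧ U₂ x = u₂ x := by
  have hL : 0 ≤ L := (norm_nonneg _).trans (hfL _ (mem_ball_self hR))
  set M : ℂ → (ℂ × ℂ) →L[ℂ] (ℂ × ℂ) := fun z =>
    f z • ((ContinuousLinearMap.inl ℂ ℂ ℂ).comp (ContinuousLinearMap.snd ℂ ℂ ℂ)) +
    g z • ((ContinuousLinearMap.inr ℂ ℂ ℂ).comp (ContinuousLinearMap.fst ℂ ℂ ℂ)) with hM
  have hMa : ∀ z v, M z v = (f z * v.2, g z * v.1) := fun z v => by simp [hM]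
  have hMn : ∀ z ∈ ball (t₁ : ℂ) R, ‖M z‖ ≤ L := fun z hz => by
    refine ContinuousLinearMap.opNorm_le_bound _ hL fun v => ?_
    rw [hMa, Prod.norm_def, Prod.norm_def]
    simp only [norm_mul]
    apply max_le
    · exact mul_le_mul (hfL z hz) (le_max_right _ _) (norm_nonneg _) hL
    · exact mul_le_mul (hgL z hz) (le_max_left _ _) (norm_nonneg _) hL
  obtain ⟨U, hU0, hU⟩ := exists_holomorphic_solution hR hL (M := M)
    ((hf.smul_const _).add (hg.smul_const _)) hMn (u₁ t₁, u₂ t₁)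
  refine ⟨fun z => (U z).1, fun z => (U z).2, fun z hz => ?_, fun z hz => ?_, ?_⟩
  · have := (ContinuousLinearMap.fst ℂ ℂ ℂ).hasFDerivAt.comp_hasDerivAt z (hU z hz)
    rw [hMa] at this; exact this
  · have := (ContinuousLinearMap.snd ℂ ℂ ℂ).hasFDerivAt.comp_hasDerivAt z (hU z hz)
    rw [hMa] at this; exact this
  · have hmem : ∀ x ∈ Ioo (t₁ - R) (t₁ + R), (x : ℂ) ∈ ball (t₁ : ℂ) R := fun x hx => by
      rw [mem_ball, Complex.dist_of_im_eq (by simp)]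
      simp only [Complex.ofReal_re, Real.dist_eq]
      rw [abs_lt]; constructor <;> linarith [hx.1, hx.2]
    have key : EqOn (fun x : ℝ => U x) (fun x => (u₁ x, u₂ x)) (Ioo (t₁ - R) (t₁ + R)) := by
      apply ODE_solution_unique_of_mem_Ioo (K := ⟨L, hL⟩) (v := fun x v => M x v)
        (s := fun _ => univ) (t₀ := t₁)
      · intro x hx
        exact ((M x).lipschitz.weaken (hMn x (hmem x hx))).lipschitzOnWith
      · constructor <;> linarith
      · intro x hx
        have := (hU x (hmem x hx)).scomp x Complex.ofRealCLM.hasDerivAt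
        exact ⟨this.congr_deriv (by simp), mem_univ _⟩
      · intro x hx
        refine ⟨?_, mem_univ _⟩
        rw [hMa]
        exact (hu₁ x).prodMk (hu₂ x)
      · exact hU0
    intro x hx
    rw [abs_lt] at hx
    have := key (show x ∈ Ioo (t₁ - R) (t₁ + R) from ⟨by linarith, by linarith⟩)
    change U x = _ at this
    change (U x).1 = u₁ x ∧ (U x).2 = u₂ x
    rw [this]; exact ⟨rfl, rfl⟩

end LinearODE

section Weight

/-- The integrable weight `⟨x⟩^{-δ}`. -/
noncomputable def japaneseWeight (δ x : ℝ) : ℝ := (1 + x ^ 2) ^ (-(δ / 2))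

variable {δ : ℝ}

lemma japaneseWeight_pos (δ x : ℝ) : 0 < japaneseWeight δ x :=
  Real.rpow_pos_of_pos (by positivity) _

lemma japaneseWeight_le_one (hδ : 1 < δ) (x : ℝ) : japaneseWeight δ x ≤ 1 :=
  Real.rpow_le_one_of_one_le_of_nonpos (by nlinarith [sq_nonneg x]) (by linarith)

lemma continuous_japaneseWeight (δ : ℝ) : Continuous (japaneseWeight δ) :=
  Continuous.rpow_const (by fun_prop) fun x => Or.inl (by positivity)

lemma integrable_japaneseWeight (hδ : 1 < δ) : Integrable (japaneseWeight δ) := by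
  have := integrable_rpow_neg_one_add_norm_sq (E := ℝ) (μ := volume) (r := δ) (by simpa using hδ)
  refine this.congr (.of_forall fun x => ?_)
  simp [japaneseWeight, neg_div]

lemma japaneseWeight_shift (hδ : 1 < δ) {x x' : ℝ} (hx : |x' - x| ≤ 1) :
    japaneseWeight δ x' ≤ 3 ^ (δ / 2) * japaneseWeight δ x := by
  unfold japaneseWeight
  rw [abs_le] at hx
  have h1 : (0 : ℝ) < 1 + x ^ 2 := by positivity
  have h2 : (0 : ℝ) < 1 + x' ^ 2 := by positivity
  have h3 : 1 + x ^ 2 ≤ 3 * (1 + x' ^ 2) := by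
    nlinarith [sq_nonneg (x' + (x' - x)), mul_nonneg (sub_nonneg.2 hx.2) (by linarith : 0 ≤ (x' - x) + 1)]
  rw [Real.rpow_neg h1.le, Real.rpow_neg h2.le, ← div_eq_mul_inv, inv_eq_one_div,
    div_le_div_iff₀ (by positivity) (by positivity), one_mul,
    ← Real.mul_rpow (by norm_num) h2.le]
  exact Real.rpow_le_rpow h1.le h3 (by linarith)

lemma tendsto_japaneseWeight_atTop (hδ : 1 < δ) :
    Tendsto (japaneseWeight δ) atTop (𝓝 0) := by
  refine (tendsto_rpow_neg_atTop (show 0 < δ / 2 by linarith)).comp ?_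
  exact tendsto_atTop_add_const_left _ _ (tendsto_pow_atTop (by norm_num))

lemma tendsto_japaneseWeight_atBot (hδ : 1 < δ) :
    Tendsto (japaneseWeight δ) atBot (𝓝 0) := by
  have := (tendsto_japaneseWeight_atTop hδ).comp tendsto_neg_atBot_atTop
  refine this.congr fun x => ?_
  simp [japaneseWeight]

lemma mem_sector_of_abs_im_lt {ε η : ℝ} (hε : 0 < ε) {z : ℂ} (hz : |z.im| < η) :
    z ∈ Sector ε η := by
  have := abs_nonneg z.re
  show |z.im| < ε * |z.re| + η
  nlinarith

open Metric in
/-- Consequences of assumption (A) in a strip around the real axis. -/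
lemma AssumptionA.exists_strip {V : ℂ → ℂ} {Vm Vp : ℝ} (hA : AssumptionA V Vm Vp) :
    ∃ δ > (1 : ℝ), ∃ y > (0 : ℝ), ∃ C > (0 : ℝ),
      AnalyticOnNhd ℂ V {z | |z.im| < y} ∧
      (∀ z : ℂ, |z.im| < y → ‖deriv V z‖ ≤ C * japaneseWeight δ z.re) ∧
      (∀ x : ℝ, x ≤ 0 → ‖V x - Vm‖ ≤ C * japaneseWeight δ x) ∧
      (∀ x : ℝ, 0 ≤ x → ‖V x - Vp‖ ≤ C * japaneseWeight δ x) := by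
  obtain ⟨ε, hε, η, hη, δ, hδ, han, ⟨C₁, R₁, h₁⟩, ⟨C₂, R₂, h₂⟩⟩ := hA.sector
  obtain ⟨s, hs0, hs1, hs2⟩ : ∃ s > (0 : ℝ), s ≤ 1 / 2 ∧ s ≤ η / 3 :=
    ⟨min (1 / 2) (η / 3), by positivity, min_le_left _ _, min_le_right _ _⟩
  set R : ℝ := max (max R₁ R₂) 0 + 1 with hR
  have hR1 : R₁ + 1 ≤ R := by rw [hR]; gcongr; exact (le_max_left _ _).trans (le_max_left _ _)
  have hR2 : R₂ + 1 ≤ R := by rw [hR]; gcongr; exact (le_max_right _ _).trans (le_max_left _ _)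
  have hR0 : 1 ≤ R := by rw [hR]; linarith [le_max_right (max R₁ R₂) 0]
  have han' : AnalyticOnNhd ℂ V {z | |z.im| < η} := fun z hz =>
    han z (mem_sector_of_abs_im_lt hε hz)
  have hopen : IsOpen {z : ℂ | |z.im| < η} :=
    isOpen_lt (continuous_abs.comp Complex.continuous_im) continuous_const
  have hwt : ∀ z : ℂ, (1 + ‖z‖ ^ 2) ^ (-(δ / 2)) ≤ japaneseWeight δ z.re := fun z => by
    refine Real.rpow_le_rpow_of_nonpos (by positivity) ?_ (by linarith)
    have := Complex.abs_re_le_norm z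
    have : z.re ^ 2 ≤ ‖z‖ ^ 2 := sq_le_sq.2 (by simpa using this)
    linarith
  have htail : ∀ (W : ℝ) (C : ℝ) (z : ℂ), (∀ z' ∈ closedBall z s,
      ‖V z' - W‖ ≤ C * (1 + ‖z'‖ ^ 2) ^ (-(δ / 2))) → |z.im| < s →
      ‖deriv V z‖ ≤ |C| * 3 ^ (δ / 2) / s * japaneseWeight δ z.re := by
    intro W C z h hz
    have hsub : closedBall z s ⊆ {z | |z.im| < η} := fun z' hz' => by
      have h1 : |z'.im - z.im| ≤ s := by
        have := Complex.abs_im_le_norm (z' - z)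
        rw [mem_closedBall, dist_eq_norm] at hz'
        simpa using this.trans hz'
      have h2 : |z'.im| ≤ |z'.im - z.im| + |z.im| := by
        simpa using abs_add_le (z'.im - z.im) z.im
      show |z'.im| < η
      linarith
    have := Complex.norm_deriv_le_of_forall_mem_sphere_norm_le (f := fun z => V z - W)
      (c := z) (R := s) (C := |C| * (3 ^ (δ / 2) * japaneseWeight δ z.re)) hs0 ?_ ?_
    · rw [deriv_sub_const] at this
      exact this.trans (le_of_eq (by ring))
    · refine (DifferentiableOn.diffContOnCl ?_).sub_const _
      rw [closure_ball _ hs0.ne']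
      exact (han'.mono hsub).differentiableOn
    · intro z' hz'
      refine (h z' (sphere_subset_closedBall hz')).trans ?_
      have h1 : |z'.re - z.re| ≤ 1 := by
        have := Complex.abs_re_le_norm (z' - z)
        rw [mem_sphere, dist_eq_norm] at hz'
        rw [Complex.sub_re] at this
        linarith
      exact mul_le_mul (le_abs_self C) ((hwt z').trans (japaneseWeight_shift hδ h1))
        (by positivity) (abs_nonneg C)
  have hcpt : IsCompact (Icc (-R) R ×ℂ Icc (-s) s) := isCompact_Icc.reProdIm isCompact_Icc
  have hsubc : Icc (-R) R ×ℂ Icc (-s) s ⊆ {z : ℂ | |z.im| < η} := fun z hz => by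
    have := hz.2
    show |z.im| < η
    rw [abs_lt]; constructor <;> linarith [this.1, this.2]
  obtain ⟨C₃, hC₃⟩ := hcpt.exists_bound_of_continuousOn
    (f := deriv V) ((han'.deriv.continuousOn).mono hsubc)
  obtain ⟨C₄, hC₄⟩ := hcpt.exists_bound_of_continuousOn
    (f := fun z => V z) ((han'.continuousOn).mono hsubc)
  have hwR : ∀ x : ℝ, |x| ≤ R → japaneseWeight δ R ≤ japaneseWeight δ x := fun x hx => by
    refine Real.rpow_le_rpow_of_nonpos (by positivity) ?_ (by linarith)
    have : x ^ 2 ≤ R ^ 2 := sq_le_sq.2 (by rwa [abs_of_nonneg (by linarith : 0 ≤ R)])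
    linarith
  set w := japaneseWeight δ R with hw
  have hw0 : 0 < w := japaneseWeight_pos _ _
  have hp : 0 ≤ (3 : ℝ) ^ (δ / 2) / s := by positivity
  set C := 1 + |C₁| + |C₂| + |C₁| * 3 ^ (δ / 2) / s + |C₂| * 3 ^ (δ / 2) / s + |C₃| / w
    + (|C₄| + |Vm| + |Vp|) / w with hC
  have e1 : 0 ≤ |C₁| * 3 ^ (δ / 2) / s := by positivity
  have e2 : 0 ≤ |C₂| * 3 ^ (δ / 2) / s := by positivity
  have e3 : 0 ≤ |C₃| / w := by positivity
  have e4 : 0 ≤ (|C₄| + |Vm| + |Vp|) / w := by positivity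
  have e5 := abs_nonneg C₁
  have e6 := abs_nonneg C₂
  have hmid : ∀ x : ℝ, |x| ≤ R → ∀ W : ℝ, |W| ≤ |Vm| + |Vp| →
      ‖V x - W‖ ≤ C * japaneseWeight δ x := by
    intro x hx W hW
    have h1 := hC₄ (x : ℂ) ⟨abs_le.1 hx, by constructor <;> simp [hs0.le]⟩
    calc ‖V x - W‖ ≤ ‖V x‖ + ‖(W : ℂ)‖ := norm_sub_le _ _
      _ ≤ |C₄| + (|Vm| + |Vp|) := by
          rw [Complex.norm_real, Real.norm_eq_abs]
          exact add_le_add (h1.trans (le_abs_self _)) hW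
      _ = (|C₄| + |Vm| + |Vp|) / w * w := by rw [div_mul_cancel₀ _ hw0.ne']; ring
      _ ≤ C * japaneseWeight δ x :=
          mul_le_mul (by linarith) (hwR x hx) hw0.le (by linarith)
  refine ⟨δ, hδ, s, hs0, C, by linarith, fun z hz => han' z ?_, fun z hz => ?_, fun x hx => ?_,
    fun x hx => ?_⟩
  · have hz' : |z.im| < s := hz
    show |z.im| < η
    linarith
  · have hwz := (japaneseWeight_pos δ z.re).le
    have hnear : ∀ z' ∈ closedBall z s, z' ∈ Sector ε η ∧ |z'.re - z.re| ≤ 1 := by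
      intro z' hz'
      rw [mem_closedBall, dist_eq_norm] at hz'
      have h1 := Complex.abs_im_le_norm (z' - z)
      have h2 := Complex.abs_re_le_norm (z' - z)
      rw [Complex.sub_im] at h1
      rw [Complex.sub_re] at h2
      have h3 : |z'.im| ≤ |z'.im - z.im| + |z.im| := by
        simpa using abs_add_le (z'.im - z.im) z.im
      exact ⟨mem_sector_of_abs_im_lt hε (by linarith), by linarith⟩
    rcases le_or_gt R z.re with hzR | hzR
    · refine (htail Vp C₁ z (fun z' hz' => h₁ z' (hnear z' hz').1 ?_) hz).trans ?_
      · have := abs_le.1 (hnear z' hz').2; linarith [this.1]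
      · gcongr; linarith
    rcases le_or_gt z.re (-R) with hzR' | hzR'
    · refine (htail Vm C₂ z (fun z' hz' => h₂ z' (hnear z' hz').1 ?_) hz).trans ?_
      · have := abs_le.1 (hnear z' hz').2; linarith [this.2]
      · gcongr; linarith
    · have hz'' := abs_lt.1 hz
      have h1 := hC₃ z ⟨⟨hzR'.le, hzR.le⟩, ⟨hz''.1.le, hz''.2.le⟩⟩
      calc ‖deriv V z‖ ≤ |C₃| / w * w := by
            rw [div_mul_cancel₀ _ hw0.ne']; exact h1.trans (le_abs_self _)
        _ ≤ C * japaneseWeight δ z.re := mul_le_mul (by linarith)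
          (hwR _ (abs_le.2 ⟨hzR'.le, hzR.le⟩)) hw0.le (by linarith)
  · rcases le_or_gt x (-R) with hxR | hxR
    · refine (h₂ x (mem_sector_of_abs_im_lt hε (by simpa using hη)) ?_).trans ?_
      · simp; linarith
      · exact mul_le_mul ((le_abs_self C₂).trans (by linarith)) (by simpa using hwt x)
          (by positivity) (by linarith)
    · exact hmid x (abs_le.2 ⟨hxR.le, by linarith⟩) Vm (by linarith [abs_nonneg Vp])
  · rcases le_or_gt R x with hxR | hxR
    · refine (h₁ x (mem_sector_of_abs_im_lt hε (by simpa using hη)) ?_).trans ?_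
      · simp; linarith
      · exact mul_le_mul ((le_abs_self C₁).trans (by linarith)) (by simpa using hwt x)
          (by positivity) (by linarith)
    · exact hmid x (abs_le.2 ⟨by linarith, hxR.le⟩) Vp (by linarith [abs_nonneg Vm])

end Weight

section Geometry

/-- The coefficient `(E - V + mc²)/c` of the Dirac system. -/
noncomputable def upCoeff (m c E : ℝ) (V : ℂ → ℂ) (z : ℂ) : ℂ := (E - V z + m * c ^ 2) / c

/-- The coefficient `(E - V - mc²)/c` of the Dirac system. -/
noncomputable def loCoeff (m c E : ℝ) (V : ℂ → ℂ) (z : ℂ) : ℂ := (E - V z - m * c ^ 2) / c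

/-- The squared momentum `((E - V)² - m²c⁴)/c²`. -/
noncomputable def sqMomentum (m c E : ℝ) (V : ℂ → ℂ) (z : ℂ) : ℂ :=
  upCoeff m c E V z * loCoeff m c E V z

/-- Quantitative description of the complex geometry near the real axis: `sqMomentum` has positive
real part to the left of the turning point `t₁`, negative real part to its right, and negative
imaginary part in an upper half disc around `t₁`. -/
structure DiracGeometry (m c E : ℝ) (V : ℂ → ℂ) (Vm t₁ δ Y y R C f₀ w κ : ℝ) : Prop where
  one_lt : 1 < δ
  hY : 0 < Y
  hy : 0 < y
  hyY : y ≤ Y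
  hR : 0 < R
  hRY : R ≤ Y
  hC : 0 < C
  hf₀ : 0 < f₀
  hw : 0 < w
  hκ : 0 < κ
  real : ∀ x : ℝ, (V x).im = 0
  analytic : AnalyticOnNhd ℂ V {z | |z.im| < Y}
  norm_deriv : ∀ z : ℂ, |z.im| < Y → ‖deriv V z‖ ≤ C * japaneseWeight δ z.re
  tail : ∀ x : ℝ, x ≤ 0 → ‖V x - Vm‖ ≤ C * japaneseWeight δ x
  up_re : ∀ z : ℂ, |z.im| < Y → f₀ ≤ (upCoeff m c E V z).re
  norm_up : ∀ z : ℂ, |z.im| < Y → ‖upCoeff m c E V z‖ ≤ C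
  norm_lo : ∀ z : ℂ, |z.im| < Y → ‖loCoeff m c E V z‖ ≤ C
  norm_sq : ∀ z : ℂ, |z.im| < Y → ‖sqMomentum m c E V z‖ ≤ C
  left : ∀ z : ℂ, |z.im| < y → z.re < t₁ - R / 4 → w ≤ (sqMomentum m c E V z).re
  right : ∀ z : ℂ, |z.im| < y → t₁ + R / 4 < z.re → (sqMomentum m c E V z).re ≤ -w
  ball : ∀ z : ℂ, z ∈ Metric.ball (t₁ : ℂ) R → 0 ≤ z.im →
    (sqMomentum m c E V z).im ≤ -κ * z.im
  left_real : ∀ x : ℝ, x < t₁ → 0 < (sqMomentum m c E V x).re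
  right_real : ∀ x : ℝ, t₁ < x → (sqMomentum m c E V x).re < 0
  zero_real : sqMomentum m c E V t₁ = 0

lemma exists_pos_le_of_tendsto {F : ℝ → ℝ} {L L' : ℝ} (hF : Continuous F) (hpos : ∀ x, 0 < F x)
    (hL : 0 < L) (hL' : 0 < L') (h : Tendsto F atBot (𝓝 L)) (h' : Tendsto F atTop (𝓝 L')) :
    ∃ w > 0, ∀ x, w ≤ F x := by
  obtain ⟨a, ha⟩ := eventually_atBot.1 (h.eventually_const_le (half_lt_self hL))
  obtain ⟨b, hb⟩ := eventually_atTop.1 (h'.eventually_const_le (half_lt_self hL'))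
  obtain ⟨x₀, -, hx₀⟩ := (isCompact_Icc (a := min a b) (b := max a b)).exists_isMinOn
    (nonempty_Icc.2 min_le_max) hF.continuousOn
  refine ⟨min (F x₀) (min (L / 2) (L' / 2)), by have := hpos x₀; positivity, fun x => ?_⟩
  rcases le_or_gt x a with h1 | h1
  · exact (min_le_right _ _).trans ((min_le_left _ _).trans (ha x h1))
  rcases le_or_gt b x with h2 | h2
  · exact (min_le_right _ _).trans ((min_le_right _ _).trans (hb x h2))
  · exact (min_le_left _ _).trans (hx₀ ⟨(min_le_left _ _).trans h1.le,
      h2.le.trans (le_max_right _ _)⟩)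

lemma convex_strip (Y : ℝ) : Convex ℝ {z : ℂ | |z.im| < Y} := by
  have : {z : ℂ | |z.im| < Y} = Complex.imLm ⁻¹' (Ioo (-Y) Y) := by
    ext z; simp [abs_lt]
  rw [this]
  exact (convex_Ioo _ _).linear_preimage _

lemma norm_sub_re_le {F : ℂ → ℂ} {Y C : ℝ} (hF : AnalyticOnNhd ℂ F {z | |z.im| < Y})
    (hC : ∀ z : ℂ, |z.im| < Y → ‖deriv F z‖ ≤ C) {z : ℂ} (hz : |z.im| < Y) :
    ‖F z - F (z.re : ℝ)‖ ≤ C * |z.im| := by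
  have h0 : |((z.re : ℝ) : ℂ).im| < Y := by simpa using (abs_nonneg z.im).trans_lt hz
  have := (convex_strip Y).norm_image_sub_le_of_norm_deriv_le (𝕜 := ℂ)
    (fun x hx => (hF x hx).differentiableAt) hC (show ((z.re : ℝ) : ℂ) ∈ _ from h0)
    (show z ∈ _ from hz)
  refine this.trans (le_of_eq ?_)
  congr 1
  have : z - (z.re : ℝ) = z.im * I := by
    apply Complex.ext <;> simp
  rw [this]; simp

variable {m c E : ℝ} {V : ℂ → ℂ}

lemma hasDerivAt_upCoeff {z V' : ℂ} (h : HasDerivAt V V' z) :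
    HasDerivAt (upCoeff m c E V) (-V' / c) z := by
  have := (((hasDerivAt_const z (E : ℂ)).sub h).add_const ((m : ℂ) * c ^ 2)).div_const (c : ℂ)
  exact this.congr_deriv (by ring)

lemma hasDerivAt_loCoeff {z V' : ℂ} (h : HasDerivAt V V' z) :
    HasDerivAt (loCoeff m c E V) (-V' / c) z := by
  have := (((hasDerivAt_const z (E : ℂ)).sub h).sub_const ((m : ℂ) * c ^ 2)).div_const (c : ℂ)
  exact this.congr_deriv (by ring)

lemma hasDerivAt_sqMomentum {z V' : ℂ} (h : HasDerivAt V V' z) :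
    HasDerivAt (sqMomentum m c E V)
      (-V' / c * (upCoeff m c E V z + loCoeff m c E V z)) z :=
  ((hasDerivAt_upCoeff h).mul (hasDerivAt_loCoeff h)).congr_deriv (by ring)

lemma analyticOnNhd_sqMomentum {U : Set ℂ} (h : AnalyticOnNhd ℂ V U) :
    AnalyticOnNhd ℂ (sqMomentum m c E V) U := by
  unfold sqMomentum upCoeff loCoeff
  exact (((analyticOnNhd_const.sub h).add analyticOnNhd_const).div_const).mul
    (((analyticOnNhd_const.sub h).sub analyticOnNhd_const).div_const)

lemma ofReal_of_real (hV : ∀ x : ℝ, (V x).im = 0) (x : ℝ) : V x = ((V x).re : ℝ) :=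
  Complex.ext (by simp) (by simpa using hV x)

lemma upCoeff_ofReal (hV : ∀ x : ℝ, (V x).im = 0) (x : ℝ) :
    upCoeff m c E V x = (((E - (V x).re + m * c ^ 2) / c : ℝ) : ℂ) := by
  rw [upCoeff, ofReal_of_real hV]; push_cast; simp

lemma loCoeff_ofReal (hV : ∀ x : ℝ, (V x).im = 0) (x : ℝ) :
    loCoeff m c E V x = (((E - (V x).re - m * c ^ 2) / c : ℝ) : ℂ) := by
  rw [loCoeff, ofReal_of_real hV]; push_cast; simp

lemma sqMomentum_ofReal (hV : ∀ x : ℝ, (V x).im = 0) (x : ℝ) :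
    sqMomentum m c E V x = (((-(m ^ 2 * c ^ 4) + ((V x).re - E) ^ 2) / c ^ 2 : ℝ) : ℂ) := by
  rw [sqMomentum, upCoeff_ofReal hV, loCoeff_ofReal hV, ← Complex.ofReal_mul]
  congr 1
  rw [div_mul_div_comm, ← sq]; congr 1; ring

open Metric in
lemma exists_diracGeometry {Vm Vp t₁ : ℝ} (hA : AssumptionA V Vm Vp) (hm : 0 < m) (hc : 0 < c)
    (hE1 : max (m * c ^ 2 + Vm) (Vp - m * c ^ 2) < E) (hE2 : E < Vp + m * c ^ 2)
    (hzero : ∀ x : ℝ, m ^ 2 * c ^ 4 - ((V x).re - E) ^ 2 = 0 ↔ x = t₁)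
    (hsimple : deriv (fun x : ℝ => m ^ 2 * c ^ 4 - ((V x).re - E) ^ 2) t₁ ≠ 0) :
    ∃ δ Y y R C f₀ w κ : ℝ, DiracGeometry m c E V Vm t₁ δ Y y R C f₀ w κ := by
  obtain ⟨δ, hδ, Y₀, hY₀, C₀, hC₀, han, hdV, htm, htp⟩ := hA.exists_strip
  have hV := hA.real_on_real
  have hlt := hA.lt
  have hEm : m * c ^ 2 < E - Vm := by linarith [(max_lt_iff.1 hE1).1]
  have hEp : -(m * c ^ 2) < E - Vp := by linarith [(max_lt_iff.1 hE1).2]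
  have hmc : 0 < m * c ^ 2 := by positivity
  set v : ℝ → ℝ := fun x => (V x).re with hv
  set W : ℝ → ℝ := fun x => (-(m ^ 2 * c ^ 4) + (v x - E) ^ 2) / c ^ 2 with hW
  set f : ℝ → ℝ := fun x => (E - v x + m * c ^ 2) / c with hf
  set g : ℝ → ℝ := fun x => (E - v x - m * c ^ 2) / c with hg
  have hWfg : ∀ x, W x = f x * g x := fun x => by
    simp only [hW, hf, hg]
    rw [div_mul_div_comm, ← sq]; congr 1; ring
  have hreal : ∀ x : ℝ, |((x : ℝ) : ℂ).im| < Y₀ := fun x => by simpa using hY₀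
  have hVc : Continuous fun x : ℝ => V x := continuous_iff_continuousAt.2 fun x =>
    (han x (hreal x)).continuousAt.comp Complex.continuous_ofReal.continuousAt
  have hvc : Continuous v := Complex.continuous_re.comp hVc
  have hWc : Continuous W := by simp only [hW]; fun_prop
  have hfc : Continuous f := by simp only [hf]; fun_prop
  have hvm : Tendsto v atBot (𝓝 Vm) := by
    rw [tendsto_iff_norm_sub_tendsto_zero]
    refine squeeze_zero' (.of_forall fun _ => norm_nonneg _) ?_
      (by simpa using (tendsto_japaneseWeight_atBot hδ).const_mul C₀)
    filter_upwards [eventually_le_atBot 0] with x hx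
    refine le_trans ?_ (htm x hx)
    simpa using Complex.abs_re_le_norm (V x - Vm)
  have hvp : Tendsto v atTop (𝓝 Vp) := by
    rw [tendsto_iff_norm_sub_tendsto_zero]
    refine squeeze_zero' (.of_forall fun _ => norm_nonneg _) ?_
      (by simpa using (tendsto_japaneseWeight_atTop hδ).const_mul C₀)
    filter_upwards [eventually_ge_atTop 0] with x hx
    refine le_trans ?_ (htp x hx)
    simpa using Complex.abs_re_le_norm (V x - Vp)
  have hlimW : ∀ {l : Filter ℝ} {v₀ : ℝ}, Tendsto v l (𝓝 v₀) →
      Tendsto W l (𝓝 ((-(m ^ 2 * c ^ 4) + (v₀ - E) ^ 2) / c ^ 2)) := fun h =>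
    (tendsto_const_nhds.add ((h.sub_const E).pow 2)).div_const _
  have hlimf : ∀ {l : Filter ℝ} {v₀ : ℝ}, Tendsto v l (𝓝 v₀) →
      Tendsto f l (𝓝 ((E - v₀ + m * c ^ 2) / c)) := fun h =>
    ((tendsto_const_nhds.sub h).add_const _).div_const _
  have hWm0 : 0 < (-(m ^ 2 * c ^ 4) + (Vm - E) ^ 2) / c ^ 2 := by
    apply div_pos _ (by positivity); nlinarith
  have hWp0 : (-(m ^ 2 * c ^ 4) + (Vp - E) ^ 2) / c ^ 2 < 0 := by
    apply div_neg_of_neg_of_pos _ (by positivity); nlinarith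
  have hW0 : ∀ x, W x = 0 ↔ x = t₁ := fun x => by
    rw [← hzero x, hW]
    simp only [div_eq_zero_iff, hv]
    constructor
    · rintro (h | h)
      · linarith
      · exact absurd h (by positivity)
    · intro h; left; linarith
  have hWl : ∀ x, x < t₁ → 0 < W x := by
    intro x hx
    by_contra hneg
    obtain ⟨a, ha⟩ := eventually_atBot.1 (((hlimW hvm).eventually_const_lt hWm0).and
      (eventually_le_atBot x))
    obtain ⟨h1, h2⟩ := ha a le_rfl
    obtain ⟨z, hz, hz0⟩ := intermediate_value_Icc' h2 hWc.continuousOn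
      (show (0 : ℝ) ∈ Icc (W x) (W a) from ⟨not_lt.1 hneg, h1.le⟩)
    have := (hW0 z).1 hz0
    linarith [hz.2]
  have hWr : ∀ x, t₁ < x → W x < 0 := by
    intro x hx
    by_contra hneg
    obtain ⟨a, ha⟩ := eventually_atTop.1 (((hlimW hvp).eventually_lt_const hWp0).and
      (eventually_ge_atTop x))
    obtain ⟨h1, h2⟩ := ha a le_rfl
    obtain ⟨z, hz, hz0⟩ := intermediate_value_Icc' h2 hWc.continuousOn
      (show (0 : ℝ) ∈ Icc (W a) (W x) from ⟨h1.le, not_lt.1 hneg⟩)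
    have := (hW0 z).1 hz0
    linarith [hz.1]
  have hfg : ∀ x, f x = g x + 2 * (m * c ^ 2) / c := fun x => by
    simp only [hf, hg]; rw [← add_div]; congr 1; ring
  have hfm0 : 0 < (E - Vm + m * c ^ 2) / c := by apply div_pos _ hc; linarith
  have hfp0 : 0 < (E - Vp + m * c ^ 2) / c := by apply div_pos _ hc; linarith
  have hf0 : ∀ x, x ≠ t₁ → f x ≠ 0 := fun x hx h0 => hx ((hW0 x).1 (by rw [hWfg, h0, zero_mul]))
  have hfl : ∀ x, x < t₁ → 0 < f x := by
    intro x hx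
    by_contra hneg
    obtain ⟨a, ha⟩ := eventually_atBot.1 (((hlimf hvm).eventually_const_lt hfm0).and
      (eventually_le_atBot x))
    obtain ⟨h1, h2⟩ := ha a le_rfl
    obtain ⟨z, hz, hz0⟩ := intermediate_value_Icc' h2 hfc.continuousOn
      (show (0 : ℝ) ∈ Icc (f x) (f a) from ⟨not_lt.1 hneg, h1.le⟩)
    exact hf0 z (by linarith [hz.2]) hz0
  have hfr : ∀ x, t₁ < x → 0 < f x := by
    intro x hx
    by_contra hneg
    obtain ⟨a, ha⟩ := eventually_atTop.1 (((hlimf hvp).eventually_const_lt hfp0).and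
      (eventually_ge_atTop x))
    obtain ⟨h1, h2⟩ := ha a le_rfl
    obtain ⟨z, hz, hz0⟩ := intermediate_value_Icc h2 hfc.continuousOn
      (show (0 : ℝ) ∈ Icc (f x) (f a) from ⟨not_lt.1 hneg, h1.le⟩)
    exact hf0 z (by linarith [hz.1]) hz0
  have hfpos : ∀ x, 0 < f x := by
    intro x
    rcases lt_trichotomy x t₁ with h | h | h
    · exact hfl x h
    · have hpos : 0 < 2 * (m * c ^ 2) / c := by positivity
      have : 2 * (m * c ^ 2) / c ≤ f t₁ := by
        refine ge_of_tendsto (hfc.continuousAt (x := t₁).tendsto.mono_left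
          (nhdsWithin_le_nhds (s := Iio t₁))) ?_
        filter_upwards [self_mem_nhdsWithin] with z hz
        have h1 := hWl z hz
        rw [hWfg] at h1
        have := pos_of_mul_pos_right h1 (hfl z hz).le
        linarith [hfg z]
      rw [h]; linarith
    · exact hfr x h
  obtain ⟨f₁, hf₁0, hf₁⟩ := exists_pos_le_of_tendsto hfc hfpos hfm0 hfp0 (hlimf hvm) (hlimf hvp)
  have hw1 : ∀ x, japaneseWeight δ x ≤ 1 := japaneseWeight_le_one hδ
  have hdV1 : ∀ z : ℂ, |z.im| < Y₀ → ‖deriv V z‖ ≤ C₀ := fun z hz =>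
    (hdV z hz).trans (mul_le_of_le_one_right hC₀.le (hw1 _))
  have hVreal : ∀ x : ℝ, ‖V x‖ ≤ C₀ + |Vm| + |Vp| := by
    intro x
    rcases le_total x 0 with h | h
    · have := norm_le_norm_add_norm_sub' (V x) Vm
      rw [Complex.norm_real, Real.norm_eq_abs] at this
      have h2 := (htm x h).trans (mul_le_of_le_one_right hC₀.le (hw1 _))
      linarith [abs_nonneg Vp]
    · have := norm_le_norm_add_norm_sub' (V x) Vp
      rw [Complex.norm_real, Real.norm_eq_abs] at this
      have h2 := (htp x h).trans (mul_le_of_le_one_right hC₀.le (hw1 _))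
      linarith [abs_nonneg Vm]
  -- shrink the strip
  obtain ⟨Y, hY, hYY₀, hYf, hY1⟩ : ∃ Y > 0, Y ≤ Y₀ ∧ C₀ / c * Y ≤ f₁ / 2 ∧ Y ≤ 1 :=
    ⟨min (min Y₀ (f₁ / 2 / (C₀ / c))) 1, by positivity,
      (min_le_left _ _).trans (min_le_left _ _), by
        calc C₀ / c * min (min Y₀ (f₁ / 2 / (C₀ / c))) 1 ≤ C₀ / c * (f₁ / 2 / (C₀ / c)) := by
              gcongr; exact (min_le_left _ _).trans (min_le_right _ _)
          _ = f₁ / 2 := by field_simp, min_le_right _ _⟩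
  have hanY : AnalyticOnNhd ℂ V {z | |z.im| < Y} := han.mono fun z hz =>
    lt_of_lt_of_le (show |z.im| < Y from hz) hYY₀
  have hVn : ∀ z : ℂ, |z.im| < Y → ‖V z - V (z.re : ℝ)‖ ≤ C₀ * |z.im| := fun z hz =>
    norm_sub_re_le hanY (fun z hz => hdV1 z (hz.trans_le hYY₀)) hz
  set C₁ := 2 * C₀ + |Vm| + |Vp| with hC₁
  have hVb : ∀ z : ℂ, |z.im| < Y → ‖V z‖ ≤ C₁ := fun z hz => by
    have h1 := hVn z hz
    have h2 := norm_le_norm_add_norm_sub' (V z) (V (z.re : ℝ))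
    have h3 := hVreal z.re
    have h4 : C₀ * |z.im| ≤ C₀ := mul_le_of_le_one_right hC₀.le (by linarith)
    linarith
  set C₂ := (|E| + C₁ + m * c ^ 2) / c with hC₂
  have hC₂0 : 0 < C₂ := by positivity
  have hub : ∀ z : ℂ, |z.im| < Y → ‖upCoeff m c E V z‖ ≤ C₂ := fun z hz => by
    rw [upCoeff, norm_div, Complex.norm_real, Real.norm_of_nonneg hc.le, hC₂]
    gcongr
    refine (norm_add_le _ _).trans (add_le_add ((norm_sub_le _ _).trans (add_le_add ?_ (hVb z hz))) ?_)
    · simp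
    · simp [abs_of_pos hm]
  have hlb : ∀ z : ℂ, |z.im| < Y → ‖loCoeff m c E V z‖ ≤ C₂ := fun z hz => by
    rw [loCoeff, norm_div, Complex.norm_real, Real.norm_of_nonneg hc.le, hC₂]
    gcongr
    refine (norm_sub_le _ _).trans (add_le_add ((norm_sub_le _ _).trans (add_le_add ?_ (hVb z hz))) ?_)
    · simp
    · simp [abs_of_pos hm]
  have hup : ∀ z : ℂ, |z.im| < Y → f₁ / 2 ≤ (upCoeff m c E V z).re := fun z hz => by
    have h1 := hVn z hz
    have h2 : upCoeff m c E V z = upCoeff m c E V (z.re : ℝ) - (V z - V (z.re : ℝ)) / c := by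
      simp only [upCoeff]; ring
    rw [h2, upCoeff_ofReal hV, Complex.sub_re, Complex.ofReal_re]
    have h3 : ((V z - V (z.re : ℝ)) / (c : ℂ)).re ≤ f₁ / 2 := by
      refine (Complex.re_le_norm _).trans ?_
      rw [norm_div, Complex.norm_real, Real.norm_of_nonneg hc.le]
      refine le_trans ?_ hYf
      rw [div_mul_eq_mul_div]
      gcongr
      exact h1.trans (by gcongr)
    have := hf₁ z.re
    simp only [hf, hv] at this
    linarith
  have hWan : AnalyticOnNhd ℂ (sqMomentum m c E V) {z | |z.im| < Y} :=
    analyticOnNhd_sqMomentum hanY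
  have hWd : ∀ z : ℂ, |z.im| < Y → ‖deriv (sqMomentum m c E V) z‖ ≤ C₀ / c * (C₂ + C₂) := by
    intro z hz
    rw [(hasDerivAt_sqMomentum (hanY z hz).differentiableAt.hasDerivAt).deriv, norm_mul, norm_div,
      norm_neg, Complex.norm_real, Real.norm_of_nonneg hc.le]
    gcongr
    · exact hdV1 z (hz.trans_le hYY₀)
    · exact (norm_add_le _ _).trans (add_le_add (hub z hz) (hlb z hz))
  have hWre : ∀ x : ℝ, (sqMomentum m c E V x).re = W x := fun x => by
    rw [sqMomentum_ofReal hV, Complex.ofReal_re]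
  have hW'at : HasDerivAt (sqMomentum m c E V) (deriv (sqMomentum m c E V) t₁) (t₁ : ℂ) :=
    (hWan t₁ (by simpa using hY)).differentiableAt.hasDerivAt
  set d := deriv (sqMomentum m c E V) t₁ with hd
  have hWd' : HasDerivAt W d.re t₁ := by
    have := hW'at.real_of_complex
    refine this.congr_of_eventuallyEq (.of_forall fun x => ?_)
    exact (hWre x).symm
  have hd0 : d.re < 0 := by
    refine lt_of_le_of_ne ?_ ?_
    · have h1 := hasDerivAt_iff_tendsto_slope.1 hWd'
      refine le_of_tendsto (h1.mono_left (nhdsWithin_mono (s := Ioi t₁) _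
        fun x hx => (ne_of_gt hx))) ?_
      filter_upwards [self_mem_nhdsWithin] with x hx
      rw [slope_def_field, (hW0 t₁).2 rfl]
      exact div_nonpos_of_nonpos_of_nonneg (by linarith [hWr x hx]) (sub_nonneg.2 (le_of_lt hx))
    · intro h0
      apply hsimple
      have h1 := hWd'.const_mul (-c ^ 2)
      rw [h0, mul_zero] at h1
      rw [← h1.deriv]
      congr 1
      funext x
      simp only [hW, hv]
      field_simp
      ring
  set κ := -d.re / 2 with hκ
  have hκ0 : 0 < κ := by rw [hκ]; linarith
  obtain ⟨R₁, hR₁0, hR₁⟩ : ∃ R > 0, ∀ z ∈ ball (t₁ : ℂ) R,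
      ‖deriv (sqMomentum m c E V) z - d‖ ≤ κ := by
    have h1 : ContinuousAt (deriv (sqMomentum m c E V)) (t₁ : ℂ) :=
      (hWan t₁ (by simpa using hY)).deriv.continuousAt
    obtain ⟨R, hR, h⟩ := Metric.continuousAt_iff.1 h1 κ hκ0
    exact ⟨R, hR, fun z hz => by
      have := (h hz).le
      rwa [dist_eq_norm] at this⟩
  set R := min R₁ Y with hR
  have hR0 : 0 < R := by positivity
  have hballY : ∀ z ∈ ball (t₁ : ℂ) R, |z.im| < Y := fun z hz => by
    have h1 := Complex.abs_im_le_norm (z - t₁)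
    rw [mem_ball, dist_eq_norm] at hz
    simp only [Complex.sub_im, Complex.ofReal_im, sub_zero] at h1
    linarith [min_le_right R₁ Y]
  have hball : ∀ z ∈ ball (t₁ : ℂ) R, 0 ≤ z.im → (sqMomentum m c E V z).im ≤ -κ * z.im := by
    intro z hz hz0
    have hzr : ((z.re : ℝ) : ℂ) ∈ ball (t₁ : ℂ) R := by
      rw [mem_ball, dist_eq_norm] at hz ⊢
      refine lt_of_le_of_lt ?_ hz
      rw [← Complex.ofReal_sub, Complex.norm_real, Real.norm_eq_abs]
      simpa using Complex.abs_re_le_norm (z - t₁)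
    have h1 := (convex_ball (t₁ : ℂ) R).norm_image_sub_le_of_norm_hasDerivWithin_le
      (f := fun z => sqMomentum m c E V z - d * z)
      (f' := fun z => deriv (sqMomentum m c E V) z - d) (C := κ)
      (fun x hx => by
        exact (((hWan x (hballY x hx)).differentiableAt.hasDerivAt.sub
          ((hasDerivAt_id x).const_mul d)).congr_deriv (by simp)).hasDerivWithinAt)
      (fun x hx => hR₁ x (ball_subset_ball (min_le_left _ _) hx)) hzr hz
    have h2 : z - (z.re : ℝ) = z.im * I := by apply Complex.ext <;> simp
    have h3 : sqMomentum m c E V z - d * z - (sqMomentum m c E V (z.re : ℝ) - d * (z.re : ℝ))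
        = sqMomentum m c E V z - sqMomentum m c E V (z.re : ℝ) - d * (z.im * I) := by
      rw [← h2]; ring
    rw [h3, h2, norm_mul, Complex.norm_I, mul_one, Complex.norm_real, Real.norm_of_nonneg hz0] at h1
    have h4 := (Complex.abs_im_le_norm _).trans h1
    rw [sqMomentum_ofReal hV] at h4
    have h5 := (abs_le.1 h4).2
    have h6 : ∀ a : ℂ, ∀ r : ℝ, (a - r - d * (z.im * I)).im = a.im - d.re * z.im := fun a r => by
      simp
    rw [h6] at h5
    rw [hκ] at h5 ⊢
    linarith
  -- bounds away from the turning point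
  obtain ⟨w₁, hw₁0, hw₁⟩ := exists_pos_le_of_tendsto (F := fun x => W (min x (t₁ - R / 4)))
    (hWc.comp (continuous_id.min continuous_const))
    (fun x => hWl _ (by linarith [min_le_right x (t₁ - R / 4)]))
    hWm0 (hWl (t₁ - R / 4) (by linarith))
    ((hlimW hvm).congr' (by
      filter_upwards [eventually_le_atBot (t₁ - R / 4)] with x hx
      rw [min_eq_left hx]))
    (tendsto_const_nhds.congr' (by
      filter_upwards [eventually_ge_atTop (t₁ - R / 4)] with x hx
      rw [min_eq_right hx]))
  obtain ⟨w₂, hw₂0, hw₂⟩ := exists_pos_le_of_tendsto (F := fun x => -W (max x (t₁ + R / 4)))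
    (hWc.comp (continuous_id.max continuous_const)).neg
    (fun x => neg_pos.2 (hWr _ (by linarith [le_max_right x (t₁ + R / 4)])))
    (neg_pos.2 (hWr (t₁ + R / 4) (by linarith))) (neg_pos.2 hWp0)
    (tendsto_const_nhds.congr' (by
      filter_upwards [eventually_le_atBot (t₁ + R / 4)] with x hx
      rw [max_eq_right hx]))
    ((hlimW hvp).neg.congr' (by
      filter_upwards [eventually_ge_atTop (t₁ + R / 4)] with x hx
      rw [max_eq_left hx]))
  set C₃ := C₀ / c * (C₂ + C₂) with hC₃
  have hC₃0 : 0 < C₃ := by positivity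
  set w := min w₁ w₂ / 2 with hw
  have hw0 : 0 < w := by positivity
  set y := min Y (w / C₃) with hy
  have hyw : C₃ * y ≤ w := by
    calc C₃ * y ≤ C₃ * (w / C₃) := by gcongr; exact min_le_right _ _
      _ = w := by field_simp
  have hWn : ∀ z : ℂ, |z.im| < y → |(sqMomentum m c E V z).re - W z.re| ≤ w := fun z hz => by
    have h1 := norm_sub_re_le hWan hWd (hz.trans_le (min_le_left _ _))
    have h2 := Complex.abs_re_le_norm (sqMomentum m c E V z - sqMomentum m c E V (z.re : ℝ))
    rw [Complex.sub_re, hWre] at h2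
    refine h2.trans (h1.trans (le_trans ?_ hyw))
    gcongr
  refine ⟨δ, Y, y, R, max C₀ (max C₂ (C₂ * C₂)), f₁ / 2, w, κ, hδ, hY, by positivity,
    min_le_left _ _, hR0, min_le_right _ _, by positivity, by positivity, hw0, hκ0, hV, hanY, ?_, ?_,
    hup, ?_, ?_, ?_, ?_, ?_, hball, ?_, ?_, ?_⟩
  · intro z hz
    exact (hdV z (hz.trans_le hYY₀)).trans (mul_le_mul_of_nonneg_right (le_max_left _ _)
      (japaneseWeight_pos _ _).le)
  · intro x hx
    exact (htm x hx).trans (mul_le_mul_of_nonneg_right (le_max_left _ _)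
      (japaneseWeight_pos _ _).le)
  · exact fun z hz => (hub z hz).trans ((le_max_left _ _).trans (le_max_right _ _))
  · exact fun z hz => (hlb z hz).trans ((le_max_left _ _).trans (le_max_right _ _))
  · intro z hz
    rw [sqMomentum, norm_mul]
    exact (mul_le_mul (hub z hz) (hlb z hz) (norm_nonneg _) hC₂0.le).trans
      ((le_max_right _ _).trans (le_max_right _ _))
  · intro z hz hzr
    have h1 := (abs_le.1 (hWn z hz)).1
    have h2 := hw₁ z.re
    simp only [min_eq_left hzr.le] at h2
    have h3 : 2 * w ≤ w₁ := by rw [hw]; linarith [min_le_left w₁ w₂]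
    linarith
  · intro z hz hzr
    have h1 := (abs_le.1 (hWn z hz)).2
    have h2 := hw₂ z.re
    simp only [max_eq_left hzr.le] at h2
    have h3 : 2 * w ≤ w₂ := by rw [hw]; linarith [min_le_right w₁ w₂]
    linarith
  · intro x hx; rw [hWre]; exact hWl x hx
  · intro x hx; rw [hWre]; exact hWr x hx
  · rw [sqMomentum_ofReal hV]
    have := (hW0 t₁).2 rfl
    simp only [hW, hv] at this
    rw [this, Complex.ofReal_zero]

end Geometry

section Momentum

/-- The branch `e^{-iπ/4} (iW)^{1/2}` of the square root of `W`, holomorphic off the positive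
imaginary axis. -/
noncomputable def branchSqrt (W : ℂ) : ℂ := cexp (-(Real.pi / 4) * I) * (I * W) ^ (2⁻¹ : ℂ)

/-- The classical momentum. -/
noncomputable def momentum (m c E : ℝ) (V : ℂ → ℂ) (z : ℂ) : ℂ :=
  branchSqrt (sqMomentum m c E V z)

/-- The amplitude `(upCoeff / loCoeff)^{1/4}` of the diagonalised system. -/
noncomputable def amplitude (m c E : ℝ) (V : ℂ → ℂ) (z : ℂ) : ℂ :=
  cexp (2⁻¹ * log (upCoeff m c E V z) - 4⁻¹ * log (I * sqMomentum m c E V z)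
    + Real.pi / 8 * I)

/-- The logarithmic derivative of the amplitude, coupling the diagonalised equations. -/
noncomputable def coupling (m c E : ℝ) (V : ℂ → ℂ) (z : ℂ) : ℂ :=
  m * deriv V z / (2 * sqMomentum m c E V z)

lemma exp_quarter : cexp (-(Real.pi / 4) * I) = (Real.sqrt 2 / 2 : ℝ) * (1 - I) := by
  have : (-(Real.pi / 4) * I : ℂ) = ((-(Real.pi / 4) : ℝ) : ℂ) * I := by push_cast; ring
  rw [this, Complex.exp_mul_I, ← Complex.ofReal_cos, ← Complex.ofReal_sin, Real.cos_neg,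
    Real.sin_neg, Real.cos_pi_div_four, Real.sin_pi_div_four]
  push_cast; ring

lemma sq_sqrt_two : ((Real.sqrt 2 : ℝ) : ℂ) ^ 2 = 2 := by
  rw [← Complex.ofReal_pow, Real.sq_sqrt (by norm_num)]; norm_num

lemma branchSqrt_sq (W : ℂ) : branchSqrt W ^ 2 = W := by
  have h := Complex.cpow_nat_inv_pow (I * W) (n := 2) (by norm_num)
  rw [Nat.cast_ofNat] at h
  rw [branchSqrt, mul_pow, h, exp_quarter, mul_pow]
  push_cast
  rw [div_pow, sq_sqrt_two]
  linear_combination (-W + I * W / 2) * I_sq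

lemma norm_branchSqrt_sq (W : ℂ) : ‖branchSqrt W‖ ^ 2 = ‖W‖ := by
  rw [← norm_pow, branchSqrt_sq]

lemma branchSqrt_ne_zero {W : ℂ} (hW : W ≠ 0) : branchSqrt W ≠ 0 := fun h => by
  have := branchSqrt_sq W
  rw [h] at this
  exact hW (by rw [← this]; simp)

lemma branchSqrt_zero : branchSqrt 0 = 0 := by
  simp [branchSqrt]

lemma continuousAt_branchSqrt {W : ℂ} (hW : I * W ∈ slitPlane ∨ W = 0) :
    ContinuousAt branchSqrt W := by
  have h1 : ContinuousAt (fun z : ℂ => z ^ (2⁻¹ : ℂ)) (I * W) := by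
    refine Complex.continuousAt_cpow_const_of_re_pos ?_ (by norm_num)
    rcases hW with h | h
    · exact h.imp le_of_lt id
    · left; simp [h]
  have h2 : ContinuousAt (fun z : ℂ => (I * z) ^ (2⁻¹ : ℂ)) W :=
    ContinuousAt.comp (f := fun z : ℂ => I * z) (g := fun z : ℂ => z ^ (2⁻¹ : ℂ)) h1 (by fun_prop)
  exact continuousAt_const.mul h2

lemma branchSqrt_re_im {W : ℂ} (hW : W.im ≤ 0) :
    0 ≤ (branchSqrt W).re ∧ (branchSqrt W).im ≤ 0 := by
  set s := (I * W) ^ (2⁻¹ : ℂ) with hs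
  have h0 : 0 ≤ s.re := by rw [hs, Complex.cpow_inv_two_re]; exact Real.sqrt_nonneg _
  have h1 : s ^ 2 = I * W := by
    have h := Complex.cpow_nat_inv_pow (I * W) (n := 2) (by norm_num)
    rwa [Nat.cast_ofNat] at h
  have h2 : s.re ^ 2 - s.im ^ 2 = -W.im := by
    have := congrArg Complex.re h1
    rw [sq, Complex.mul_re] at this
    simp at this
    nlinarith
  have h3 : |s.im| ≤ s.re := abs_le_of_sq_le_sq (by linarith) h0
  have h4 := abs_le.1 h3
  have hp : branchSqrt W = (Real.sqrt 2 / 2 : ℝ) * ((1 - I) * s) := by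
    rw [branchSqrt, exp_quarter, mul_assoc]
  have hr : 0 ≤ Real.sqrt 2 / 2 := by positivity
  rw [hp, Complex.re_ofReal_mul, Complex.im_ofReal_mul]
  constructor
  · apply mul_nonneg hr
    simp; linarith [h4.1]
  · apply mul_nonpos_of_nonneg_of_nonpos hr
    simp; linarith [h4.2]

lemma branchSqrt_of_pos {x : ℝ} (hx : 0 < x) : branchSqrt x = Real.sqrt x := by
  have h1 : I * (x : ℂ) = ((Real.sqrt x * (Real.sqrt 2 / 2) : ℝ) * (1 + I)) ^ 2 := by
    have : ((Real.sqrt x : ℝ) : ℂ) ^ 2 = x := by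
      rw [← Complex.ofReal_pow, Real.sq_sqrt hx.le]
    push_cast
    rw [mul_pow, mul_pow, div_pow, this, sq_sqrt_two]
    linear_combination (-(x:ℂ) / 2) * I_sq
  rw [branchSqrt, h1, Complex.sq_cpow_two_inv, exp_quarter]
  · push_cast
    linear_combination (1 / 2 * ((Real.sqrt x : ℝ) : ℂ)) * sq_sqrt_two
      - (((Real.sqrt x : ℝ) : ℂ) * ((Real.sqrt 2 : ℝ) : ℂ) ^ 2 / 4) * I_sq
  · rw [Complex.re_ofReal_mul]
    have := Real.sqrt_pos.2 hx
    simp; positivity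

lemma branchSqrt_of_neg {x : ℝ} (hx : x < 0) : branchSqrt x = -I * Real.sqrt (-x) := by
  have h1 : I * (x : ℂ) = ((Real.sqrt (-x) * (Real.sqrt 2 / 2) : ℝ) * (1 - I)) ^ 2 := by
    have : ((Real.sqrt (-x) : ℝ) : ℂ) ^ 2 = -x := by
      rw [← Complex.ofReal_pow, Real.sq_sqrt (by linarith)]; push_cast; ring
    push_cast
    rw [mul_pow, mul_pow, div_pow, this, sq_sqrt_two]
    linear_combination ((x:ℂ) / 2) * I_sq
  rw [branchSqrt, h1, Complex.sq_cpow_two_inv, exp_quarter]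
  · push_cast
    linear_combination (-(1 / 2) * I * ((Real.sqrt (-x) : ℝ) : ℂ)) * sq_sqrt_two
      + (((Real.sqrt (-x) : ℝ) : ℂ) * ((Real.sqrt 2 : ℝ) : ℂ) ^ 2 / 4) * I_sq
  · rw [Complex.re_ofReal_mul]
    have := Real.sqrt_pos.2 (neg_pos.2 hx)
    rw [show (1 - I : ℂ).re = 1 by simp]; positivity

lemma analyticAt_branchSqrt_comp {F : ℂ → ℂ} {z : ℂ} (hF : AnalyticAt ℂ F z)
    (hz : I * F z ∈ slitPlane) : AnalyticAt ℂ (fun z => branchSqrt (F z)) z :=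
  analyticAt_const.mul ((analyticAt_const.mul hF).cpow analyticAt_const hz)

lemma ne_zero_of_I_mul_mem_slitPlane {W : ℂ} (h : I * W ∈ slitPlane) : W ≠ 0 := fun h0 => by
  simp [h0] at h

lemma I_mul_mem_slitPlane {W : ℂ} (h : W.im < 0 ∨ W.re ≠ 0) : I * W ∈ slitPlane := by
  rw [Complex.mem_slitPlane_iff]
  simpa using h

variable {m c E : ℝ} {V : ℂ → ℂ} {z : ℂ}

lemma amplitude_ne_zero (z : ℂ) : amplitude m c E V z ≠ 0 := Complex.exp_ne_zero _

lemma amplitude_sq (hf : upCoeff m c E V z ≠ 0) (hW : sqMomentum m c E V z ≠ 0) :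
    amplitude m c E V z ^ 2 * momentum m c E V z = upCoeff m c E V z := by
  rw [amplitude, momentum, branchSqrt, Complex.cpow_def_of_ne_zero (by simpa using hW),
    ← Complex.exp_nat_mul, ← Complex.exp_add, ← Complex.exp_add]
  conv_rhs => rw [← Complex.exp_log hf]
  congr 1
  push_cast
  ring

lemma momentum_eq (hf : upCoeff m c E V z ≠ 0) (hW : sqMomentum m c E V z ≠ 0) :
    momentum m c E V z = loCoeff m c E V z * amplitude m c E V z ^ 2 := by
  have h1 := amplitude_sq hf hW
  have h2 : momentum m c E V z ^ 2 = upCoeff m c E V z * loCoeff m c E V z := branchSqrt_sq _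
  have h3 : momentum m c E V z ≠ 0 := branchSqrt_ne_zero hW
  apply mul_right_cancel₀ h3
  rw [mul_assoc, h1, ← sq, h2]; ring

lemma hasDerivAt_amplitude (hc : c ≠ 0) (hV : DifferentiableAt ℂ V z)
    (hf : upCoeff m c E V z ∈ slitPlane)
    (hW : I * sqMomentum m c E V z ∈ slitPlane) :
    HasDerivAt (amplitude m c E V) (coupling m c E V z * amplitude m c E V z) z := by
  have h1 := (hasDerivAt_upCoeff (m := m) (c := c) (E := E) hV.hasDerivAt).clog hf
  have h2 := ((hasDerivAt_sqMomentum (m := m) (c := c) (E := E) hV.hasDerivAt).const_mul I).clog hW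
  have h3 := (((h1.const_mul (2⁻¹ : ℂ)).sub (h2.const_mul (4⁻¹ : ℂ))).add_const
    ((Real.pi : ℂ) / 8 * I)).cexp
  refine h3.congr_deriv ?_
  have hf0 := slitPlane_ne_zero hf
  have hW0 := ne_zero_of_I_mul_mem_slitPlane hW
  have hg0 : loCoeff m c E V z ≠ 0 := fun h => hW0 (by simp [sqMomentum, h])
  have hc' : (c : ℂ) ≠ 0 := by exact_mod_cast hc
  rw [mul_comm (coupling m c E V z)]
  change amplitude m c E V z * _ = _
  congr 1
  have hfg : upCoeff m c E V z - loCoeff m c E V z = 2 * m * c := by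
    simp only [upCoeff, loCoeff]; field_simp; ring
  rw [coupling]
  simp only [sqMomentum]
  field_simp
  linear_combination (2 * deriv V z) * hfg

lemma amplitude_ofReal_right (hV : ∀ x : ℝ, (V x).im = 0) {x : ℝ}
    (hf : 0 < (upCoeff m c E V x).re) (hW : (sqMomentum m c E V x).re < 0) :
    amplitude m c E V x = I * (starRingEnd ℂ) (amplitude m c E V x) := by
  set a := (upCoeff m c E V x).re with ha
  set b := (sqMomentum m c E V x).re with hb
  have h1 : upCoeff m c E V x = (a : ℂ) := by
    rw [ha, upCoeff_ofReal hV, Complex.ofReal_re]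
  have h2 : sqMomentum m c E V x = (b : ℂ) := by
    rw [hb, sqMomentum_ofReal hV, Complex.ofReal_re]
  have h3 : log (I * (b : ℂ)) = (Real.log (-b) : ℝ) - Real.pi / 2 * I := by
    have : I * (b : ℂ) = ((-b : ℝ) : ℂ) * (-I) := by push_cast; ring
    rw [this, Complex.log_ofReal_mul (by linarith) (by simp), Complex.log_neg_I]; ring
  have h4 : amplitude m c E V x
      = cexp ((2⁻¹ * Real.log a - 4⁻¹ * Real.log (-b) : ℝ) + Real.pi / 4 * I) := by
    rw [amplitude, h1, h2, h3, ← Complex.ofReal_log hf.le]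
    congr 1; push_cast; ring
  rw [h4, ← Complex.exp_conj]
  have h5 : I = cexp (Real.pi / 2 * I) := by
    rw [Complex.exp_mul_I]
    rw [show (Real.pi / 2 : ℂ) = ((Real.pi / 2 : ℝ) : ℂ) by push_cast; ring, ← Complex.ofReal_cos,
      ← Complex.ofReal_sin, Real.cos_pi_div_two, Real.sin_pi_div_two]
    simp
  have h6 : ∀ w, I * cexp w = cexp (Real.pi / 2 * I + w) := fun w => by
    rw [Complex.exp_add, ← h5]
  rw [h6]
  congr 1
  rw [map_add, map_mul, Complex.conj_ofReal, map_div₀, Complex.conj_ofReal, Complex.conj_I,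
    map_ofNat]
  ring

lemma amplitude_ofReal_left (hV : ∀ x : ℝ, (V x).im = 0) {x : ℝ}
    (hf : 0 < (upCoeff m c E V x).re) (hW : 0 < (sqMomentum m c E V x).re) :
    amplitude m c E V x
      = (Real.exp (2⁻¹ * Real.log (upCoeff m c E V x).re
        - 4⁻¹ * Real.log (sqMomentum m c E V x).re) : ℝ) := by
  set a := (upCoeff m c E V x).re with ha
  set b := (sqMomentum m c E V x).re with hb
  have h1 : upCoeff m c E V x = (a : ℂ) := by
    rw [ha, upCoeff_ofReal hV, Complex.ofReal_re]
  have h2 : sqMomentum m c E V x = (b : ℂ) := by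
    rw [hb, sqMomentum_ofReal hV, Complex.ofReal_re]
  have h3 : log (I * (b : ℂ)) = (Real.log b : ℝ) + Real.pi / 2 * I := by
    rw [mul_comm, Complex.log_ofReal_mul hW Complex.I_ne_zero, Complex.log_I]
  rw [amplitude, h1, h2, h3, ← Complex.ofReal_log hf.le, Complex.ofReal_exp]
  congr 1; push_cast; ring

end Momentum

section WkbSegment

/-- A region in which the diagonalised Dirac system is holomorphic and uniformly controlled. -/
structure WkbDomain (m c E : ℝ) (V : ℂ → ℂ) (δ : ℝ) (U : Set ℂ) (C : ℝ) : Prop where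
  one_lt : 1 < δ
  hc : 0 < c
  analytic : AnalyticOnNhd ℂ V U
  slit : ∀ z ∈ U, I * sqMomentum m c E V z ∈ slitPlane
  up : ∀ z ∈ U, upCoeff m c E V z ∈ slitPlane
  one_le : 1 ≤ C
  norm_w : ∀ z ∈ U, ‖I / (2 * momentum m c E V z)‖ ≤ C
  norm_p : ∀ z ∈ U, ‖momentum m c E V z‖ ≤ C
  norm_ν : ∀ z ∈ U, ‖coupling m c E V z‖ ≤ C * japaneseWeight δ z.re

/-- The approximate solutions of the Riccati equation attached to the Dirac system. -/
noncomputable def diracRiccati (m c E : ℝ) (V : ℂ → ℂ) (n : ℕ) : ℂ × ℂ → ℂ :=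
  riccatiIter (fun z => I / (2 * momentum m c E V z)) (coupling m c E V) n

/-- Gevrey bounds for the approximate solutions of the Riccati equation. -/
structure RiccatiBounds (m c E : ℝ) (V : ℂ → ℂ) (δ : ℝ) (U : Set ℂ) (r ρ B : ℝ) : Prop where
  hr : 0 < r
  hρ : 0 < ρ
  one_le : 1 ≤ B
  mul_le : ρ * B ≤ 1 / 2
  bound : ∀ N : ℕ, 1 ≤ N → ∀ h : ℂ, ‖h‖ * N ≤ ρ → ∀ z, Metric.closedBall z r ⊆ U →
    ∀ n ≤ N + 1, ‖diracRiccati m c E V n (z, h)‖ ≤ B * ‖h‖ * japaneseWeight δ z.re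
  diff : ∀ N : ℕ, 1 ≤ N → ∀ h : ℂ, ‖h‖ * N ≤ ρ → ∀ z, Metric.closedBall z r ⊆ U → ∀ n ≤ N,
    ‖diracRiccati m c E V (n + 1) (z, h) - diracRiccati m c E V n (z, h)‖
      ≤ B * ‖h‖ * japaneseWeight δ z.re * (‖h‖ * N / (2 * ρ)) ^ n

variable {m c E : ℝ} {V : ℂ → ℂ} {δ : ℝ} {U : Set ℂ} {C r ρ B : ℝ}

lemma WkbDomain.ne_zero (D : WkbDomain m c E V δ U C) {z : ℂ} (hz : z ∈ U) :
    sqMomentum m c E V z ≠ 0 := ne_zero_of_I_mul_mem_slitPlane (D.slit z hz)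

lemma WkbDomain.analytic_momentum (D : WkbDomain m c E V δ U C) :
    AnalyticOnNhd ℂ (momentum m c E V) U := fun z hz =>
  analyticAt_branchSqrt_comp (analyticOnNhd_sqMomentum D.analytic z hz) (D.slit z hz)

lemma WkbDomain.analytic_w (D : WkbDomain m c E V δ U C) :
    AnalyticOnNhd ℂ (fun z => I / (2 * momentum m c E V z)) U := fun z hz =>
  analyticAt_const.div (analyticAt_const.mul (D.analytic_momentum z hz))
    (mul_ne_zero two_ne_zero (branchSqrt_ne_zero (D.ne_zero hz)))

lemma WkbDomain.analytic_ν (D : WkbDomain m c E V δ U C) :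
    AnalyticOnNhd ℂ (coupling m c E V) U := fun z hz =>
  (analyticAt_const.mul (D.analytic z hz).deriv).div
    (analyticAt_const.mul (analyticOnNhd_sqMomentum D.analytic z hz))
    (mul_ne_zero two_ne_zero (D.ne_zero hz))

lemma WkbDomain.exists_bounds (D : WkbDomain m c E V δ U C) (hr : 0 < r) (hr1 : r ≤ 1) :
    ∃ ρ B : ℝ, RiccatiBounds m c E V δ U r ρ B := by
  obtain ⟨ρ, hρ, B, hB, hρB, H⟩ := exists_riccatiIter_bound (U := U) (C := C)
    (κ := 3 ^ (δ / 2)) (r := r) (ω := fun z => japaneseWeight δ z.re)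
    D.analytic_w D.analytic_ν D.one_le
    (Real.one_le_rpow (by norm_num) (by linarith [D.one_lt])) hr
    (fun z => (japaneseWeight_pos _ _).le) (fun z => japaneseWeight_le_one D.one_lt _)
    (fun z z' h => japaneseWeight_shift D.one_lt (by
      have := Complex.abs_re_le_norm (z' - z)
      rw [Complex.sub_re] at this
      linarith)) D.norm_w D.norm_ν
  exact ⟨ρ, B, hr, hρ, hB, hρB, fun N hN h hh z hz => (H N hN h hh z hz).1,
    fun N hN h hh z hz => (H N hN h hh z hz).2⟩

/-- The diagonal components of a solution, relative to the exponential `e^d`, are `ε X`-close to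
those of the exact WKB solution with Riccati variable `Q`. -/
def WkbState (A y₁ y₂ Q d : ℂ) (ε X : ℝ) : Prop :=
  ‖(y₁ / A + A * y₂) / 2 * cexp (-d) - 1‖ ≤ ε * X ∧
  ‖((y₁ / A - A * y₂) / 2 - Q * ((y₁ / A + A * y₂) / 2)) * cexp (-d)‖ ≤ ε * X

/-- Propagation of WKB approximations along a straight segment. -/
lemma WkbDomain.propagate (D : WkbDomain m c E V δ U C) (R : RiccatiBounds m c E V δ U r ρ B)
    {z₀ e : ℂ} (he : ‖e‖ ≤ 1) {s₀ s₁ : ℝ} (hs : s₀ ≤ s₁)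
    (hpath : ∀ s ∈ Icc s₀ s₁, Metric.closedBall (z₀ + s * e) r ⊆ U)
    {h : ℝ} (hh : 0 < h) {N : ℕ} (hN : 1 ≤ N) (hhN : h * N ≤ ρ) {y₁ y₂ : ℝ → ℂ}
    (hy₁ : ∀ s ∈ Icc s₀ s₁, HasDerivAt y₁ (e * (I / h * upCoeff m c E V (z₀ + s * e) * y₂ s)) s)
    (hy₂ : ∀ s ∈ Icc s₀ s₁, HasDerivAt y₂ (e * (I / h * loCoeff m c E V (z₀ + s * e) * y₁ s)) s)
    {K μ X : ℝ} (hK : ∫ s in s₀..s₁, 2 * C * B * japaneseWeight δ (z₀ + s * e).re ≤ K)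
    (hμ : 0 ≤ μ)
    (hP : ∀ s ∈ Icc s₀ s₁, -μ ≤ (I / h * momentum m c E V (z₀ + s * e) * e).re)
    (hX : 0 ≤ X) {d : ℂ}
    (h₀ : WkbState (amplitude m c E V (z₀ + s₀ * e)) (y₁ s₀) (y₂ s₀)
      (diracRiccati m c E V N (z₀ + s₀ * e, h)) d ((1 / 2) ^ N) X) :
    WkbState (amplitude m c E V (z₀ + s₁ * e)) (y₁ s₁) (y₂ s₁)
      (diracRiccati m c E V N (z₀ + s₁ * e, h))
      (d + ∫ s in s₀..s₁, (I / h * momentum m c E V (z₀ + s * e) * e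
        - coupling m c E V (z₀ + s * e) * e * diracRiccati m c E V N (z₀ + s * e, h)))
      ((1 / 2) ^ N)
      (X + (K + 1) * (2 * Real.exp (3 * K + 2 * μ * (s₁ - s₀))) * (1 + X)) := by
  have hzU : ∀ s ∈ Icc s₀ s₁, z₀ + s * e ∈ U := fun s hs =>
    hpath s hs (Metric.mem_closedBall_self R.hr.le)
  have hC0 : 0 ≤ C := zero_le_one.trans D.one_le
  have hB0 : 0 ≤ B := zero_le_one.trans R.one_le
  have hzc : Continuous fun s : ℝ => z₀ + s * e := by fun_prop
  have hzd : ∀ s : ℝ, HasDerivAt (fun s : ℝ => z₀ + s * e) e s := fun s => by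
    have := ((Complex.ofRealCLM.hasDerivAt (x := s)).mul_const e).const_add z₀
    exact this.congr_deriv (by simp)
  have hcont : ∀ {F : ℂ → ℂ}, AnalyticOnNhd ℂ F U →
      ContinuousOn (fun s : ℝ => F (z₀ + s * e)) (Icc s₀ s₁) := fun hF =>
    hF.continuousOn.comp hzc.continuousOn hzU
  have hhC : (h : ℂ) ≠ 0 := by exact_mod_cast hh.ne'
  have hω : ∀ s : ℝ, 0 ≤ japaneseWeight δ (z₀ + s * e).re := fun s => (japaneseWeight_pos _ _).le
  have hω1 : ∀ s : ℝ, japaneseWeight δ (z₀ + s * e).re ≤ 1 := fun s =>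
    japaneseWeight_le_one D.one_lt _
  have hnh : ‖(h : ℂ)‖ = h := by rw [Complex.norm_real, Real.norm_of_nonneg hh.le]
  have hhN' : ‖(h : ℂ)‖ * N ≤ ρ := by rwa [hnh]
  have hhρ : h ≤ ρ := by
    have : (1 : ℝ) ≤ N := by exact_mod_cast hN
    nlinarith
  set A : ℝ → ℂ := fun s => amplitude m c E V (z₀ + s * e) with hA
  have hA0 : ∀ s, A s ≠ 0 := fun s => amplitude_ne_zero _
  have hAd : ∀ s ∈ Icc s₀ s₁,
      HasDerivAt A (e * (coupling m c E V (z₀ + s * e) * A s)) s := fun s hs => by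
    have := (hasDerivAt_amplitude D.hc.ne' (D.analytic _ (hzU s hs)).differentiableAt
      (D.up _ (hzU s hs)) (D.slit _ (hzU s hs))).scomp s (hzd s)
    exact this.congr_deriv (by simp [hA])
  have hup : ∀ s ∈ Icc s₀ s₁, upCoeff m c E V (z₀ + s * e)
      = A s ^ 2 * momentum m c E V (z₀ + s * e) := fun s hs =>
    (amplitude_sq (slitPlane_ne_zero (D.up _ (hzU s hs))) (D.ne_zero (hzU s hs))).symm
  have hlo : ∀ s ∈ Icc s₀ s₁, momentum m c E V (z₀ + s * e)
      = loCoeff m c E V (z₀ + s * e) * A s ^ 2 := fun s hs =>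
    momentum_eq (slitPlane_ne_zero (D.up _ (hzU s hs))) (D.ne_zero (hzU s hs))
  have hlo' : ∀ s ∈ Icc s₀ s₁, loCoeff m c E V (z₀ + s * e)
      = momentum m c E V (z₀ + s * e) / A s ^ 2 := fun s hs => by
    rw [hlo s hs, mul_div_cancel_right₀ _ (pow_ne_zero 2 (hA0 s))]
  have key := segment_estimate (s₀ := s₀) (s₁ := s₁)
    (a := fun s => (y₁ s / A s + A s * y₂ s) / 2 * cexp (-d))
    (b := fun s => (y₁ s / A s - A s * y₂ s) / 2 * cexp (-d))
    (P := fun s => I / h * momentum m c E V (z₀ + s * e) * e)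
    (k := fun s => coupling m c E V (z₀ + s * e) * e)
    (Q := fun s => diracRiccati m c E V N (z₀ + s * e, h))
    (R := fun s => e * (2 * I * momentum m c E V (z₀ + s * e) / h *
      (diracRiccati m c E V N (z₀ + s * e, h) - diracRiccati m c E V (N + 1) (z₀ + s * e, h))))
    (κ := fun s => 2 * C * B * japaneseWeight δ (z₀ + s * e).re)
    (ε := (1 / 2) ^ N) (μ := μ) (K := K) (X₀ := 1 + X) hs (by positivity)
    (pow_le_one₀ (by norm_num) (by norm_num)) hμ
    ((continuousOn_const.mul (hcont D.analytic_momentum)).mul continuousOn_const)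
    ((hcont D.analytic_ν).mul continuousOn_const)
    ((continuous_const.mul ((continuous_japaneseWeight δ).comp
      (Complex.continuous_re.comp hzc))).continuousOn)
    ?_ ?_ ?_ ?_ ?_ ?_ hP hK ?_ ?_
  · obtain ⟨k1, k2⟩ := key
    have e1 : ∀ u D' : ℂ, u * cexp (-(d + D')) = u * cexp (-d) * cexp (-D') := fun u D' => by
      rw [mul_assoc, ← Complex.exp_add]; congr 2; ring
    have hE : 0 ≤ 2 * Real.exp (3 * K + 2 * μ * (s₁ - s₀)) := by positivity
    have hK0 : 0 ≤ K := le_trans (intervalIntegral.integral_nonneg hs fun s _ =>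
      mul_nonneg (by positivity) (hω s)) hK
    have hε : (0 : ℝ) ≤ (1 / 2) ^ N := by positivity
    constructor
    · rw [e1]
      refine (norm_sub_le_norm_sub_add_norm_sub _ ((y₁ s₀ / A s₀ + A s₀ * y₂ s₀) / 2 * cexp (-d)) _).trans ?_
      refine (add_le_add k1 h₀.1).trans ?_
      rw [← mul_add]
      refine mul_le_mul_of_nonneg_left ?_ hε
      nlinarith [mul_nonneg hE hX]
    · rw [e1]
      have : ∀ u v Q' : ℂ, (u - Q' * v) * cexp (-d) = u * cexp (-d) - Q' * (v * cexp (-d)) :=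
        fun u v Q' => by ring
      rw [this]
      refine k2.trans (mul_le_mul_of_nonneg_left ?_ hε)
      nlinarith [mul_nonneg hE hX, mul_nonneg hK0 hE, mul_nonneg (mul_nonneg hK0 hE) hX]
  · intro s hs
    have := ((((hy₁ s hs).div (hAd s hs) (hA0 s)).add ((hAd s hs).mul (hy₂ s hs))).div_const 2).mul_const
      (cexp (-d))
    refine this.congr_deriv ?_
    rw [hup s hs, hlo' s hs]
    have := hA0 s
    field_simp
    ring
  · intro s hs
    have := ((((hy₁ s hs).div (hAd s hs) (hA0 s)).sub ((hAd s hs).mul (hy₂ s hs))).div_const 2).mul_const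
      (cexp (-d))
    refine this.congr_deriv ?_
    rw [hup s hs, hlo' s hs]
    have := hA0 s
    field_simp
    ring
  · intro s hs
    have h1 := (riccatiIter_hasDerivAt D.analytic_w D.analytic_ν N (hzU s hs) h).scomp s (hzd s)
    refine h1.congr_deriv ?_
    have h2 := riccatiIter_succ (w := fun z => I / (2 * momentum m c E V z))
      (ν := coupling m c E V) N (z₀ + s * e, h)
    simp only at h2
    have hp0 : momentum m c E V (z₀ + s * e) ≠ 0 := branchSqrt_ne_zero (D.ne_zero (hzU s hs))
    simp only [diracRiccati]
    rw [h2, smul_eq_mul]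
    generalize fderiv ℂ (riccatiIter (fun z => I / (2 * momentum m c E V z)) (coupling m c E V) N)
      (z₀ + s * e, (h : ℂ)) (1, 0) = F
    generalize riccatiIter (fun z => I / (2 * momentum m c E V z)) (coupling m c E V) N
      (z₀ + s * e, (h : ℂ)) = q
    generalize coupling m c E V (z₀ + s * e) = k
    generalize momentum m c E V (z₀ + s * e) = p at hp0
    field_simp
    linear_combination (e * h * (F + k - k * q ^ 2)) * I_sq
  · intro s hs
    rw [norm_mul]
    have h1 := D.norm_ν _ (hzU s hs)
    have h2 : ‖coupling m c E V (z₀ + s * e)‖ * ‖e‖ ≤ ‖coupling m c E V (z₀ + s * e)‖ :=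
      mul_le_of_le_one_right (norm_nonneg _) he
    have h3 : C * japaneseWeight δ (z₀ + s * e).re
        ≤ 2 * C * B * japaneseWeight δ (z₀ + s * e).re := by
      apply mul_le_mul_of_nonneg_right _ (hω s)
      nlinarith [R.one_le]
    linarith
  · intro s hs
    refine (R.bound N hN h hhN' _ (hpath s hs) N (by omega)).trans ?_
    rw [hnh]
    have h1 : B * h ≤ 1 / 2 := by nlinarith [R.mul_le]
    nlinarith [hω s, hω1 s, mul_nonneg hB0 hh.le]
  · intro s hs
    have h1 := R.diff N hN h hhN' _ (hpath s hs) N le_rfl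
    rw [hnh] at h1
    have h2 : (h * N / (2 * ρ)) ^ N ≤ (1 / 2) ^ N := by
      apply pow_le_pow_left₀ (by have := R.hρ; positivity)
      rw [div_le_div_iff₀ (by linarith [R.hρ]) (by norm_num)]
      linarith
    have h3 := D.norm_p _ (hzU s hs)
    rw [norm_mul, norm_mul, norm_div, norm_mul, norm_mul, hnh, Complex.norm_I, norm_sub_rev]
    simp only [Complex.norm_ofNat, mul_one]
    calc ‖e‖ * (2 * ‖momentum m c E V (z₀ + s * e)‖ / h * _)
        ≤ 1 * (2 * C / h * (B * h * japaneseWeight δ (z₀ + s * e).re * (1 / 2) ^ N)) := by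
          have := hω s
          gcongr
          exact h1.trans (by gcongr)
      _ = _ := by field_simp
  · have := norm_le_norm_add_norm_sub' ((y₁ s₀ / A s₀ + A s₀ * y₂ s₀) / 2 * cexp (-d)) 1
    have h2 := h₀.1
    have h3 : (1 / 2 : ℝ) ^ N * X ≤ X :=
      mul_le_of_le_one_left hX (pow_le_one₀ (by norm_num) (by norm_num))
    rw [norm_one] at this
    linarith
  · have h2 := h₀.2
    have : ∀ u v Q' : ℂ, (u - Q' * v) * cexp (-d) = u * cexp (-d) - Q' * (v * cexp (-d)) :=
      fun u v Q' => by ring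
    rw [this] at h2
    refine h2.trans (mul_le_mul_of_nonneg_left (by linarith) (by positivity))

end WkbSegment

section Jost

variable {h m c E Vm : ℝ} {V : ℂ → ℂ} {u v : ℝ → ℂ × ℂ}

lemma IsDiracSolution.hasDerivAt_fst (hu : IsDiracSolution h m c V E u) (hh : 0 < h) (hc : 0 < c)
    (x : ℝ) : HasDerivAt (fun x => (u x).1) (I / h * upCoeff m c E V x * (u x).2) x := by
  have h1 := (hu.diff1 x).hasDerivAt
  refine h1.congr_deriv ?_
  have h2 := hu.eq2 x
  have hh' : (h : ℂ) ≠ 0 := by exact_mod_cast hh.ne'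
  have hc' : (c : ℂ) ≠ 0 := by exact_mod_cast hc.ne'
  generalize deriv (fun x => (u x).1) x = d at h2
  rw [upCoeff]
  field_simp
  linear_combination I * h2 + h * c * d * I_sq

lemma IsDiracSolution.hasDerivAt_snd (hu : IsDiracSolution h m c V E u) (hh : 0 < h) (hc : 0 < c)
    (x : ℝ) : HasDerivAt (fun x => (u x).2) (I / h * loCoeff m c E V x * (u x).1) x := by
  have h1 := (hu.diff2 x).hasDerivAt
  refine h1.congr_deriv ?_
  have h2 := hu.eq1 x
  have hh' : (h : ℂ) ≠ 0 := by exact_mod_cast hh.ne'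
  have hc' : (c : ℂ) ≠ 0 := by exact_mod_cast hc.ne'
  generalize deriv (fun x => (u x).2) x = d at h2
  rw [loCoeff]
  field_simp
  linear_combination I * h2 + h * c * d * I_sq

lemma IsDiracSolution.wron_eq (hu : IsDiracSolution h m c V E u) (hv : IsDiracSolution h m c V E v)
    (hh : 0 < h) (hc : 0 < c) (x y : ℝ) : Wron (u x) (v x) = Wron (u y) (v y) := by
  have H : ∀ x, HasDerivAt (fun x => Wron (u x) (v x)) 0 x := fun x => by
    have := ((hu.hasDerivAt_fst hh hc x).mul (hv.hasDerivAt_snd hh hc x)).sub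
      ((hu.hasDerivAt_snd hh hc x).mul (hv.hasDerivAt_fst hh hc x))
    exact this.congr_deriv (by ring)
  exact is_const_of_deriv_eq_zero (fun x => (H x).differentiableAt) (fun x => (H x).deriv) x y

/-- The exponential rate of the Jost solutions is purely imaginary. -/
lemma jost_phase_eq (hc : 0 < c) (hE : m * c ^ 2 + Vm < E) (hm : 0 < m) :
    I / ((h : ℂ) * c) * ((PhiF m c (E - Vm) : ℝ) : ℂ) = I / h * (Real.sqrt (Esym m c E Vm) : ℝ) := by
  have h1 : PhiF m c (E - Vm) = c * Real.sqrt (Esym m c E Vm) := by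
    have h0 : 0 < E - Vm := by nlinarith [mul_pos hm (pow_pos hc 2)]
    rw [PhiF, Real.sign_of_pos h0, one_mul, Esym, Real.sqrt_div' _ (by positivity),
      Real.sqrt_sq hc.le, mul_div_cancel₀ _ hc.ne']
    congr 1; ring
  rw [h1]
  have hc' : (c : ℂ) ≠ 0 := by exact_mod_cast hc.ne'
  push_cast
  rw [div_mul_eq_mul_div, div_mul_eq_mul_div, mul_comm (h : ℂ) c, mul_left_comm,
    mul_div_mul_left _ _ hc']

lemma ampF_pos (hc : 0 < c) (hE : m * c ^ 2 + Vm < E) (hm : 0 < m) : 0 < AmpF m c (E - Vm) := by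
  have : 0 < m * c ^ 2 := by positivity
  exact Real.rpow_pos_of_pos (div_pos (by linarith) (by linarith)) _

lemma JostCond.fst (hu : JostCond h m c E Vm 1 1 atBot u) (hc : 0 < c)
    (hE : m * c ^ 2 + Vm < E) (hm : 0 < m) :
    Tendsto (fun x : ℝ => (u x).1 * cexp (-(I / h * (Real.sqrt (Esym m c E Vm) : ℝ) * x))) atBot
      (𝓝 ((AmpF m c (E - Vm) : ℝ) : ℂ)) := by
  have := hu.1
  simp only [Complex.ofReal_one, one_mul] at this
  rwa [jost_phase_eq hc hE hm] at this

lemma JostCond.snd (hu : JostCond h m c E Vm 1 1 atBot u) (hc : 0 < c)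
    (hE : m * c ^ 2 + Vm < E) (hm : 0 < m) :
    Tendsto (fun x : ℝ => (u x).2 * cexp (-(I / h * (Real.sqrt (Esym m c E Vm) : ℝ) * x))) atBot
      (𝓝 ((AmpF m c (E - Vm) : ℝ) : ℂ)⁻¹) := by
  have := hu.2
  simp only [Complex.ofReal_one, one_mul] at this
  rwa [jost_phase_eq hc hE hm] at this

lemma JostCond.fst_out (hu : JostCond h m c E Vm (-1) (-1) atBot u) (hc : 0 < c)
    (hE : m * c ^ 2 + Vm < E) (hm : 0 < m) :
    Tendsto (fun x : ℝ => (u x).1 * cexp (I / h * (Real.sqrt (Esym m c E Vm) : ℝ) * x)) atBot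
      (𝓝 ((AmpF m c (E - Vm) : ℝ) : ℂ)) := by
  have := hu.1
  simp only [Complex.ofReal_neg, Complex.ofReal_one, neg_div, neg_mul, neg_neg,
    one_mul] at this
  rwa [jost_phase_eq hc hE hm] at this

lemma JostCond.snd_out (hu : JostCond h m c E Vm (-1) (-1) atBot u) (hc : 0 < c)
    (hE : m * c ^ 2 + Vm < E) (hm : 0 < m) :
    Tendsto (fun x : ℝ => (u x).2 * cexp (I / h * (Real.sqrt (Esym m c E Vm) : ℝ) * x)) atBot
      (𝓝 (-((AmpF m c (E - Vm) : ℝ) : ℂ)⁻¹)) := by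
  have := hu.2
  simp only [Complex.ofReal_neg, Complex.ofReal_one, neg_div, neg_mul, neg_neg,
    one_mul] at this
  rwa [jost_phase_eq hc hE hm] at this

/-- The Wronskian of the incoming and outgoing Jost solutions. -/
lemma wron_jost (hu : IsDiracSolution h m c V E u) (hv : IsDiracSolution h m c V E v)
    (hh : 0 < h) (hc : 0 < c) (hE : m * c ^ 2 + Vm < E) (hm : 0 < m)
    (hju : JostCond h m c E Vm 1 1 atBot u) (hjv : JostCond h m c E Vm (-1) (-1) atBot v) (x : ℝ) :
    Wron (u x) (v x) = -2 := by
  have ha : ((AmpF m c (E - Vm) : ℝ) : ℂ) ≠ 0 := by exact_mod_cast (ampF_pos hc hE hm).ne'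
  have h1 := ((hju.fst hc hE hm).mul (hjv.snd_out hc hE hm)).sub
    ((hju.snd hc hE hm).mul (hjv.fst_out hc hE hm))
  have h2 : (fun y : ℝ => (u y).1 * cexp (-(I / h * (Real.sqrt (Esym m c E Vm) : ℝ) * y)) *
      ((v y).2 * cexp (I / h * (Real.sqrt (Esym m c E Vm) : ℝ) * y)) -
      (u y).2 * cexp (-(I / h * (Real.sqrt (Esym m c E Vm) : ℝ) * y)) *
      ((v y).1 * cexp (I / h * (Real.sqrt (Esym m c E Vm) : ℝ) * y))) = fun _ => Wron (u x) (v x) := by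
    funext y
    rw [hu.wron_eq hv hh hc x y, Complex.exp_neg, Wron]
    have := Complex.exp_ne_zero (I / h * (Real.sqrt (Esym m c E Vm) : ℝ) * y)
    generalize cexp (I / h * (Real.sqrt (Esym m c E Vm) : ℝ) * y) = e at this
    field_simp
  rw [h2] at h1
  rw [tendsto_nhds_unique tendsto_const_nhds h1]
  field_simp
  norm_num

/-- Charge conjugation of solutions. -/
lemma IsDiracSolution.conj (hu : IsDiracSolution h m c V E u) (hV : ∀ x : ℝ, (V x).im = 0) :
    IsDiracSolution h m c V E
      (fun x => ((starRingEnd ℂ) (u x).1, -(starRingEnd ℂ) (u x).2)) := by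
  have hVc : ∀ x : ℝ, (starRingEnd ℂ) (V x) = V x := fun x => Complex.conj_eq_iff_im.2 (hV x)
  have d1 : ∀ x, HasDerivAt (fun x => (starRingEnd ℂ) (u x).1)
      ((starRingEnd ℂ) (deriv (fun x => (u x).1) x)) x := fun x =>
    (Complex.conjCLE : ℂ →L[ℝ] ℂ).hasFDerivAt.comp_hasDerivAt x (hu.diff1 x).hasDerivAt
  have d2 : ∀ x, HasDerivAt (fun x => -(starRingEnd ℂ) (u x).2)
      (-(starRingEnd ℂ) (deriv (fun x => (u x).2) x)) x := fun x =>
    ((Complex.conjCLE : ℂ →L[ℝ] ℂ).hasFDerivAt.comp_hasDerivAt x (hu.diff2 x).hasDerivAt).neg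
  refine ⟨fun x => (d1 x).differentiableAt, fun x => (d2 x).differentiableAt, fun x => ?_,
    fun x => ?_⟩
  · have := congrArg (starRingEnd ℂ) (hu.eq1 x)
    simp only [map_add, map_mul, map_neg, Complex.conj_I, Complex.conj_ofReal, map_pow, hVc] at this
    simp only [(d2 x).deriv]
    linear_combination this
  · have := congrArg (starRingEnd ℂ) (hu.eq2 x)
    simp only [map_add, map_mul, map_neg, Complex.conj_I, Complex.conj_ofReal, map_pow, hVc] at this
    simp only [(d1 x).deriv]
    linear_combination -this

lemma JostCond.conj (hu : JostCond h m c E Vm 1 1 atBot u) :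
    JostCond h m c E Vm (-1) (-1) atBot
      (fun x => ((starRingEnd ℂ) (u x).1, -(starRingEnd ℂ) (u x).2)) := by
  have hcont := Complex.continuous_conj
  obtain ⟨h1, h2⟩ := hu
  constructor
  · have := (hcont.tendsto _).comp h1
    refine (this.congr fun x => ?_).trans (by simp)
    simp [← Complex.exp_conj]
  · have := ((hcont.tendsto _).comp h2).neg
    refine (this.congr fun x => ?_).trans (by simp)
    simp [← Complex.exp_conj]

/-- The outgoing Jost solution is the charge conjugate of the incoming one. -/
lemma jost_out_eq (hu : IsDiracSolution h m c V E u) (hv : IsDiracSolution h m c V E v)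
    (hV : ∀ x : ℝ, (V x).im = 0)
    (hh : 0 < h) (hc : 0 < c) (hE : m * c ^ 2 + Vm < E) (hm : 0 < m)
    (hju : JostCond h m c E Vm 1 1 atBot u) (hjv : JostCond h m c E Vm (-1) (-1) atBot v) (x : ℝ) :
    v x = ((starRingEnd ℂ) (u x).1, -(starRingEnd ℂ) (u x).2) := by
  have hW := wron_jost hu hv hh hc hE hm hju hjv x
  have hW' := wron_jost hu (hu.conj hV) hh hc hE hm hju hju.conj x
  have hvv : Wron (v x) ((starRingEnd ℂ) (u x).1, -(starRingEnd ℂ) (u x).2) = 0 := by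
    have h1 := ((hjv.fst_out hc hE hm).mul (hju.conj.snd_out hc hE hm)).sub
      ((hjv.snd_out hc hE hm).mul (hju.conj.fst_out hc hE hm))
    have h2 : Tendsto (fun y : ℝ => cexp (-(2 * (I / h * (Real.sqrt (Esym m c E Vm) : ℝ) * y))) *
        ((v y).1 * cexp (I / h * (Real.sqrt (Esym m c E Vm) : ℝ) * y) *
        (-(starRingEnd ℂ) (u y).2 * cexp (I / h * (Real.sqrt (Esym m c E Vm) : ℝ) * y)) -
        (v y).2 * cexp (I / h * (Real.sqrt (Esym m c E Vm) : ℝ) * y) *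
        ((starRingEnd ℂ) (u y).1 * cexp (I / h * (Real.sqrt (Esym m c E Vm) : ℝ) * y)))) atBot
        (𝓝 0) := by
      refine squeeze_zero_norm' (a := fun y : ℝ => ‖_‖) (Eventually.of_forall fun y => ?_)
        ((tendsto_zero_iff_norm_tendsto_zero.1 (h1.trans ?_)))
      · rw [norm_mul]
        have : ‖cexp (-(2 * (I / h * (Real.sqrt (Esym m c E Vm) : ℝ) * y)))‖ = 1 := by
          rw [Complex.norm_exp]
          simp [Complex.div_re]
        rw [this, one_mul]
      · rw [show ((AmpF m c (E - Vm) : ℝ) : ℂ) * -((AmpF m c (E - Vm) : ℝ) : ℂ)⁻¹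
          - -((AmpF m c (E - Vm) : ℝ) : ℂ)⁻¹ * ((AmpF m c (E - Vm) : ℝ) : ℂ) = 0 by ring]
    have h3 : ∀ y : ℝ, cexp (-(2 * (I / h * (Real.sqrt (Esym m c E Vm) : ℝ) * y))) *
        ((v y).1 * cexp (I / h * (Real.sqrt (Esym m c E Vm) : ℝ) * y) *
        (-(starRingEnd ℂ) (u y).2 * cexp (I / h * (Real.sqrt (Esym m c E Vm) : ℝ) * y)) -
        (v y).2 * cexp (I / h * (Real.sqrt (Esym m c E Vm) : ℝ) * y) *
        ((starRingEnd ℂ) (u y).1 * cexp (I / h * (Real.sqrt (Esym m c E Vm) : ℝ) * y)))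
        = Wron (v x) ((starRingEnd ℂ) (u x).1, -(starRingEnd ℂ) (u x).2) := fun y => by
      rw [hv.wron_eq (hu.conj hV) hh hc x y, Wron, two_mul, neg_add, Complex.exp_add,
        Complex.exp_neg]
      have := Complex.exp_ne_zero (I / h * (Real.sqrt (Esym m c E Vm) : ℝ) * y)
      generalize cexp (I / h * (Real.sqrt (Esym m c E Vm) : ℝ) * y) = e at this
      field_simp
    exact tendsto_nhds_unique tendsto_const_nhds (h2.congr h3)
  simp only [Wron] at hW hW' hvv
  generalize (starRingEnd ℂ) (u x).1 = a at *
  generalize -(starRingEnd ℂ) (u x).2 = b at *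
  ext
  · linear_combination ((1 : ℂ) / 2) * ((v x).1 * hW' - a * hW - (u x).1 * hvv)
  · linear_combination ((1 : ℂ) / 2) * ((v x).2 * hW' - b * hW - (u x).2 * hvv)

/-- The reflection coefficient relates the two representations of a bounded solution. -/
lemma reflection_relation (hu : IsDiracSolution h m c V E u) (hv : IsDiracSolution h m c V E v)
    (hh : 0 < h) (hc : 0 < c) (hE : m * c ^ 2 + Vm < E) (hm : 0 < m)
    (hju : JostCond h m c E Vm 1 1 atBot u) (hjv : JostCond h m c E Vm (-1) (-1) atBot v)
    {A B α β : ℂ} (heq : ∀ x, A • (u x + α • v x) = B • (v x + β • u x)) : B = α * A := by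
  have hW := wron_jost hu hv hh hc hE hm hju hjv 0
  have h0 := heq 0
  have h1 := congrArg Prod.fst h0
  have h2 := congrArg Prod.snd h0
  simp only [Prod.smul_fst, Prod.smul_snd, Prod.fst_add, Prod.snd_add, smul_eq_mul, Wron]
    at h1 h2 hW
  linear_combination ((1 : ℂ) / 2) * ((B - α * A) * hW + (u 0).1 * h2 - (u 0).2 * h1)

end Jost

section Domains

variable {m c E : ℝ} {V : ℂ → ℂ} {Vm t₁ δ Y y R C f₀ w κ : ℝ}

/-- The region to the left of the turning point. -/
def leftDomain (t₁ y R : ℝ) : Set ℂ := {z | |z.im| < y ∧ z.re < t₁ - R / 4}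

/-- The region to the right of the turning point, connected to the left one above the turning
point. -/
def rightDomain (t₁ y R τ : ℝ) : Set ℂ :=
  {z | |z.im| < y ∧ t₁ + R / 4 < z.re} ∪ {z | z ∈ Metric.ball (t₁ : ℂ) R ∧ τ / 2 < z.im}

namespace DiracGeometry

lemma up_mem_slitPlane (G : DiracGeometry m c E V Vm t₁ δ Y y R C f₀ w κ) {z : ℂ}
    (hz : |z.im| < Y) : upCoeff m c E V z ∈ slitPlane :=
  Complex.mem_slitPlane_iff.2 (Or.inl (G.hf₀.trans_le (G.up_re z hz)))

lemma abs_im_lt_of_mem_ball (G : DiracGeometry m c E V Vm t₁ δ Y y R C f₀ w κ) {z : ℂ}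
    (hz : z ∈ Metric.ball (t₁ : ℂ) R) : |z.im| < Y := by
  have h1 := Complex.abs_im_le_norm (z - t₁)
  rw [Complex.sub_im, Complex.ofReal_im, sub_zero] at h1
  rw [Metric.mem_ball, dist_eq_norm] at hz
  linarith [G.hRY]

lemma norm_momentum_le (G : DiracGeometry m c E V Vm t₁ δ Y y R C f₀ w κ) {z : ℂ}
    (hz : |z.im| < Y) : ‖momentum m c E V z‖ ≤ Real.sqrt C := by
  refine Real.le_sqrt_of_sq_le ?_
  rw [momentum, norm_branchSqrt_sq]
  exact G.norm_sq z hz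

lemma exists_wkbDomain (G : DiracGeometry m c E V Vm t₁ δ Y y R C f₀ w κ) (hc : 0 < c) {U : Set ℂ}
    {w₀ : ℝ} (hw₀ : 0 < w₀) (hU : ∀ z ∈ U, |z.im| < Y) (hW : ∀ z ∈ U, w₀ ≤ ‖sqMomentum m c E V z‖)
    (hs : ∀ z ∈ U, I * sqMomentum m c E V z ∈ slitPlane) :
    ∃ C', WkbDomain m c E V δ U C' := by
  set a := 1 / (2 * Real.sqrt w₀)
  set b := |m| * C / (2 * w₀)
  refine ⟨max 1 (max a (max (Real.sqrt C) b)), G.one_lt, hc, fun z hz => G.analytic z (hU z hz), hs,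
    fun z hz => G.up_mem_slitPlane (hU z hz), le_max_left _ _, fun z hz => ?_, fun z hz => ?_,
    fun z hz => ?_⟩
  · refine le_trans ?_ ((le_max_left a _).trans (le_max_right _ _))
    have : Real.sqrt w₀ ≤ ‖momentum m c E V z‖ := by
      refine Real.sqrt_le_iff.2 ⟨norm_nonneg _, ?_⟩
      rw [momentum, norm_branchSqrt_sq]
      exact hW z hz
    rw [norm_div, norm_mul, Complex.norm_I, Complex.norm_ofNat]
    have h0 := Real.sqrt_pos.2 hw₀
    exact div_le_div_of_nonneg_left zero_le_one (by positivity) (by linarith)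
  · exact (G.norm_momentum_le (hU z hz)).trans
      ((le_max_left _ b).trans ((le_max_right a _).trans (le_max_right _ _)))
  · refine le_trans ?_ (mul_le_mul_of_nonneg_right
      ((le_max_right (Real.sqrt C) b).trans ((le_max_right a _).trans (le_max_right 1 _)))
      (japaneseWeight_pos _ _).le)
    rw [coupling, norm_div, norm_mul, norm_mul, Complex.norm_real, Real.norm_eq_abs,
      Complex.norm_ofNat]
    have h1 := G.norm_deriv z (hU z hz)
    have h2 := hW z hz
    have h3 := japaneseWeight_pos δ z.re
    calc |m| * ‖deriv V z‖ / (2 * ‖sqMomentum m c E V z‖)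
        ≤ |m| * (C * japaneseWeight δ z.re) / (2 * w₀) := by
          have := G.hC
          gcongr
      _ = _ := by simp only [b]; ring

lemma exists_leftDomain (G : DiracGeometry m c E V Vm t₁ δ Y y R C f₀ w κ) (hc : 0 < c) :
    ∃ C', WkbDomain m c E V δ (leftDomain t₁ y R) C' :=
  G.exists_wkbDomain hc G.hw (fun _ hz => hz.1.trans_le G.hyY)
    (fun z hz => (G.left z hz.1 hz.2).trans ((le_abs_self _).trans (Complex.abs_re_le_norm _)))
    fun z hz => I_mul_mem_slitPlane (Or.inr (G.hw.trans_le (G.left z hz.1 hz.2)).ne')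

lemma exists_rightDomain (G : DiracGeometry m c E V Vm t₁ δ Y y R C f₀ w κ) (hc : 0 < c) {τ : ℝ}
    (hτ : 0 < τ) : ∃ C', WkbDomain m c E V δ (rightDomain t₁ y R τ) C' := by
  have h1 : ∀ z ∈ Metric.ball (t₁ : ℂ) R, τ / 2 < z.im →
      κ * (τ / 2) ≤ -(sqMomentum m c E V z).im := fun z hz h => by
    have := G.ball z hz (by linarith)
    nlinarith [G.hκ]
  refine G.exists_wkbDomain hc (w₀ := min w (κ * (τ / 2))) (lt_min G.hw
    (mul_pos G.hκ (by linarith))) ?_ ?_ ?_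
  · rintro z (hz | hz)
    · exact hz.1.trans_le G.hyY
    · exact G.abs_im_lt_of_mem_ball hz.1
  · rintro z (hz | hz)
    · refine (min_le_left _ _).trans ?_
      have := G.right z hz.1 hz.2
      exact (le_neg_of_le_neg this).trans ((neg_le_abs _).trans (Complex.abs_re_le_norm _))
    · exact (min_le_right _ _).trans ((h1 z hz.1 hz.2).trans
        ((neg_le_abs _).trans (Complex.abs_im_le_norm _)))
  · rintro z (hz | hz)
    · exact I_mul_mem_slitPlane (Or.inr (by linarith [G.right z hz.1 hz.2, G.hw]))
    · exact I_mul_mem_slitPlane (Or.inl (by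
        have := h1 z hz.1 hz.2
        nlinarith [mul_pos G.hκ hτ]))

lemma sqMomentum_real (G : DiracGeometry m c E V Vm t₁ δ Y y R C f₀ w κ) (x : ℝ) :
    sqMomentum m c E V x = (((sqMomentum m c E V x).re : ℝ) : ℂ) := by
  rw [sqMomentum_ofReal G.real, Complex.ofReal_re]

lemma momentum_left (G : DiracGeometry m c E V Vm t₁ δ Y y R C f₀ w κ) {x : ℝ} (hx : x < t₁) :
    momentum m c E V x = (Real.sqrt (sqMomentum m c E V x).re : ℝ) := by
  rw [momentum, G.sqMomentum_real, branchSqrt_of_pos (G.left_real x hx), Complex.ofReal_re]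

lemma momentum_right (G : DiracGeometry m c E V Vm t₁ δ Y y R C f₀ w κ) {x : ℝ} (hx : t₁ < x) :
    momentum m c E V x = -I * (Real.sqrt (-(sqMomentum m c E V x).re) : ℝ) := by
  rw [momentum, G.sqMomentum_real, branchSqrt_of_neg (G.right_real x hx), Complex.ofReal_re]

lemma momentum_turning (G : DiracGeometry m c E V Vm t₁ δ Y y R C f₀ w κ) :
    momentum m c E V t₁ = 0 := by
  rw [momentum, G.zero_real, branchSqrt_zero]

lemma momentum_re_im (G : DiracGeometry m c E V Vm t₁ δ Y y R C f₀ w κ) {z : ℂ}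
    (hz : z ∈ Metric.ball (t₁ : ℂ) R) (h : 0 ≤ z.im) :
    0 ≤ (momentum m c E V z).re ∧ (momentum m c E V z).im ≤ 0 := by
  refine branchSqrt_re_im ((G.ball z hz h).trans ?_)
  nlinarith [G.hκ]

lemma continuousAt_momentum (G : DiracGeometry m c E V Vm t₁ δ Y y R C f₀ w κ) {z : ℂ}
    (hz : |z.im| < Y) (hs : I * sqMomentum m c E V z ∈ slitPlane ∨ sqMomentum m c E V z = 0) :
    ContinuousAt (momentum m c E V) z :=
  ContinuousAt.comp (f := sqMomentum m c E V) (continuousAt_branchSqrt hs)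
    (analyticOnNhd_sqMomentum G.analytic z hz).continuousAt

lemma continuousAt_momentum_ofReal (G : DiracGeometry m c E V Vm t₁ δ Y y R C f₀ w κ) (x : ℝ) :
    ContinuousAt (momentum m c E V) x := by
  refine G.continuousAt_momentum (by simpa using G.hy.trans_le G.hyY) ?_
  rcases lt_trichotomy x t₁ with h | rfl | h
  · exact Or.inl (I_mul_mem_slitPlane (Or.inr (G.left_real x h).ne'))
  · exact Or.inr G.zero_real
  · exact Or.inl (I_mul_mem_slitPlane (Or.inr (G.right_real x h).ne))

lemma continuous_momentum (G : DiracGeometry m c E V Vm t₁ δ Y y R C f₀ w κ) :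
    Continuous fun x : ℝ => momentum m c E V x := continuous_iff_continuousAt.2 fun x =>
  ContinuousAt.comp (f := fun x : ℝ => (x : ℂ)) (G.continuousAt_momentum_ofReal x)
    Complex.continuous_ofReal.continuousAt

lemma ball_slit (G : DiracGeometry m c E V Vm t₁ δ Y y R C f₀ w κ) {z : ℂ}
    (hz : z ∈ Metric.ball (t₁ : ℂ) R) (h : 0 < z.im) : I * sqMomentum m c E V z ∈ slitPlane :=
  I_mul_mem_slitPlane (Or.inl ((G.ball z hz h.le).trans_lt (by nlinarith [G.hκ])))

/-- The action along a path passing above the turning point. -/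
lemma integral_path (G : DiracGeometry m c E V Vm t₁ δ Y y R C f₀ w κ) {x₀ x₁ τ : ℝ} (hτ : 0 ≤ τ)
    (h₀ : t₁ - R / 2 ≤ x₀) (h₁ : x₁ ≤ t₁ + R / 2) (h01 : x₀ ≤ x₁) (hτR : τ ≤ R / 8) :
    (∫ s in (0 : ℝ)..τ, momentum m c E V (x₀ + s * I) * I)
      + (∫ s in x₀..x₁, momentum m c E V (τ * I + s * 1) * 1)
      + (∫ s in (-τ)..0, momentum m c E V (x₁ + s * -I) * -I)
      = ∫ s in x₀..x₁, momentum m c E V s := by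
  have hR := G.hR
  have hball : ∀ z : ℂ, x₀ ≤ z.re → z.re ≤ x₁ → 0 ≤ z.im → z.im ≤ τ →
      z ∈ Metric.ball (t₁ : ℂ) R := fun z h1 h2 h3 h4 => by
    rw [Metric.mem_ball, dist_eq_norm]
    refine (Complex.norm_le_abs_re_add_abs_im _).trans_lt ?_
    rw [Complex.sub_re, Complex.sub_im, Complex.ofReal_re, Complex.ofReal_im, sub_zero,
      abs_of_nonneg h3]
    have : |z.re - t₁| ≤ R / 2 := abs_le.2 ⟨by linarith, by linarith⟩
    linarith
  have key := Complex.integral_boundary_rect_eq_zero_of_continuousOn_of_differentiableOn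
    (momentum m c E V) (x₀ : ℂ) (x₁ + τ * I) ?_ ?_
  · simp only [Complex.ofReal_re, Complex.ofReal_im, Complex.add_re, Complex.add_im, Complex.mul_re,
      Complex.mul_im, Complex.I_re, Complex.I_im, mul_zero, mul_one, zero_mul, sub_zero, add_zero,
      zero_add, Complex.ofReal_zero, smul_eq_mul] at key
    have e3 : (∫ s in (-τ)..0, momentum m c E V (x₁ + s * -I) * -I)
        = -(I * ∫ s in (0 : ℝ)..τ, momentum m c E V (x₁ + s * I)) := by
      have := intervalIntegral.integral_comp_neg (a := 0) (b := τ)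
        (fun s : ℝ => momentum m c E V (x₁ + s * -I) * -I)
      rw [neg_zero] at this
      rw [← this, ← intervalIntegral.integral_const_mul, ← intervalIntegral.integral_neg]
      refine intervalIntegral.integral_congr fun s _ => ?_
      simp only [Complex.ofReal_neg, neg_mul_neg]
      ring
    have e2 : (∫ s in x₀..x₁, momentum m c E V (τ * I + s * 1) * 1)
        = ∫ s in x₀..x₁, momentum m c E V (s + τ * I) := by
      refine intervalIntegral.integral_congr fun s _ => ?_
      simp only [mul_one, add_comm]
    rw [e2, e3, intervalIntegral.integral_mul_const]
    linear_combination -key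
  · intro z hz
    rw [Complex.mem_reProdIm] at hz
    simp only [Complex.ofReal_re, Complex.ofReal_im, Complex.add_re, Complex.add_im, Complex.mul_re,
      Complex.mul_im, Complex.I_re, Complex.I_im, mul_zero, mul_one, sub_zero, add_zero,
      zero_add, uIcc_of_le h01, uIcc_of_le hτ] at hz
    obtain ⟨⟨a1, a2⟩, a3, a4⟩ := hz
    have hb := hball z a1 a2 a3 a4
    rcases a3.eq_or_lt with h | h
    · have : z = (z.re : ℂ) := Complex.ext (by simp) (by simp [← h])
      rw [this]
      exact (G.continuousAt_momentum_ofReal _).continuousWithinAt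
    · exact (G.continuousAt_momentum (G.abs_im_lt_of_mem_ball hb)
        (Or.inl (G.ball_slit hb h))).continuousWithinAt
  · intro z hz
    rw [Complex.mem_reProdIm] at hz
    simp only [Complex.ofReal_re, Complex.ofReal_im, Complex.add_re, Complex.add_im, Complex.mul_re,
      Complex.mul_im, Complex.I_re, Complex.I_im, mul_zero, mul_one, sub_zero, add_zero,
      zero_add, min_eq_left h01, max_eq_right h01, min_eq_left hτ, max_eq_right hτ] at hz
    obtain ⟨⟨a1, a2⟩, a3, a4⟩ := hz
    have hb := hball z a1.le a2.le a3.le a4.le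
    exact (analyticAt_branchSqrt_comp (analyticOnNhd_sqMomentum G.analytic z
      (G.abs_im_lt_of_mem_ball hb)) (G.ball_slit hb a3)).differentiableAt.differentiableWithinAt

end DiracGeometry

end Domains

section LeftState

variable {m c E : ℝ} {V : ℂ → ℂ} {Vm t₁ δ Y y R C f₀ w κ : ℝ}
variable {U : Set ℂ} {C' r ρ B : ℝ}

/-- The integrand of the correction to the WKB phase along the path `s ↦ z₀ + s e`. -/
noncomputable def phaseDensity (m c E : ℝ) (V : ℂ → ℂ) (z₀ e : ℂ) (n : ℕ) (h : ℂ) (s : ℝ) : ℂ :=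
  coupling m c E V (z₀ + s * e) * e * diracRiccati m c E V n (z₀ + s * e, h)

lemma WkbDomain.analytic_riccati (D : WkbDomain m c E V δ U C') (n : ℕ) :
    AnalyticOnNhd ℂ (diracRiccati m c E V n) (U ×ˢ univ) :=
  riccatiIter_analytic D.analytic_w D.analytic_ν n

lemma WkbDomain.norm_phaseDensity_le (D : WkbDomain m c E V δ U C')
    (H : RiccatiBounds m c E V δ U r ρ B) {z₀ e : ℂ} (he : ‖e‖ ≤ 1) {s : ℝ}
    (hs : Metric.closedBall (z₀ + s * e) r ⊆ U) {N : ℕ} (hN : 1 ≤ N) {h : ℂ} (hh : ‖h‖ * N ≤ ρ)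
    {n : ℕ} (hn : n ≤ N + 1) :
    ‖phaseDensity m c E V z₀ e n h s‖ ≤ C' * B * ‖h‖ * japaneseWeight δ (z₀ + s * e).re := by
  have h1 := H.bound N hN h hh _ hs n hn
  have h2 := D.norm_ν _ (hs (Metric.mem_closedBall_self H.hr.le))
  have h3 := japaneseWeight_pos δ (z₀ + s * e).re
  have h4 := japaneseWeight_le_one D.one_lt (z₀ + s * e).re
  have hC := D.one_le
  have hB := H.one_le
  rw [phaseDensity, norm_mul, norm_mul]
  calc ‖coupling m c E V (z₀ + s * e)‖ * ‖e‖ * _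
      ≤ (C' * japaneseWeight δ (z₀ + s * e).re) * 1
        * (B * ‖h‖ * japaneseWeight δ (z₀ + s * e).re) := by gcongr
    _ ≤ (C' * 1) * 1 * (B * ‖h‖ * japaneseWeight δ (z₀ + s * e).re) := by gcongr
    _ = _ := by ring

lemma WkbDomain.continuousOn_phaseDensity (D : WkbDomain m c E V δ U C') {z₀ e : ℂ} {S : Set ℝ}
    (hS : ∀ s ∈ S, z₀ + s * e ∈ U) (n : ℕ) (h : ℂ) :
    ContinuousOn (phaseDensity m c E V z₀ e n h) S := by
  have hz : Continuous fun s : ℝ => z₀ + s * e := by fun_prop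
  have h1 := D.analytic_ν.continuousOn.comp hz.continuousOn hS
  have h2 : ContinuousOn (fun s : ℝ => diracRiccati m c E V n (z₀ + s * e, h)) S :=
    (D.analytic_riccati n).continuousOn.comp (hz.prodMk continuous_const).continuousOn
      fun s hs => ⟨hS s hs, mem_univ _⟩
  exact (h1.mul continuousOn_const).mul h2

lemma WkbDomain.integrableOn_phaseDensity (D : WkbDomain m c E V δ U C')
    (H : RiccatiBounds m c E V δ U r ρ B) {z₀ e : ℂ} (he : ‖e‖ ≤ 1) {S : Set ℝ}
    (hSm : MeasurableSet S) (hS : ∀ s ∈ S, Metric.closedBall (z₀ + s * e) r ⊆ U)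
    (hω : IntegrableOn (fun s : ℝ => japaneseWeight δ (z₀ + s * e).re) S)
    {N : ℕ} (hN : 1 ≤ N) {h : ℂ} (hh : ‖h‖ * N ≤ ρ) {n : ℕ} (hn : n ≤ N + 1) :
    IntegrableOn (phaseDensity m c E V z₀ e n h) S := by
  refine Integrable.mono' (hω.const_mul (C' * B * ‖h‖)) ?_ ?_
  · exact (D.continuousOn_phaseDensity (fun s hs => hS s hs
      (Metric.mem_closedBall_self H.hr.le)) n h).aestronglyMeasurable hSm
  · exact (ae_restrict_iff' hSm).2 (Eventually.of_forall fun s hs =>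
      D.norm_phaseDensity_le H he (hS s hs) hN hh hn)

namespace DiracGeometry

lemma qsym_eq (G : DiracGeometry m c E V Vm t₁ δ Y y R C f₀ w κ) {x : ℝ} (hx : x ≤ t₁) :
    momentum m c E V x = ((Qsym m c E Vm V x + Real.sqrt (Esym m c E Vm) : ℝ) : ℂ) := by
  rw [Qsym, sub_add_cancel]
  rcases hx.eq_or_lt with rfl | hx
  · have := G.zero_real
    rw [sqMomentum_ofReal G.real, Complex.ofReal_eq_zero] at this
    rw [G.momentum_turning, this, Real.sqrt_zero, Complex.ofReal_zero]
  · rw [G.momentum_left hx, sqMomentum_ofReal G.real, Complex.ofReal_re]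

lemma continuous_re_V (G : DiracGeometry m c E V Vm t₁ δ Y y R C f₀ w κ) :
    Continuous fun x : ℝ => (V x).re :=
  Complex.continuous_re.comp (continuous_iff_continuousAt.2 fun x =>
    ContinuousAt.comp (f := fun x : ℝ => (x : ℂ)) (G.analytic x (by
      simpa using G.hy.trans_le G.hyY)).continuousAt Complex.continuous_ofReal.continuousAt)

lemma continuous_qsym (G : DiracGeometry m c E V Vm t₁ δ Y y R C f₀ w κ) :
    Continuous (Qsym m c E Vm V) := by
  have := G.continuous_re_V
  unfold Qsym
  fun_prop

lemma esym_pos (hm : 0 < m) (hc : 0 < c) (hE : m * c ^ 2 + Vm < E) : 0 < Esym m c E Vm := by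
  have : 0 < m * c ^ 2 := by positivity
  refine div_pos ?_ (by positivity)
  nlinarith

lemma integrableOn_qsym (G : DiracGeometry m c E V Vm t₁ δ Y y R C f₀ w κ)
    (hm : 0 < m) (hc : 0 < c) (hE : m * c ^ 2 + Vm < E) (b : ℝ) :
    IntegrableOn (Qsym m c E Vm V) (Iic b) := by
  have hEs := Real.sqrt_pos.2 (esym_pos hm hc hE)
  have h0 : IntegrableOn (Qsym m c E Vm V) (Iic (min b (min 0 (t₁ - 1)))) := by
    set k := (C * (C + 2 * |Vm - E|) / c ^ 2) / Real.sqrt (Esym m c E Vm) with hk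
    refine Integrable.mono' (g := fun x => k * japaneseWeight δ x)
      ((integrable_japaneseWeight G.one_lt).const_mul k).integrableOn
      G.continuous_qsym.aestronglyMeasurable
      ((ae_restrict_iff' measurableSet_Iic).2 (Eventually.of_forall fun x hx => ?_))
    have hxt : x < t₁ := by
      have := (mem_Iic.1 hx).trans ((min_le_right _ _).trans (min_le_right _ _))
      linarith
    have hpos := G.left_real x hxt
    rw [sqMomentum_ofReal G.real, Complex.ofReal_re] at hpos
    have hx0 : x ≤ 0 := (mem_Iic.1 hx).trans ((min_le_right _ _).trans (min_le_left _ _))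
    have ht := G.tail x hx0
    have hw1 := japaneseWeight_le_one G.one_lt x
    have hw0 := japaneseWeight_pos δ x
    have hv : |(V x).re - Vm| ≤ C * japaneseWeight δ x := by
      refine le_trans ?_ ht
      have := Complex.abs_re_le_norm (V x - Vm)
      simpa using this
    rw [Qsym]
    set A := (-(m ^ 2 * c ^ 4) + ((V x).re - E) ^ 2) / c ^ 2
    have hsq : Real.sqrt A - Real.sqrt (Esym m c E Vm)
        = (A - Esym m c E Vm) / (Real.sqrt A + Real.sqrt (Esym m c E Vm)) := by
      rw [eq_div_iff (by positivity)]
      nlinarith [Real.sq_sqrt hpos.le, Real.sq_sqrt (esym_pos hm hc hE).le]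
    have hd : |A - Esym m c E Vm| ≤ C * (C + 2 * |Vm - E|) / c ^ 2 * japaneseWeight δ x := by
      have : A - Esym m c E Vm
          = ((V x).re - Vm) * (((V x).re - Vm) + 2 * (Vm - E)) / c ^ 2 := by
        simp only [A, Esym]; ring
      rw [this, abs_div, abs_mul, abs_of_nonneg (sq_nonneg c)]
      have h2 : |(V x).re - Vm + 2 * (Vm - E)| ≤ C + 2 * |Vm - E| := by
        refine (abs_add_le _ _).trans ?_
        rw [abs_mul, abs_two]
        have := G.hC
        nlinarith
      calc _ ≤ (C * japaneseWeight δ x) * (C + 2 * |Vm - E|) / c ^ 2 := by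
            gcongr
            exact (abs_nonneg _).trans hv
        _ = _ := by ring
    rw [hsq, norm_div, Real.norm_eq_abs, Real.norm_of_nonneg (by positivity)]
    calc _ ≤ C * (C + 2 * |Vm - E|) / c ^ 2 * japaneseWeight δ x / Real.sqrt (Esym m c E Vm) := by
          gcongr
          · exact (abs_nonneg _).trans hd
          · linarith [Real.sqrt_nonneg A]
      _ = _ := by rw [hk]; ring
  have h1 : IntegrableOn (Qsym m c E Vm V) (Icc (min b (min 0 (t₁ - 1))) b) :=
    G.continuous_qsym.continuousOn.integrableOn_Icc
  refine (h0.union h1).mono_set fun x hx => ?_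
  rcases le_total x (min b (min 0 (t₁ - 1))) with h | h
  exacts [Or.inl h, Or.inr ⟨h, hx⟩]

lemma tendsto_re_V (G : DiracGeometry m c E V Vm t₁ δ Y y R C f₀ w κ) :
    Tendsto (fun x : ℝ => (V x).re) atBot (𝓝 Vm) := by
  rw [tendsto_iff_norm_sub_tendsto_zero]
  have h1 := (tendsto_japaneseWeight_atBot G.one_lt).const_mul C
  rw [mul_zero] at h1
  refine squeeze_zero' (Eventually.of_forall fun x => norm_nonneg _) ?_ h1
  filter_upwards [eventually_le_atBot 0] with x hx
  refine le_trans ?_ (G.tail x hx)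
  have := Complex.abs_re_le_norm (V x - Vm)
  simpa using this

lemma tendsto_amplitude (G : DiracGeometry m c E V Vm t₁ δ Y y R C f₀ w κ)
    (hm : 0 < m) (hc : 0 < c) (hE : m * c ^ 2 + Vm < E) :
    Tendsto (fun x : ℝ => amplitude m c E V x) atBot (𝓝 ((AmpF m c (E - Vm) : ℝ) : ℂ)) := by
  have hmc : 0 < m * c ^ 2 := by positivity
  have hf : 0 < (E - Vm + m * c ^ 2) / c := div_pos (by linarith) hc
  have hEs := esym_pos hm hc hE
  have h1 : Tendsto (fun x : ℝ => (upCoeff m c E V x).re) atBot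
      (𝓝 ((E - Vm + m * c ^ 2) / c)) := by
    have := ((G.tendsto_re_V.const_sub E).add_const (m * c ^ 2)).div_const c
    refine this.congr fun x => ?_
    rw [upCoeff_ofReal G.real, Complex.ofReal_re]
  have h2 : Tendsto (fun x : ℝ => (sqMomentum m c E V x).re) atBot (𝓝 (Esym m c E Vm)) := by
    have := (((G.tendsto_re_V.sub_const E).pow 2).const_add (-(m ^ 2 * c ^ 4))).div_const (c ^ 2)
    refine this.congr fun x => ?_
    rw [sqMomentum_ofReal G.real, Complex.ofReal_re]
  have h3 := (((h1.log hf.ne').const_mul 2⁻¹).sub ((h2.log hEs.ne').const_mul 4⁻¹)).rexp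
  have h4 : Real.exp (2⁻¹ * Real.log ((E - Vm + m * c ^ 2) / c)
      - 4⁻¹ * Real.log (Esym m c E Vm)) = AmpF m c (E - Vm) := by
    have e1 : Esym m c E Vm
        = ((E - Vm + m * c ^ 2) / c) * ((E - Vm - m * c ^ 2) / c) := by
      rw [Esym]; field_simp; ring
    have hg : 0 < (E - Vm - m * c ^ 2) / c := div_pos (by linarith) hc
    have e2 : (E - Vm + m * c ^ 2) / (E - Vm - m * c ^ 2)
        = ((E - Vm + m * c ^ 2) / c) / ((E - Vm - m * c ^ 2) / c) := by
      rw [div_div_div_cancel_right₀ hc.ne']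
    rw [AmpF, e2, Real.rpow_def_of_pos (div_pos hf hg), Real.log_div hf.ne' hg.ne', e1,
      Real.log_mul hf.ne' hg.ne']
    congr 1; ring
  rw [h4] at h3
  refine ((Complex.continuous_ofReal.tendsto _).comp h3).congr' ?_
  filter_upwards [eventually_lt_atBot t₁] with x hx
  rw [Function.comp_apply, amplitude_ofReal_left G.real
    (G.hf₀.trans_le (G.up_re x (by simpa using G.hy.trans_le G.hyY))) (G.left_real x hx)]

/-- The incoming Jost solution is a WKB solution to the left of the turning point. -/
lemma left_state (G : DiracGeometry m c E V Vm t₁ δ Y y R C f₀ w κ)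
    (hm : 0 < m) (hc : 0 < c) (hE : m * c ^ 2 + Vm < E)
    (D : WkbDomain m c E V δ (leftDomain t₁ y R) C')
    (H : RiccatiBounds m c E V δ (leftDomain t₁ y R) r ρ B) (hry : r < y) (hrR : r < R / 4) :
    ∃ X₁ : ℝ, 0 ≤ X₁ ∧ ∀ h : ℝ, 0 < h → ∀ N : ℕ, 1 ≤ N → h * N ≤ ρ → ∀ u : ℝ → ℂ × ℂ,
      IsDiracSolution h m c V E u → JostCond h m c E Vm 1 1 atBot u →
      WkbState (amplitude m c E V ((t₁ - R / 2 : ℝ) : ℂ)) (u (t₁ - R / 2)).1 (u (t₁ - R / 2)).2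
        (diracRiccati m c E V N (((t₁ - R / 2 : ℝ) : ℂ), h))
        (I / h * (((∫ x in Iic (t₁ - R / 2), Qsym m c E Vm V x)
          + Real.sqrt (Esym m c E Vm) * (t₁ - R / 2) : ℝ) : ℂ)
          - ∫ x in Iic (t₁ - R / 2), phaseDensity m c E V 0 1 N h x) ((1 / 2) ^ N) X₁ := by
  set x₀ := t₁ - R / 2 with hx₀
  have hR := G.hR
  have hB0 : 0 ≤ B := zero_le_one.trans H.one_le
  have hC0 : 0 ≤ C' := zero_le_one.trans D.one_le
  have hball : ∀ x : ℝ, x ≤ x₀ → Metric.closedBall ((x : ℝ) : ℂ) r ⊆ leftDomain t₁ y R :=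
    fun x hx z hz => by
      rw [Metric.mem_closedBall, dist_eq_norm] at hz
      have h1 := (Complex.abs_im_le_norm (z - x)).trans hz
      have h2 := (Complex.abs_re_le_norm (z - x)).trans hz
      rw [Complex.sub_im, Complex.ofReal_im, sub_zero] at h1
      rw [Complex.sub_re, Complex.ofReal_re, abs_le] at h2
      exact ⟨by linarith, by linarith [h2.2]⟩
  set K := ∫ x, 2 * C' * B * japaneseWeight δ x with hK
  have hKi : Integrable fun x => 2 * C' * B * japaneseWeight δ x :=
    (integrable_japaneseWeight G.one_lt).const_mul _
  have hK0 : 0 ≤ K := integral_nonneg fun x => mul_nonneg (by positivity) (japaneseWeight_pos _ _).le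
  refine ⟨1 + (K + 1) * (2 * Real.exp (3 * K + 2 * 0 * 0)) * (1 + 1), by positivity,
    fun h hh N hN hhN u hu hj => ?_⟩
  have hnh : ‖(h : ℂ)‖ * N ≤ ρ := by rwa [Complex.norm_real, Real.norm_of_nonneg hh.le]
  have hε : (0 : ℝ) < (1 / 2) ^ N := by positivity
  set θ : ℂ := I / h * (Real.sqrt (Esym m c E Vm) : ℝ) with hθ
  have ha : ((AmpF m c (E - Vm) : ℝ) : ℂ) ≠ 0 := by exact_mod_cast (ampF_pos hc hE hm).ne'
  have hAmp := G.tendsto_amplitude hm hc hE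
  have hu1 := hj.fst hc hE hm
  have hu2 := hj.snd hc hE hm
  have hQ : Tendsto (fun x : ℝ => diracRiccati m c E V N (x, h)) atBot (𝓝 0) := by
    have h1 := (tendsto_japaneseWeight_atBot G.one_lt).const_mul (B * ‖(h : ℂ)‖)
    rw [mul_zero] at h1
    refine squeeze_zero_norm' ?_ h1
    filter_upwards [eventually_le_atBot x₀] with x hx
    exact H.bound N hN h hnh x (hball x hx) N (by omega)
  have hplus := (((hu1.div hAmp ha).add (hAmp.mul hu2)).div_const 2)
  have hminus := (((hu1.div hAmp ha).sub (hAmp.mul hu2)).div_const 2)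
  rw [div_self ha, mul_inv_cancel₀ ha] at hplus hminus
  norm_num at hplus hminus
  have hfirst : ∀ᶠ x : ℝ in atBot, WkbState (amplitude m c E V x) (u x).1 (u x).2
      (diracRiccati m c E V N (x, h)) (θ * x) ((1 / 2) ^ N) 1 := by
    have h2 := hminus.sub (hQ.mul hplus)
    rw [zero_mul, sub_zero] at h2
    have h1 := (hplus.sub_const 1).norm
    rw [sub_self, norm_zero] at h1
    have h2 := h2.norm
    rw [norm_zero] at h2
    filter_upwards [h1.eventually_le_const hε, h2.eventually_le_const hε] with x hx1 hx2
    rw [WkbState, mul_one]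
    constructor
    · refine le_trans (le_of_eq ?_) hx1
      congr 1; ring
    · refine le_trans (le_of_eq ?_) hx2
      congr 1; ring
  have hup : ∀ᶠ X : ℝ in atBot, WkbState (amplitude m c E V x₀) (u x₀).1 (u x₀).2
      (diracRiccati m c E V N (x₀, h))
      (I / h * (((∫ x in X..x₀, Qsym m c E Vm V x)
          + Real.sqrt (Esym m c E Vm) * x₀ : ℝ) : ℂ)
          - ∫ x in X..x₀, phaseDensity m c E V 0 1 N h x) ((1 / 2) ^ N)
      (1 + (K + 1) * (2 * Real.exp (3 * K + 2 * 0 * 0)) * (1 + 1)) := by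
    filter_upwards [hfirst, eventually_le_atBot x₀] with X hX hXx
    have hp := D.propagate H (z₀ := 0) (e := 1) (s₀ := X) (s₁ := x₀) (by simp) hXx
      (fun s hs => by simpa using hball s hs.2) hh hN hhN
      (y₁ := fun x => (u x).1) (y₂ := fun x => (u x).2)
      (fun s _ => by simpa using hu.hasDerivAt_fst hh hc s)
      (fun s _ => by simpa using hu.hasDerivAt_snd hh hc s) (K := K) (μ := 0) (X := 1)
      (by
        simp only [zero_add, mul_one, Complex.ofReal_re]
        rw [intervalIntegral.integral_of_le hXx]
        exact setIntegral_le_integral hKi (Eventually.of_forall fun x =>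
          mul_nonneg (by positivity) (japaneseWeight_pos _ _).le)) le_rfl
      (fun s hs => by
        have hst : s < t₁ := by linarith [hs.2]
        simp only [zero_add, mul_one, G.momentum_left hst, neg_zero]
        simp [Complex.div_re]) zero_le_one (d := θ * X) (by simpa using hX)
    simp only [zero_add, mul_one, mul_zero, zero_mul, add_zero] at hp ⊢
    convert hp using 1
    have i1 : IntervalIntegrable (fun x : ℝ => I / h * momentum m c E V x) volume X x₀ :=
      (continuous_const.mul G.continuous_momentum).intervalIntegrable _ _
    have i2 : IntervalIntegrable (phaseDensity m c E V 0 1 N h) volume X x₀ := by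
      refine ContinuousOn.intervalIntegrable (D.continuousOn_phaseDensity (fun s hs => ?_) N h)
      rw [uIcc_of_le hXx] at hs
      simpa using hball s hs.2 (Metric.mem_closedBall_self H.hr.le)
    have e1 : ∫ s in X..x₀, (I / h * momentum m c E V s
        - coupling m c E V s * diracRiccati m c E V N (s, h))
        = (∫ s in X..x₀, I / h * momentum m c E V s)
          - ∫ s in X..x₀, phaseDensity m c E V 0 1 N h s := by
      rw [← intervalIntegral.integral_sub i1 i2]
      simp [phaseDensity]
    have e2 : ∫ s in X..x₀, I / h * momentum m c E V s = I / h *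
        (((∫ x in X..x₀, Qsym m c E Vm V x) + Real.sqrt (Esym m c E Vm) * (x₀ - X) : ℝ) : ℂ) := by
      rw [intervalIntegral.integral_const_mul]
      congr 1
      have e3 : ∫ s in X..x₀, momentum m c E V s
          = ∫ s in X..x₀, ((Qsym m c E Vm V s + Real.sqrt (Esym m c E Vm) : ℝ) : ℂ) := by
        refine intervalIntegral.integral_congr fun s hs => G.qsym_eq ?_
        rw [uIcc_of_le hXx] at hs
        linarith [hs.2]
      rw [e3, intervalIntegral.integral_ofReal, intervalIntegral.integral_add
        (G.continuous_qsym.intervalIntegrable _ _) intervalIntegrable_const,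
        intervalIntegral.integral_const, smul_eq_mul, mul_comm (x₀ - X)]
    rw [e1, e2, hθ]
    push_cast
    ring
  have hlim : Tendsto (fun X : ℝ => I / h * (((∫ x in X..x₀, Qsym m c E Vm V x)
          + Real.sqrt (Esym m c E Vm) * x₀ : ℝ) : ℂ)
          - ∫ x in X..x₀, phaseDensity m c E V 0 1 N h x) atBot
      (𝓝 (I / h * (((∫ x in Iic x₀, Qsym m c E Vm V x)
          + Real.sqrt (Esym m c E Vm) * x₀ : ℝ) : ℂ)
          - ∫ x in Iic x₀, phaseDensity m c E V 0 1 N h x)) := by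
    have l1 := intervalIntegral_tendsto_integral_Iic x₀ (G.integrableOn_qsym hm hc hE x₀)
      (tendsto_id (α := ℝ) (x := atBot))
    have l2 := intervalIntegral_tendsto_integral_Iic x₀ (D.integrableOn_phaseDensity H
      (z₀ := 0) (e := 1) (by simp) measurableSet_Iic
      (fun s hs => by simpa using hball s hs)
      (by simpa using (integrable_japaneseWeight G.one_lt).integrableOn) hN hnh
      (n := N) (by omega)) (tendsto_id (α := ℝ) (x := atBot))
    exact (((Complex.continuous_ofReal.tendsto _).comp (l1.add_const _)).const_mul _).sub l2
  have hclosed : IsClosed {d : ℂ | WkbState (amplitude m c E V x₀) (u x₀).1 (u x₀).2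
      (diracRiccati m c E V N (x₀, h)) d ((1 / 2) ^ N)
      (1 + (K + 1) * (2 * Real.exp (3 * K + 2 * 0 * 0)) * (1 + 1))} := by
    simp only [WkbState, ofPred_and]
    refine IsClosed.inter (isClosed_le ?_ continuous_const) (isClosed_le ?_ continuous_const) <;>
      fun_prop
  have := hclosed.mem_of_tendsto hlim hup
  rw [mem_ofPred_eq] at this
  rw [hx₀]
  simpa [hx₀] using this

end DiracGeometry

end LeftState

section PathState

variable {m c E : ℝ} {V : ℂ → ℂ} {Vm t₁ δ Y y R C f₀ w κ : ℝ}

lemma WkbState.of_le {A y₁ y₂ Q Q' d : ℂ} {ε X ε' X' : ℝ} (H : WkbState A y₁ y₂ Q d ε X)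
    (h : ε * X ≤ ε' * X') (hε : 0 ≤ ε') (hε1 : ε' ≤ 1) (hX' : 0 ≤ X') (hQ : ‖Q' - Q‖ ≤ ε') :
    WkbState A y₁ y₂ Q' d ε' (2 * X' + 1) := by
  obtain ⟨h1, h2⟩ := H
  have h3 : ε' * X' ≤ X' := mul_le_of_le_one_left hX' hε1
  have h4 : ‖(y₁ / A + A * y₂) / 2 * cexp (-d)‖ ≤ 1 + X' := by
    have := norm_le_norm_add_norm_sub' ((y₁ / A + A * y₂) / 2 * cexp (-d)) 1
    rw [norm_one] at this
    linarith
  refine ⟨h1.trans (h.trans (mul_le_mul_of_nonneg_left (by linarith) hε)), ?_⟩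
  have e : ((y₁ / A - A * y₂) / 2 - Q' * ((y₁ / A + A * y₂) / 2)) * cexp (-d)
      = ((y₁ / A - A * y₂) / 2 - Q * ((y₁ / A + A * y₂) / 2)) * cexp (-d)
        - (Q' - Q) * ((y₁ / A + A * y₂) / 2 * cexp (-d)) := by ring
  rw [e]
  refine (norm_sub_le _ _).trans ?_
  rw [norm_mul (Q' - Q)]
  have := mul_le_mul hQ h4 (norm_nonneg _) hε
  nlinarith

lemma RiccatiBounds.norm_sub_le {U : Set ℂ} {r ρ B : ℝ} (H : RiccatiBounds m c E V δ U r ρ B)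
    (hδ : 1 < δ) {z : ℂ} (hz : Metric.closedBall z r ⊆ U) {N : ℕ} (hN : 1 ≤ N) {h : ℂ}
    (hh : ‖h‖ * N ≤ ρ) {a b : ℕ} (hab : a ≤ b) (hb : b ≤ N) :
    ‖diracRiccati m c E V b (z, h) - diracRiccati m c E V a (z, h)‖ ≤ (1 / 2) ^ a := by
  have hB : B * ‖h‖ ≤ 1 / 2 := by
    have : (1 : ℝ) ≤ N := by exact_mod_cast hN
    have h1 : ‖h‖ ≤ ρ := by nlinarith [norm_nonneg h]
    nlinarith [H.mul_le, H.one_le]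
  have hω := japaneseWeight_le_one hδ z.re
  have hω0 := japaneseWeight_pos δ z.re
  have hB0 : 0 ≤ B * ‖h‖ := mul_nonneg (zero_le_one.trans H.one_le) (norm_nonneg h)
  have hρ := H.hρ
  suffices ∀ k, a + k ≤ N → ‖diracRiccati m c E V (a + k) (z, h) - diracRiccati m c E V a (z, h)‖
      ≤ (1 / 2) ^ a - (1 / 2) ^ (a + k) by
    obtain ⟨k, rfl⟩ := Nat.exists_eq_add_of_le hab
    exact (this k hb).trans (by linarith [show (0 : ℝ) < (1 / 2) ^ (a + k) by positivity])
  intro k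
  induction k with
  | zero => simp
  | succ k ih =>
    intro hk
    have h1 := ih (by omega)
    have h2 := H.diff N hN h hh z hz (a + k) (by omega)
    have h3 : (‖h‖ * N / (2 * ρ)) ^ (a + k) ≤ (1 / 2) ^ (a + k) := by
      apply pow_le_pow_left₀ (by positivity)
      rw [div_le_div_iff₀ (by linarith) (by norm_num)]
      linarith
    have h4 : B * ‖h‖ * japaneseWeight δ z.re * (‖h‖ * N / (2 * ρ)) ^ (a + k)
        ≤ 1 / 2 * 1 * (1 / 2) ^ (a + k) := by gcongr
    rw [← add_assoc, ← sub_add_sub_cancel _ (diracRiccati m c E V (a + k) (z, h)), pow_succ]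
    refine (norm_add_le _ _).trans ?_
    linarith

/-- The correction to the WKB phase along a path from `-∞` to `t₁ + R/2` above the turning
point. -/
noncomputable def pathPhase (m c E : ℝ) (V : ℂ → ℂ) (t₁ R τ : ℝ) (a b : ℕ) (h : ℂ) : ℂ :=
  (∫ s in Iic (t₁ - R / 2), phaseDensity m c E V 0 1 a h s)
  + (∫ s in Ioc 0 τ, phaseDensity m c E V ((t₁ - R / 2 : ℝ) : ℂ) I a h s)
  + (∫ s in Ioc (t₁ - R / 2) (t₁ + R / 2), phaseDensity m c E V (τ * I) 1 b h s)
  + ∫ s in Ioc (-τ) 0, phaseDensity m c E V ((t₁ + R / 2 : ℝ) : ℂ) (-I) b h s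

lemma closedBall_subset_leftDomain {x s r : ℝ} (hr : r < R / 4) (hx : x ≤ t₁ - R / 2)
    (hs : |s| + r < y) : Metric.closedBall (x + s * I : ℂ) r ⊆ leftDomain t₁ y R := by
  intro z hz
  rw [Metric.mem_closedBall, dist_eq_norm] at hz
  have h1 := (Complex.abs_im_le_norm (z - (x + s * I))).trans hz
  have h2 := (Complex.abs_re_le_norm (z - (x + s * I))).trans hz
  simp only [Complex.sub_im, Complex.sub_re, Complex.add_im, Complex.add_re, Complex.mul_re,
    Complex.mul_im, Complex.ofReal_re, Complex.ofReal_im, Complex.I_re, Complex.I_im, mul_zero,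
    mul_one, sub_zero, add_zero, zero_add] at h1 h2
  have h3 := abs_sub_abs_le_abs_sub z.im s
  exact ⟨by linarith, by linarith [(abs_le.1 h2).2]⟩

lemma closedBall_subset_rightDomain {x s r τ : ℝ} (hr : r < R / 4) (hx : t₁ + R / 2 ≤ x)
    (hs : |s| + r < y) : Metric.closedBall (x + s * I : ℂ) r ⊆ rightDomain t₁ y R τ := by
  intro z hz
  rw [Metric.mem_closedBall, dist_eq_norm] at hz
  have h1 := (Complex.abs_im_le_norm (z - (x + s * I))).trans hz
  have h2 := (Complex.abs_re_le_norm (z - (x + s * I))).trans hz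
  simp only [Complex.sub_im, Complex.sub_re, Complex.add_im, Complex.add_re, Complex.mul_re,
    Complex.mul_im, Complex.ofReal_re, Complex.ofReal_im, Complex.I_re, Complex.I_im, mul_zero,
    mul_one, sub_zero, add_zero, zero_add] at h1 h2
  have h3 := abs_sub_abs_le_abs_sub z.im s
  exact Or.inl ⟨by linarith, by linarith [(abs_le.1 h2).1]⟩

lemma add_mul_I_mem_ball {x s : ℝ} (h : |x - t₁| + |s| < R) :
    (x + s * I : ℂ) ∈ Metric.ball (t₁ : ℂ) R := by
  rw [Metric.mem_ball, dist_eq_norm]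
  refine (Complex.norm_le_abs_re_add_abs_im _).trans_lt ?_
  simpa using h

lemma closedBall_subset_rightDomain_of_above {x s r τ : ℝ} (hx : |x - t₁| ≤ R / 2) (hs : s ≤ R / 8)
    (hsr : τ / 2 + r < s) (hτ : 0 < τ) (hr0 : 0 < r) :
    Metric.closedBall (x + s * I : ℂ) r ⊆ rightDomain t₁ y R τ := by
  intro z hz
  rw [Metric.mem_closedBall, dist_eq_norm] at hz
  have h1 := (Complex.abs_im_le_norm (z - (x + s * I))).trans hz
  have hb : ((x + s * I : ℂ) - t₁) = ((x - t₁ : ℝ) : ℂ) + s * I := by push_cast; ring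
  have h2 : ‖(x + s * I : ℂ) - t₁‖ ≤ R / 2 + R / 8 := by
    rw [hb]
    refine (norm_add_le _ _).trans ?_
    rw [norm_mul, Complex.norm_I, Complex.norm_real, Complex.norm_real, Real.norm_eq_abs,
      Real.norm_eq_abs, abs_of_pos (by linarith : 0 < s)]
    linarith
  simp only [Complex.sub_im, Complex.add_im, Complex.mul_im, Complex.ofReal_re, Complex.ofReal_im,
    Complex.I_re, Complex.I_im, mul_zero, mul_one, add_zero, zero_add] at h1
  refine Or.inr ⟨?_, by linarith [(abs_le.1 h1).1]⟩
  rw [Metric.mem_ball, dist_eq_norm]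
  have := norm_add_le (z - (x + s * I)) ((x + s * I : ℂ) - t₁)
  rw [sub_add_sub_cancel] at this
  linarith

end PathState

section Segments

variable {m c E : ℝ} {V : ℂ → ℂ} {Vm t₁ δ Y y R C f₀ w κ : ℝ}
variable {U S : Set ℂ} {C' r ρ B : ℝ}

/-- Propagation along a straight segment of the holomorphic extension of a solution. -/
lemma WkbDomain.propagate_segment (D : WkbDomain m c E V δ U C')
    (H : RiccatiBounds m c E V δ U r ρ B) {z₀ e : ℂ} (he : ‖e‖ ≤ 1) {s₀ s₁ : ℝ} (hs : s₀ ≤ s₁)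
    (hpath : ∀ s ∈ Icc s₀ s₁, Metric.closedBall (z₀ + s * e) r ⊆ U)
    (hS : ∀ s ∈ Icc s₀ s₁, z₀ + s * e ∈ S)
    {h : ℝ} (hh : 0 < h) {N : ℕ} (hN : 1 ≤ N) (hhN : h * N ≤ ρ) {U₁ U₂ : ℂ → ℂ}
    (hU₁ : ∀ z ∈ S, HasDerivAt U₁ (I / h * upCoeff m c E V z * U₂ z) z)
    (hU₂ : ∀ z ∈ S, HasDerivAt U₂ (I / h * loCoeff m c E V z * U₁ z) z)
    {μ X : ℝ} (hμ : 0 ≤ μ)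
    (hP : ∀ s ∈ Icc s₀ s₁, -μ ≤ (I / h * momentum m c E V (z₀ + s * e) * e).re)
    (hX : 0 ≤ X) {d : ℂ}
    (h₀ : WkbState (amplitude m c E V (z₀ + s₀ * e)) (U₁ (z₀ + s₀ * e)) (U₂ (z₀ + s₀ * e))
      (diracRiccati m c E V N (z₀ + s₀ * e, h)) d ((1 / 2) ^ N) X) :
    WkbState (amplitude m c E V (z₀ + s₁ * e)) (U₁ (z₀ + s₁ * e)) (U₂ (z₀ + s₁ * e))
      (diracRiccati m c E V N (z₀ + s₁ * e, h))
      (d + (I / h * (∫ s in s₀..s₁, momentum m c E V (z₀ + s * e) * e)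
        - ∫ s in Ioc s₀ s₁, phaseDensity m c E V z₀ e N h s))
      ((1 / 2) ^ N)
      (X + (2 * C' * B * (s₁ - s₀) + 1) *
        (2 * Real.exp (3 * (2 * C' * B * (s₁ - s₀)) + 2 * μ * (s₁ - s₀))) * (1 + X)) := by
  have hC0 : 0 ≤ C' := zero_le_one.trans D.one_le
  have hB0 : 0 ≤ B := zero_le_one.trans H.one_le
  have hnh : ‖(h : ℂ)‖ * N ≤ ρ := by rwa [Complex.norm_real, Real.norm_of_nonneg hh.le]
  have hz : Continuous fun s : ℝ => z₀ + s * e := by fun_prop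
  have hzd : ∀ s : ℝ, HasDerivAt (fun s : ℝ => z₀ + s * e) e s := fun s => by
    have := ((Complex.ofRealCLM.hasDerivAt (x := s)).mul_const e).const_add z₀
    exact this.congr_deriv (by simp)
  have hω : Continuous fun s : ℝ => japaneseWeight δ (z₀ + s * e).re :=
    (continuous_japaneseWeight δ).comp (Complex.continuous_re.comp hz)
  have hU : ∀ s ∈ Icc s₀ s₁, z₀ + s * e ∈ U := fun s h => hpath s h
    (Metric.mem_closedBall_self H.hr.le)
  have key := D.propagate H he hs hpath hh hN hhN (y₁ := fun s => U₁ (z₀ + s * e))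
    (y₂ := fun s => U₂ (z₀ + s * e)) (K := 2 * C' * B * (s₁ - s₀)) (μ := μ) (X := X) (d := d)
    (fun s h => ((hU₁ _ (hS s h)).comp s (hzd s)).congr_deriv (by ring))
    (fun s h => ((hU₂ _ (hS s h)).comp s (hzd s)).congr_deriv (by ring)) ?_ hμ hP hX h₀
  · convert key using 2
    rw [intervalIntegral.integral_sub, ← intervalIntegral.integral_const_mul,
      ← intervalIntegral.integral_of_le hs]
    · congr 1
      exact intervalIntegral.integral_congr fun s _ => by ring
    · refine ContinuousOn.intervalIntegrable ?_
      rw [uIcc_of_le hs]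
      exact (continuousOn_const.mul (D.analytic_momentum.continuousOn.comp hz.continuousOn hU)).mul
        continuousOn_const
    · refine ContinuousOn.intervalIntegrable ?_
      rw [uIcc_of_le hs]
      exact D.continuousOn_phaseDensity hU N h
  · calc ∫ s in s₀..s₁, 2 * C' * B * japaneseWeight δ (z₀ + s * e).re
        ≤ ∫ _ in s₀..s₁, 2 * C' * B := by
          refine intervalIntegral.integral_mono_on hs
            ((hω.const_mul _).intervalIntegrable _ _) intervalIntegrable_const fun s _ => ?_
          exact mul_le_of_le_one_right (by positivity) (japaneseWeight_le_one D.one_lt _)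
      _ = 2 * C' * B * (s₁ - s₀) := by
          rw [intervalIntegral.integral_const, smul_eq_mul]; ring

end Segments

section Path

variable {m c E : ℝ} {V : ℂ → ℂ} {Vm t₁ δ Y y R C f₀ w κ : ℝ}

lemma DiracGeometry.exists_extension (G : DiracGeometry m c E V Vm t₁ δ Y y R C f₀ w κ)
    (hc : 0 < c) {h : ℝ} (hh : 0 < h) {u : ℝ → ℂ × ℂ} (hu : IsDiracSolution h m c V E u) :
    ∃ U₁ U₂ : ℂ → ℂ,
      (∀ z ∈ Metric.ball (t₁ : ℂ) R, HasDerivAt U₁ (I / h * upCoeff m c E V z * U₂ z) z) ∧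
      (∀ z ∈ Metric.ball (t₁ : ℂ) R, HasDerivAt U₂ (I / h * loCoeff m c E V z * U₁ z) z) ∧
      ∀ x : ℝ, |x - t₁| < R → U₁ x = (u x).1 ∧ U₂ x = (u x).2 := by
  have hIh : ‖I / (h : ℂ)‖ = 1 / h := by
    rw [norm_div, Complex.norm_I, Complex.norm_real, Real.norm_of_nonneg hh.le]
  have hb : ∀ z ∈ Metric.ball (t₁ : ℂ) R, |z.im| < Y := fun z hz => G.abs_im_lt_of_mem_ball hz
  have hd : ∀ z ∈ Metric.ball (t₁ : ℂ) R, HasDerivAt V (deriv V z) z := fun z hz =>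
    (G.analytic z (hb z hz)).differentiableAt.hasDerivAt
  refine exists_holomorphic_extension (L := 1 / h * C) G.hR (fun z hz => ?_) (fun z hz => ?_)
    (fun z hz => ?_) (fun z hz => ?_) (fun x => hu.hasDerivAt_fst hh hc x)
    (fun x => hu.hasDerivAt_snd hh hc x)
  · exact ((hasDerivAt_upCoeff (hd z hz)).differentiableAt.const_mul _).differentiableWithinAt
  · exact ((hasDerivAt_loCoeff (hd z hz)).differentiableAt.const_mul _).differentiableWithinAt
  · rw [norm_mul, hIh]; gcongr; exact G.norm_up z (hb z hz)
  · rw [norm_mul, hIh]; gcongr; exact G.norm_lo z (hb z hz)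

lemma half_pow_mul_le {N L : ℕ} {a K x x' : ℝ} (hx : 0 ≤ x) (hK : 0 ≤ K) (ha : 0 ≤ a)
    (h : (1 / 2 : ℝ) ^ (L * N) * Real.exp a ≤ (1 / 2) ^ N) (hx' : x' = x + (K + 1) *
      (2 * Real.exp (3 * K + a)) * (1 + x)) :
    (1 / 2 : ℝ) ^ (L * N) * x' ≤ (1 / 2) ^ N * (x + (K + 1) * (2 * Real.exp (3 * K)) * (1 + x)) := by
  have h1 : (1 / 2 : ℝ) ^ (L * N) ≤ (1 / 2) ^ N :=
    (le_mul_of_one_le_right (by positivity) (Real.one_le_exp ha)).trans h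
  rw [hx', Real.exp_add]
  calc (1 / 2 : ℝ) ^ (L * N) * (x + (K + 1) * (2 * (Real.exp (3 * K) * Real.exp a)) * (1 + x))
      = (1 / 2 : ℝ) ^ (L * N) * x
        + (1 / 2 : ℝ) ^ (L * N) * Real.exp a * ((K + 1) * (2 * Real.exp (3 * K)) * (1 + x)) := by ring
    _ ≤ (1 / 2) ^ N * x + (1 / 2) ^ N * ((K + 1) * (2 * Real.exp (3 * K)) * (1 + x)) := by gcongr
    _ = _ := by ring

/-- The incoming Jost solution is a WKB solution to the right of the turning point. -/
lemma DiracGeometry.path_state (G : DiracGeometry m c E V Vm t₁ δ Y y R C f₀ w κ)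
    (hm : 0 < m) (hc : 0 < c) (hE : m * c ^ 2 + Vm < E) {CL rL ρL BL CR rR ρR BR τ : ℝ}
    (DL : WkbDomain m c E V δ (leftDomain t₁ y R) CL)
    (HL : RiccatiBounds m c E V δ (leftDomain t₁ y R) rL ρL BL)
    (DR : WkbDomain m c E V δ (rightDomain t₁ y R τ) CR)
    (HR : RiccatiBounds m c E V δ (rightDomain t₁ y R τ) rR ρR BR)
    (hτ : 0 < τ) (hτR : τ ≤ R / 8) (hrL : rL < R / 4) (hrLτ : τ + rL < y)
    (hrRτ : τ / 2 + rR < τ) (hrRy : τ + rR < y) :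
    ∃ X₁ : ℝ, 0 ≤ X₁ ∧ ∀ h : ℝ, 0 < h → ∀ N L : ℕ, 1 ≤ N → 1 ≤ L → h * (L * N : ℕ) ≤ ρL →
      h * N ≤ ρR →
      (1 / 2 : ℝ) ^ (L * N) * Real.exp (2 * (Real.sqrt C / h) * τ) ≤ (1 / 2) ^ N →
      ∀ u : ℝ → ℂ × ℂ, IsDiracSolution h m c V E u → JostCond h m c E Vm 1 1 atBot u →
      WkbState (amplitude m c E V ((t₁ + R / 2 : ℝ) : ℂ)) (u (t₁ + R / 2)).1 (u (t₁ + R / 2)).2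
        (diracRiccati m c E V N (((t₁ + R / 2 : ℝ) : ℂ), h))
        (I / h * ((((∫ x in Iic (t₁ - R / 2), Qsym m c E Vm V x)
          + Real.sqrt (Esym m c E Vm) * (t₁ - R / 2) : ℝ) : ℂ)
          + ∫ s in (t₁ - R / 2)..(t₁ + R / 2), momentum m c E V s)
          - pathPhase m c E V t₁ R τ (L * N) N h) ((1 / 2) ^ N) X₁ := by
  have hR := G.hR
  have hrL0 := HL.hr
  have hrR0 := HR.hr
  obtain ⟨X₁, hX₁, H1⟩ := G.left_state hm hc hE DL HL (by linarith) hrL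
  set x₀ := t₁ - R / 2 with hx₀
  set x₁ := t₁ + R / 2 with hx₁
  have hCL : 0 ≤ CL := zero_le_one.trans DL.one_le
  have hCR : 0 ≤ CR := zero_le_one.trans DR.one_le
  have hBL : 0 ≤ BL := zero_le_one.trans HL.one_le
  have hBR : 0 ≤ BR := zero_le_one.trans HR.one_le
  set KL := 2 * CL * BL * (τ - 0)
  have hKL : 0 ≤ KL := mul_nonneg (by positivity) (by linarith)
  set X₂ := X₁ + (KL + 1) * (2 * Real.exp (3 * KL)) * (1 + X₁) with hX₂
  have hX₂0 : 0 ≤ X₂ := by positivity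
  set X₃ := (2 * X₂ + 1) + (2 * CR * BR * (x₁ - x₀) + 1) *
        (2 * Real.exp (3 * (2 * CR * BR * (x₁ - x₀)) + 2 * 0 * (x₁ - x₀))) * (1 + (2 * X₂ + 1)) with hX₃
  have hx01 : 0 ≤ x₁ - x₀ := by linarith
  have hX₃0 : 0 ≤ X₃ := by positivity
  set X₄ := X₃ + (2 * CR * BR * (0 - -τ) + 1) *
        (2 * Real.exp (3 * (2 * CR * BR * (0 - -τ)) + 2 * 0 * (0 - -τ))) * (1 + X₃) with hX₄
  have hττ : 0 ≤ 0 - -τ := by linarith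
  refine ⟨X₄, by positivity, fun h hh N L hN hL hhL hhR hexp u hu hj => ?_⟩
  have hLN : 1 ≤ L * N := one_le_mul hL hN
  obtain ⟨U₁, U₂, hU₁, hU₂, hUu⟩ := G.exists_extension hc hh hu
  have S1 := H1 h hh (L * N) hLN hhL u hu hj
  have hx₀R : |x₀ - t₁| < R := by rw [hx₀, abs_lt]; constructor <;> linarith
  have hx₁R : |x₁ - t₁| < R := by rw [hx₁, abs_lt]; constructor <;> linarith
  have hx₀R' : |x₀ - t₁| ≤ R / 2 := by rw [hx₀, abs_le]; constructor <;> linarith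
  have hx₁R' : |x₁ - t₁| ≤ R / 2 := by rw [hx₁, abs_le]; constructor <;> linarith
  rw [← (hUu x₀ hx₀R).1, ← (hUu x₀ hx₀R).2] at S1
  rw [← (hUu x₁ hx₁R).1, ← (hUu x₁ hx₁R).2]
  have hPb : ∀ z : ℂ, |z.im| < Y → ∀ e : ℂ, ‖e‖ ≤ 1 →
      -(Real.sqrt C / h) ≤ (I / h * momentum m c E V z * e).re := fun z hz e he => by
    have h1 : ‖I / h * momentum m c E V z * e‖ ≤ Real.sqrt C / h := by
      rw [norm_mul, norm_mul, norm_div, Complex.norm_I, Complex.norm_real, Real.norm_of_nonneg hh.le]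
      calc 1 / h * ‖momentum m c E V z‖ * ‖e‖ ≤ 1 / h * Real.sqrt C * 1 := by
            gcongr; exact G.norm_momentum_le hz
        _ = _ := by ring
    linarith [(abs_le.1 (Complex.abs_re_le_norm (I / h * momentum m c E V z * e))).1]
  have hbL : ∀ s ∈ Icc 0 τ, (x₀ + s * I : ℂ) ∈ Metric.ball (t₁ : ℂ) R := fun s hs =>
    add_mul_I_mem_ball (by rw [abs_of_nonneg hs.1]; linarith [hs.2])
  have S2 := DL.propagate_segment HL (z₀ := (x₀ : ℂ)) (e := I) (by simp) hτ.le (fun s hs =>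
    closedBall_subset_leftDomain hrL le_rfl (by rw [abs_of_nonneg hs.1]; linarith [hs.2])) hbL
    hh hLN hhL hU₁ hU₂ (μ := Real.sqrt C / h) (by positivity) (fun s hs =>
      hPb _ (G.abs_im_lt_of_mem_ball (hbL s hs)) I (by simp)) hX₁ (by
        simpa only [Complex.ofReal_zero, zero_mul, add_zero] using S1)
  have hbM : ∀ s ∈ Icc x₀ x₁, (τ * I + s * 1 : ℂ) ∈ Metric.ball (t₁ : ℂ) R := fun s hs => by
    rw [mul_one, add_comm]
    refine add_mul_I_mem_ball ?_
    have : |s - t₁| ≤ R / 2 := by rw [abs_le]; constructor <;> linarith [hs.1, hs.2]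
    rw [abs_of_pos hτ]; linarith
  have S2' := S2.of_le (ε' := (1 / 2) ^ N) (X' := X₂)
    (Q' := diracRiccati m c E V N ((x₀ : ℂ) + τ * I, h))
    (half_pow_mul_le (K := KL) (a := 2 * (Real.sqrt C / h) * (τ - 0)) hX₁ hKL
      (mul_nonneg (by positivity) (by linarith)) (by simpa using hexp) rfl)
    (by positivity) (pow_le_one₀ (by norm_num) (by norm_num)) hX₂0 (by
      rw [norm_sub_rev]
      exact HL.norm_sub_le G.one_lt (closedBall_subset_leftDomain hrL le_rfl
        (by rw [abs_of_pos hτ]; linarith)) hLN (by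
          rwa [Complex.norm_real, Real.norm_of_nonneg hh.le]) (Nat.le_mul_of_pos_left N hL) le_rfl)
  have e1 : (x₀ + τ * I : ℂ) = τ * I + x₀ * 1 := by ring
  rw [e1] at S2'
  have S3 := DR.propagate_segment HR (z₀ := (τ * I : ℂ)) (e := 1) (by simp)
    (by linarith : x₀ ≤ x₁) (fun s hs => by
      rw [mul_one, add_comm]
      exact closedBall_subset_rightDomain_of_above
        (abs_le.2 ⟨by linarith [hs.1], by linarith [hs.2]⟩) hτR hrRτ hτ hrR0) hbM
    hh hN hhR hU₁ hU₂ (μ := 0) le_rfl (fun s hs => ?_) (by positivity) S2'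
  swap
  · have h1 := (G.momentum_re_im (hbM s hs) (by simp [hτ.le])).2
    have e : I / h * momentum m c E V (τ * I + s * 1) * 1
        = ((1 / h : ℝ) : ℂ) * (I * momentum m c E V (τ * I + s * 1)) := by push_cast; ring
    rw [e, Complex.re_ofReal_mul, Complex.I_mul_re, neg_zero]
    exact mul_nonneg (by positivity) (by linarith)
  have e2 : (τ * I + x₁ * 1 : ℂ) = x₁ + ((-τ : ℝ) : ℂ) * -I := by push_cast; ring
  rw [e2] at S3
  have hbR : ∀ s ∈ Icc (-τ) 0, (x₁ + s * -I : ℂ) ∈ Metric.ball (t₁ : ℂ) R := fun s hs => by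
    have e : (x₁ + s * -I : ℂ) = x₁ + ((-s : ℝ) : ℂ) * I := by push_cast; ring
    rw [e]
    exact add_mul_I_mem_ball (by rw [abs_neg, abs_of_nonpos hs.2]; linarith [hs.1])
  have S4 := DR.propagate_segment HR (z₀ := (x₁ : ℂ)) (e := -I) (by simp)
    (by linarith : -τ ≤ 0) (fun s hs => by
      have e : (x₁ + s * -I : ℂ) = x₁ + ((-s : ℝ) : ℂ) * I := by push_cast; ring
      rw [e]
      exact closedBall_subset_rightDomain (by linarith) le_rfl
        (by rw [abs_neg, abs_of_nonpos hs.2]; linarith [hs.1])) hbR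
    hh hN hhR hU₁ hU₂ (μ := 0) le_rfl (fun s hs => ?_) hX₃0 S3
  swap
  · have h1 := (G.momentum_re_im (hbR s hs) (by simp [hs.2])).1
    have e : I / h * momentum m c E V (x₁ + s * -I) * -I
        = ((1 / h : ℝ) : ℂ) * (-(I * I) * momentum m c E V (x₁ + s * -I)) := by push_cast; ring
    rw [e, Complex.I_mul_I, neg_neg, one_mul, Complex.re_ofReal_mul, neg_zero]
    exact mul_nonneg (by positivity) h1
  have hint := G.integral_path hτ.le le_rfl le_rfl (by linarith : x₀ ≤ x₁) hτR
  simp only [Complex.ofReal_zero, zero_mul, add_zero] at S4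
  convert S4 using 1
  rw [pathPhase, ← hint]
  ring

end Path

section RightEnd

variable {m c E : ℝ} {V : ℂ → ℂ} {Vm t₁ δ Y y R C f₀ w κ : ℝ}
variable {C' r ρ B τ : ℝ}

open ComplexConjugate in
lemma WkbState.conj_ratio {A y₁ y₂ Q d : ℂ} {ε X : ℝ} (H : WkbState A y₁ y₂ Q d ε X)
    (hA0 : A ≠ 0) (hA : A = I * conj A) (hη : 2 * (ε * X) + ‖Q‖ * (1 + ε * X) ≤ 1 / 2) :
    ‖y₁ / conj y₁ - I * cexp (d - conj d)‖ ≤ 4 * (2 * (ε * X) + ‖Q‖ * (1 + ε * X)) ∧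
      ‖A‖ * Real.exp d.re / 2 ≤ ‖y₁‖ := by
  obtain ⟨h1, h2⟩ := H
  set η := 2 * (ε * X) + ‖Q‖ * (1 + ε * X) with hηd
  set a := (y₁ / A + A * y₂) / 2 * cexp (-d) with ha
  set b := ((y₁ / A - A * y₂) / 2 - Q * ((y₁ / A + A * y₂) / 2)) * cexp (-d) with hb
  set ξ := a * (1 + Q) + b with hξ
  have e1 : y₁ = A * cexp d * ξ := by
    have : cexp d * cexp (-d) = 1 := by rw [← Complex.exp_add, add_neg_cancel, Complex.exp_zero]
    rw [hξ, ha, hb]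
    generalize cexp d = D at *
    generalize cexp (-d) = D' at *
    have e : A * D * ((y₁ / A + A * y₂) / 2 * D' * (1 + Q) + ((y₁ / A - A * y₂) / 2
      - Q * ((y₁ / A + A * y₂) / 2)) * D') = (D * D') * (A * (y₁ / A)) := by ring
    rw [e, this, one_mul, mul_div_cancel₀ _ hA0]
  have hξ1 : ‖ξ - 1‖ ≤ η := by
    have e : ξ - 1 = (a - 1) + (Q * ((a - 1) + 1) + b) := by rw [hξ]; ring
    rw [e]
    refine (norm_add_le _ _).trans ?_
    have h3 : ‖Q * ((a - 1) + 1)‖ ≤ ‖Q‖ * (1 + ε * X) := by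
      rw [norm_mul]
      gcongr
      refine (norm_add_le _ _).trans ?_
      rw [norm_one]; linarith
    have h4 := norm_add_le (Q * ((a - 1) + 1)) b
    rw [hηd]; linarith
  have hξ2 : 1 / 2 ≤ ‖ξ‖ := by
    have := norm_sub_norm_le 1 ξ
    rw [norm_one, norm_sub_rev] at this
    linarith
  have hξ0 : ξ ≠ 0 := by rintro h; rw [h, norm_zero] at hξ2; linarith
  have hcξ0 : conj ξ ≠ 0 := (map_ne_zero _).2 hξ0
  constructor
  · have e2 : y₁ / conj y₁ = I * cexp (d - conj d) * (ξ / conj ξ) := by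
      have hcA : conj A ≠ 0 := (map_ne_zero _).2 hA0
      have h3 : conj y₁ = conj A * cexp (conj d) * conj ξ := by
        rw [e1, map_mul, map_mul, ← Complex.exp_conj]
      rw [h3, Complex.exp_sub]
      nth_rewrite 1 [e1]
      nth_rewrite 1 [hA]
      have := Complex.exp_ne_zero (conj d)
      field_simp
    have h3 : ‖I * cexp (d - conj d)‖ = 1 := by
      rw [norm_mul, Complex.norm_I, Complex.norm_exp, Complex.sub_re, Complex.conj_re, sub_self,
        Real.exp_zero, mul_one]
    have h4 : ξ / conj ξ - 1 = ((ξ - 1) - conj (ξ - 1)) / conj ξ := by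
      rw [map_sub, map_one]; field_simp; ring
    rw [e2, ← mul_sub_one, norm_mul, h3, one_mul, h4, norm_div, RCLike.norm_conj,
      div_le_iff₀ (by linarith)]
    refine (norm_sub_le _ _).trans ?_
    rw [RCLike.norm_conj]
    nlinarith [norm_nonneg (ξ - 1)]
  · have : ‖y₁‖ = ‖A‖ * Real.exp d.re * ‖ξ‖ := by
      rw [e1, norm_mul, norm_mul, Complex.norm_exp]
    rw [this]
    have : 0 ≤ ‖A‖ * Real.exp d.re := by positivity
    nlinarith

/-- The full correction to the WKB phase. -/
noncomputable def totalPhase (m c E : ℝ) (V : ℂ → ℂ) (t₁ R τ : ℝ) (a b : ℕ) (h : ℂ) : ℂ :=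
  pathPhase m c E V t₁ R τ a b h + ∫ s in Ioi (t₁ + R / 2), phaseDensity m c E V 0 1 b h s

namespace DiracGeometry

lemma right_state (G : DiracGeometry m c E V Vm t₁ δ Y y R C f₀ w κ) (hc : 0 < c)
    (D : WkbDomain m c E V δ (rightDomain t₁ y R τ) C')
    (H : RiccatiBounds m c E V δ (rightDomain t₁ y R τ) r ρ B) (hrR : r < R / 4) (hry : r < y)
    {X₁ : ℝ} (hX₁ : 0 ≤ X₁) :
    ∃ X₂ : ℝ, 0 ≤ X₂ ∧ ∀ h : ℝ, 0 < h → ∀ N : ℕ, 1 ≤ N → h * N ≤ ρ →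
      ∀ u : ℝ → ℂ × ℂ, IsDiracSolution h m c V E u → ∀ d : ℂ,
      WkbState (amplitude m c E V ((t₁ + R / 2 : ℝ) : ℂ)) (u (t₁ + R / 2)).1 (u (t₁ + R / 2)).2
        (diracRiccati m c E V N (((t₁ + R / 2 : ℝ) : ℂ), h)) d ((1 / 2) ^ N) X₁ →
      ∀ x, t₁ + R / 2 ≤ x → WkbState (amplitude m c E V x) (u x).1 (u x).2
        (diracRiccati m c E V N (x, h))
        (d + (I / h * (∫ s in (t₁ + R / 2)..x, momentum m c E V s)
          - ∫ s in (t₁ + R / 2)..x, phaseDensity m c E V 0 1 N h s)) ((1 / 2) ^ N) X₂ := by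
  set x₁ := t₁ + R / 2 with hx₁
  have hR := G.hR
  have hC : 0 ≤ C' := zero_le_one.trans D.one_le
  have hB : 0 ≤ B := zero_le_one.trans H.one_le
  have hω0 : 0 ≤ 2 * C' * B := by positivity
  set K := ∫ s, 2 * C' * B * japaneseWeight δ s with hK
  have hKi : Integrable fun s => 2 * C' * B * japaneseWeight δ s :=
    (integrable_japaneseWeight G.one_lt).const_mul _
  have hK0 : 0 ≤ K := integral_nonneg fun s => mul_nonneg hω0 (japaneseWeight_pos _ _).le
  refine ⟨X₁ + (K + 1) * (2 * Real.exp (3 * K)) * (1 + X₁), by positivity,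
    fun h hh N hN hhN u hu d h₀ x hx => ?_⟩
  have hpath : ∀ s ∈ Icc x₁ x, Metric.closedBall ((0 : ℂ) + s * 1) r ⊆ rightDomain t₁ y R τ :=
    fun s hs => by
      have := closedBall_subset_rightDomain (τ := τ) (y := y) hrR hs.1 (s := 0)
        (by rw [abs_zero, zero_add]; exact hry)
      simpa using this
  have hU : ∀ s ∈ Icc x₁ x, (0 : ℂ) + s * 1 ∈ rightDomain t₁ y R τ := fun s hs =>
    hpath s hs (Metric.mem_closedBall_self H.hr.le)
  have key := D.propagate H (z₀ := 0) (e := 1) (by simp) hx hpath hh hN hhN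
    (y₁ := fun s => (u s).1) (y₂ := fun s => (u s).2) (K := K) (μ := 0) (X := X₁) (d := d)
    (fun s _ => by simpa using hu.hasDerivAt_fst hh hc s)
    (fun s _ => by simpa using hu.hasDerivAt_snd hh hc s) ?_ le_rfl (fun s hs => ?_) hX₁
    (by simpa using h₀)
  · simp only [mul_zero, zero_mul, add_zero] at key
    convert key using 2
    · simp
    · simp
    · rw [← intervalIntegral.integral_const_mul, ← intervalIntegral.integral_sub]
      · exact intervalIntegral.integral_congr fun s _ => by simp [phaseDensity]
      · exact (G.continuous_momentum.intervalIntegrable _ _).const_mul _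
      · refine ContinuousOn.intervalIntegrable ?_
        rw [uIcc_of_le hx]
        exact D.continuousOn_phaseDensity hU N h
  · have : ∀ s : ℝ, ((0 : ℂ) + s * 1).re = s := fun s => by simp
    simp only [this]
    rw [intervalIntegral.integral_of_le hx]
    exact setIntegral_le_integral hKi (Eventually.of_forall fun s =>
      mul_nonneg hω0 (japaneseWeight_pos _ _).le)
  · have e : I / h * momentum m c E V ((0 : ℂ) + s * 1) * 1
        = ((1 / h * Real.sqrt (-(sqMomentum m c E V s).re) : ℝ) : ℂ) := by
      rw [zero_add, mul_one, mul_one, G.momentum_right (by linarith [hs.1])]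
      push_cast
      linear_combination (-(1 / (h : ℂ)) * ((Real.sqrt (-(sqMomentum m c E V s).re) : ℝ) : ℂ)) * Complex.I_mul_I
    rw [e, Complex.ofReal_re, neg_zero]
    positivity

lemma right_action (G : DiracGeometry m c E V Vm t₁ δ Y y R C f₀ w κ) (hm : 0 < m) (hc : 0 < c)
    (hE : m * c ^ 2 + Vm < E) {x₀ x₁ x : ℝ} (h₀ : x₀ ≤ t₁) (h₁ : t₁ ≤ x) :
    (((∫ x in Iic x₀, Qsym m c E Vm V x) + Real.sqrt (Esym m c E Vm) * x₀ : ℝ) : ℂ)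
      + (∫ s in x₀..x₁, momentum m c E V s) + (∫ s in x₁..x, momentum m c E V s)
    = (((∫ x in Iic t₁, Qsym m c E Vm V x) + Real.sqrt (Esym m c E Vm) * t₁ : ℝ) : ℂ)
      - I * ((∫ s in t₁..x, Real.sqrt (-(sqMomentum m c E V s).re) : ℝ) : ℂ) := by
  have hi := fun a b => G.continuous_momentum.intervalIntegrable (μ := volume) a b
  rw [add_assoc, intervalIntegral.integral_add_adjacent_intervals (hi _ _) (hi _ _),
    ← intervalIntegral.integral_add_adjacent_intervals (hi x₀ t₁) (hi t₁ x)]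
  have e1 : ∫ s in x₀..t₁, momentum m c E V s
      = ((∫ s in x₀..t₁, (Qsym m c E Vm V s + Real.sqrt (Esym m c E Vm)) : ℝ) : ℂ) := by
    rw [← intervalIntegral.integral_ofReal]
    refine intervalIntegral.integral_congr fun s hs => ?_
    rw [uIcc_of_le h₀] at hs
    exact G.qsym_eq hs.2
  have e2 : ∫ s in t₁..x, momentum m c E V s
      = -I * ((∫ s in t₁..x, Real.sqrt (-(sqMomentum m c E V s).re) : ℝ) : ℂ) := by
    rw [← intervalIntegral.integral_ofReal, ← intervalIntegral.integral_const_mul]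
    refine intervalIntegral.integral_congr fun s hs => ?_
    rw [uIcc_of_le h₁] at hs
    rcases hs.1.eq_or_lt with h | h
    · rw [← h]
      simp only [G.momentum_turning, G.zero_real, Complex.zero_re, neg_zero, Real.sqrt_zero,
        Complex.ofReal_zero, mul_zero]
    · exact G.momentum_right h
  have e3 : ∫ s in x₀..t₁, (Qsym m c E Vm V s + Real.sqrt (Esym m c E Vm))
      = (∫ x in Iic t₁, Qsym m c E Vm V x) - (∫ x in Iic x₀, Qsym m c E Vm V x)
        + Real.sqrt (Esym m c E Vm) * (t₁ - x₀) := by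
    rw [intervalIntegral.integral_add (G.continuous_qsym.intervalIntegrable _ _)
      intervalIntegrable_const, intervalIntegral.integral_const,
      intervalIntegral.integral_Iic_sub_Iic (G.integrableOn_qsym hm hc hE _)
        (G.integrableOn_qsym hm hc hE _), smul_eq_mul]
    ring
  rw [e1, e2, e3]
  push_cast
  ring

lemma tendsto_right_action (G : DiracGeometry m c E V Vm t₁ δ Y y R C f₀ w κ) :
    Tendsto (fun x => ∫ s in t₁..x, Real.sqrt (-(sqMomentum m c E V s).re)) atTop atTop := by
  have hR := G.hR
  have hc : Continuous fun s : ℝ => Real.sqrt (-(sqMomentum m c E V s).re) := by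
    refine Real.continuous_sqrt.comp (Continuous.neg (Complex.continuous_re.comp ?_))
    rw [continuous_iff_continuousAt]
    intro x
    have h1 : AnalyticAt ℂ (sqMomentum m c E V) x :=
      analyticOnNhd_sqMomentum G.analytic x (by simpa using G.hY)
    exact h1.continuousAt.comp Complex.continuous_ofReal.continuousAt
  have hw := Real.sqrt_pos.2 G.hw
  refine tendsto_atTop_mono' atTop (f₁ := fun x => Real.sqrt w * (x - (t₁ + R / 2))) ?_ ?_
  · filter_upwards [eventually_ge_atTop (t₁ + R / 2)] with x hx
    rw [← intervalIntegral.integral_add_adjacent_intervals (hc.intervalIntegrable t₁ (t₁ + R / 2))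
      (hc.intervalIntegrable _ x)]
    have h1 : 0 ≤ ∫ s in t₁..(t₁ + R / 2), Real.sqrt (-(sqMomentum m c E V s).re) :=
      intervalIntegral.integral_nonneg (by linarith) fun s _ => Real.sqrt_nonneg _
    have h2 : ∫ s in (t₁ + R / 2)..x, Real.sqrt w
        ≤ ∫ s in (t₁ + R / 2)..x, Real.sqrt (-(sqMomentum m c E V s).re) := by
      refine intervalIntegral.integral_mono_on hx intervalIntegrable_const
        (hc.intervalIntegrable _ _) fun s hs => Real.sqrt_le_sqrt ?_
      have := G.right s (by simpa using G.hy) (by rw [Complex.ofReal_re]; linarith [hs.1])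
      linarith
    rw [intervalIntegral.integral_const, smul_eq_mul] at h2
    linarith
  · exact (tendsto_atTop_add_const_right atTop _ tendsto_id).const_mul_atTop hw

lemma norm_amplitude_ge (G : DiracGeometry m c E V Vm t₁ δ Y y R C f₀ w κ) {x : ℝ} (hx : t₁ < x) :
    Real.sqrt (f₀ / Real.sqrt C) ≤ ‖amplitude m c E V x‖ := by
  have hY : |((x : ℝ) : ℂ).im| < Y := by simpa using G.hY
  have h1 := amplitude_sq (slitPlane_ne_zero (G.up_mem_slitPlane hY))
    fun h : sqMomentum m c E V x = 0 => (G.right_real x hx).ne (by rw [h, Complex.zero_re])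
  have h2 := G.norm_momentum_le hY
  have h3 : f₀ ≤ ‖upCoeff m c E V x‖ := (G.up_re x hY).trans (Complex.re_le_norm _)
  rw [← h1, norm_mul, norm_pow] at h3
  rw [Real.sqrt_le_left (norm_nonneg _), div_le_iff₀ (Real.sqrt_pos.2 G.hC)]
  exact h3.trans (by gcongr)

end DiracGeometry

end RightEnd

section Reflection

variable {m c E : ℝ} {V : ℂ → ℂ} {Vm t₁ δ Y y R C f₀ w κ : ℝ}
variable {C' r ρ B τ : ℝ}

lemma closedBall_ofReal_subset_rightDomain {x : ℝ} (hr : r < R / 4) (hx : t₁ + R / 2 ≤ x)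
    (hry : r < y) : Metric.closedBall (0 + x * 1 : ℂ) r ⊆ rightDomain t₁ y R τ := by
  simpa using closedBall_subset_rightDomain (τ := τ) (y := y) hr hx (s := 0)
    (by rw [abs_zero, zero_add]; exact hry)

open ComplexConjugate in
/-- Comparison of the reflection coefficient of a bounded solution with the exponential of the
truncated WKB phase. -/
lemma DiracGeometry.reflection_approx (G : DiracGeometry m c E V Vm t₁ δ Y y R C f₀ w κ)
    (hm : 0 < m) (hc : 0 < c) (hE : m * c ^ 2 + Vm < E) {CL rL ρL BL CR rR ρR BR τ : ℝ}
    (DL : WkbDomain m c E V δ (leftDomain t₁ y R) CL)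
    (HL : RiccatiBounds m c E V δ (leftDomain t₁ y R) rL ρL BL)
    (DR : WkbDomain m c E V δ (rightDomain t₁ y R τ) CR)
    (HR : RiccatiBounds m c E V δ (rightDomain t₁ y R τ) rR ρR BR)
    (hτ : 0 < τ) (hτR : τ ≤ R / 8) (hrL : rL < R / 4) (hrLτ : τ + rL < y)
    (hrRτ : τ / 2 + rR < τ) (hrRy : τ + rR < y) :
    ∃ X : ℝ, 0 ≤ X ∧ ∀ h : ℝ, 0 < h → ∀ N L : ℕ, 1 ≤ N → 1 ≤ L → h * (L * N : ℕ) ≤ ρL →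
      h * N ≤ ρR →
      (1 / 2 : ℝ) ^ (L * N) * Real.exp (2 * (Real.sqrt C / h) * τ) ≤ (1 / 2) ^ N →
      (1 / 2 : ℝ) ^ N * X ≤ 1 →
      ∀ u : ℝ → ℂ × ℂ, IsDiracSolution h m c V E u → JostCond h m c E Vm 1 1 atBot u →
      ∀ (α : ℂ) (M : ℝ), (∀ x, ‖(u x).1 + α * conj (u x).1‖ ≤ M) →
      ‖α + I * cexp (2 * I / h * (((∫ x in Iic t₁, Qsym m c E Vm V x)
          + Real.sqrt (Esym m c E Vm) * t₁ : ℝ) : ℂ)) *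
        cexp (-(totalPhase m c E V t₁ R τ (L * N) N h - conj (totalPhase m c E V t₁ R τ (L * N) N h)))‖
        ≤ (1 / 2) ^ N * X := by
  have hR := G.hR
  have hrL0 := HL.hr
  have hrR0 := HR.hr
  have hrR : rR < R / 4 := by linarith
  obtain ⟨X₁, hX₁, H1⟩ := G.path_state hm hc hE DL HL DR HR hτ hτR hrL hrLτ hrRτ hrRy
  obtain ⟨X₂, hX₂, H2⟩ := G.right_state hc DR HR hrR (by linarith) hX₁
  refine ⟨8 * X₂, by positivity, fun h hh N L hN hL hhL hhR hexp hsmall u hu hj α M hM => ?_⟩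
  have S := H2 h hh N hN hhR u hu _ (H1 h hh N L hN hL hhL hhR hexp u hu hj)
  set x₁ := t₁ + R / 2 with hx₁
  set ε : ℝ := (1 / 2) ^ N with hε
  set T : ℝ := (∫ x in Iic t₁, Qsym m c E Vm V x) + Real.sqrt (Esym m c E Vm) * t₁ with hT
  set J := totalPhase m c E V t₁ R τ (L * N) N h with hJ
  set P := pathPhase m c E V t₁ R τ (L * N) N h with hP
  set j : ℝ → ℂ := fun x => P + ∫ s in x₁..x, phaseDensity m c E V 0 1 N h s with hj'
  set ra : ℝ → ℝ := fun x => ∫ s in t₁..x, Real.sqrt (-(sqMomentum m c E V s).re) with hra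
  set d : ℝ → ℂ := fun x => I * ((T / h : ℝ) : ℂ) + ((1 / h * ra x : ℝ) : ℂ) - j x with hd
  set Q : ℝ → ℂ := fun x => diracRiccati m c E V N (x, h) with hQ
  have hhC : (h : ℂ) ≠ 0 := by exact_mod_cast hh.ne'
  have S' : ∀ x, x₁ ≤ x → WkbState (amplitude m c E V x) (u x).1 (u x).2 (Q x) (d x) ε X₂ := by
    intro x hx
    convert S x hx using 1
    have := G.right_action hm hc hE (x₀ := t₁ - R / 2) (x₁ := x₁) (x := x) (by linarith)
      (by linarith)
    rw [← hT] at this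
    have e : ∀ a b q : ℂ, I / h * a - P + (I / h * b - q) = I / h * (a + b) - (P + q) := by
      intros; ring
    rw [e, this, hd]
    simp only [hra, hj']
    push_cast
    field_simp
    linear_combination (∫ s in t₁..x, Real.sqrt (-(sqMomentum m c E V s).re) : ℝ) * Complex.I_sq
  have hnh : ‖(h : ℂ)‖ * N ≤ ρR := by rwa [Complex.norm_real, Real.norm_of_nonneg hh.le]
  have hball : ∀ x ∈ Ioi x₁, Metric.closedBall (0 + x * 1 : ℂ) rR ⊆ rightDomain t₁ y R τ :=
    fun x hx => closedBall_ofReal_subset_rightDomain hrR (le_of_lt hx) (by linarith)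
  have hre : ∀ s : ℝ, ((0 : ℂ) + s * 1).re = s := fun s => by simp
  have hint : IntegrableOn (phaseDensity m c E V 0 1 N h) (Ioi x₁) := by
    refine DR.integrableOn_phaseDensity HR (by simp) measurableSet_Ioi hball ?_ hN hnh (by omega)
    simp only [hre]
    exact (integrable_japaneseWeight G.one_lt).integrableOn
  have hjJ : Tendsto j atTop (𝓝 J) :=
    (intervalIntegral_tendsto_integral_Ioi x₁ hint tendsto_id).const_add P
  have hQ0 : Tendsto (fun x => ‖Q x‖) atTop (𝓝 0) := by
    have h1 : Tendsto (fun x => BR * ‖(h : ℂ)‖ * japaneseWeight δ x) atTop (𝓝 0) := by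
      simpa using (tendsto_japaneseWeight_atTop G.one_lt).const_mul (BR * ‖(h : ℂ)‖)
    refine squeeze_zero' (Eventually.of_forall fun x => norm_nonneg _) ?_ h1
    filter_upwards [eventually_gt_atTop x₁] with x hx
    have := HR.bound N hN h hnh _ (hball x hx) N (by omega)
    simpa [hQ] using this
  have hdre : Tendsto (fun x => (d x).re) atTop atTop := by
    have h1 : ∀ x, (d x).re = 1 / h * ra x + -(j x).re := fun x => by
      simp only [hd, Complex.sub_re, Complex.add_re, Complex.ofReal_re, Complex.I_mul_re,
        Complex.ofReal_im, neg_zero, zero_add]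
      ring
    simp only [h1]
    exact (G.tendsto_right_action.const_mul_atTop (by positivity)).atTop_add
      ((Complex.continuous_re.tendsto _).comp hjJ).neg
  have hη : Tendsto (fun x => 2 * (ε * X₂) + ‖Q x‖ * (1 + ε * X₂)) atTop (𝓝 (2 * (ε * X₂))) := by
    simpa using (hQ0.mul_const (1 + ε * X₂)).const_add (2 * (ε * X₂))
  have hηs : ∀ᶠ x in atTop, 2 * (ε * X₂) + ‖Q x‖ * (1 + ε * X₂) ≤ 1 / 2 :=
    (hη.eventually (gt_mem_nhds (by linarith))).mono fun x hx => le_of_lt hx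
  set a := Real.sqrt (f₀ / Real.sqrt C) with ha
  have ha0 : 0 < a := Real.sqrt_pos.2 (div_pos G.hf₀ (Real.sqrt_pos.2 G.hC))
  have hy₁ : Tendsto (fun x => a * Real.exp (d x).re / 2) atTop atTop :=
    ((Real.tendsto_exp_atTop.comp hdre).const_mul_atTop ha0).atTop_div_const (by norm_num)
  have hM' : Tendsto (fun x => M / (a * Real.exp (d x).re / 2)) atTop (𝓝 0) :=
    hy₁.const_div_atTop M
  have hfin : ∀ᶠ x in atTop, ‖α + I * cexp (d x - conj (d x))‖
      ≤ M / (a * Real.exp (d x).re / 2) + 4 * (2 * (ε * X₂) + ‖Q x‖ * (1 + ε * X₂)) := by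
    filter_upwards [hηs, eventually_ge_atTop x₁] with x hx1 hx2
    have hx3 : t₁ < x := by linarith
    obtain ⟨h1, h2⟩ := (S' x hx2).conj_ratio (amplitude_ne_zero _)
      (amplitude_ofReal_right G.real (G.hf₀.trans_le (G.up_re x (by simpa using G.hY)))
        (G.right_real x hx3)) hx1
    have h3 : a * Real.exp (d x).re / 2 ≤ ‖(u x).1‖ := le_trans (by
      gcongr; exact G.norm_amplitude_ge hx3) h2
    have h4 : 0 < a * Real.exp (d x).re / 2 := by positivity
    have hy0 : (u x).1 ≠ 0 := norm_pos_iff.1 (h4.trans_le h3)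
    have hcy0 : conj (u x).1 ≠ 0 := (map_ne_zero _).2 hy0
    have h5 : ‖α + (u x).1 / conj (u x).1‖ ≤ M / (a * Real.exp (d x).re / 2) := by
      have e : α + (u x).1 / conj (u x).1 = ((u x).1 + α * conj (u x).1) / conj (u x).1 := by
        field_simp; ring
      have hM0 : 0 ≤ M := (norm_nonneg _).trans (hM x)
      rw [e, norm_div, RCLike.norm_conj]
      exact div_le_div₀ hM0 (hM x) h4 h3
    have e : α + I * cexp (d x - conj (d x)) = (α + (u x).1 / conj (u x).1)
      - ((u x).1 / conj (u x).1 - I * cexp (d x - conj (d x))) := by ring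
    rw [e]
    exact (norm_sub_le _ _).trans (add_le_add h5 h1)
  have hlim : Tendsto (fun x => ‖α + I * cexp (d x - conj (d x))‖) atTop
      (𝓝 ‖α + I * cexp (2 * I / h * (T : ℂ)) * cexp (-(J - conj J))‖) := by
    have e : ∀ x, d x - conj (d x) = 2 * I / h * (T : ℂ) + -(j x - conj (j x)) := fun x => by
      simp only [hd, map_sub, map_add, map_mul, Complex.conj_ofReal, Complex.conj_I]
      push_cast
      ring
    simp only [e, mul_assoc, ← Complex.exp_add]
    have hc : Continuous fun z : ℂ => ‖α + I * cexp (2 * I / h * (T : ℂ) + -(z - conj z))‖ := by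
      fun_prop
    have := (hc.tendsto J).comp hjJ
    simpa only [Function.comp_def, mul_assoc] using this
  have := le_of_tendsto_of_tendsto hlim (hM'.add (hη.const_mul 4)) hfin
  linarith

end Reflection

section SymbolFamily

/-- An integral of holomorphic functions with an integrable bound is holomorphic. -/
lemma differentiableOn_integral_of_le {α : Type*} [MeasurableSpace α] {μ : Measure α}
    {F : ℂ → α → ℂ} {b : α → ℝ} {O : Set ℂ} (hO : IsOpen O)
    (hm : ∀ h ∈ O, AEStronglyMeasurable (F h) μ)
    (hd : ∀ᵐ s ∂μ, DifferentiableOn ℂ (fun h => F h s) O)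
    (hb : ∀ᵐ s ∂μ, ∀ h ∈ O, ‖F h s‖ ≤ b s) (hbi : Integrable b μ) :
    DifferentiableOn ℂ (fun h => ∫ s, F h s ∂μ) O := by
  intro h₀ hh₀
  obtain ⟨η', hη', hball'⟩ := Metric.isOpen_iff.1 hO h₀ hh₀
  obtain ⟨η, hη, hball⟩ : ∃ η > 0, ∀ x, dist x h₀ ≤ 2 * η → x ∈ O :=
    ⟨η' / 3, by linarith, fun x hx => hball' (by rw [Metric.mem_ball]; linarith)⟩
  have key := hasDerivAt_integral_of_dominated_loc_of_deriv_le (μ := μ) (F := F) (x₀ := h₀)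
    (F' := fun h s => deriv (fun h => F h s) h) (bound := fun s => b s / η)
    (Metric.ball_mem_nhds h₀ hη)
    (eventually_of_mem (Metric.ball_mem_nhds h₀ hη) fun x hx => hm x (hball x (by
      rw [Metric.mem_ball] at hx; linarith)))
    ⟨hm h₀ hh₀, (Integrable.mono' hbi (hm h₀ hh₀) (hb.mono fun s hs => hs h₀ hh₀)).2⟩ ?_ ?_
    (hbi.div_const η) ?_
  · exact key.2.differentiableAt.differentiableWithinAt
  · set t : ℕ → ℂ := fun n => ((η / ((n : ℝ) + 1) : ℝ) : ℂ) with ht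
    have ht0 : ∀ n, t n ≠ 0 := fun n => by
      rw [ht, Complex.ofReal_ne_zero]; positivity
    have htη : ∀ n, ‖t n‖ ≤ η := fun n => by
      rw [ht, Complex.norm_real, Real.norm_of_nonneg (by positivity)]
      exact div_le_self hη.le (by linarith [(Nat.cast_nonneg n : (0 : ℝ) ≤ n)])
    have htl : Tendsto t atTop (𝓝[≠] 0) := by
      refine tendsto_nhdsWithin_iff.2 ⟨?_, Eventually.of_forall ht0⟩
      have h1 := (tendsto_one_div_add_atTop_nhds_zero_nat (𝕜 := ℝ)).const_mul η
      have h2 := (Complex.continuous_ofReal.tendsto _).comp h1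
      simpa [ht, Function.comp_def, div_eq_mul_inv] using h2
    refine aestronglyMeasurable_of_tendsto_ae atTop
      (f := fun n s => (t n)⁻¹ • (F (h₀ + t n) s - F h₀ s)) (fun n => ?_) ?_
    · refine AEStronglyMeasurable.const_smul ((hm _ (hball _ ?_)).sub (hm h₀ hh₀)) (t n)⁻¹
      rw [dist_eq_norm, add_sub_cancel_left]
      linarith [htη n]
    · filter_upwards [hd] with s hs
      exact ((hs.differentiableAt (hO.mem_nhds hh₀)).hasDerivAt.tendsto_slope_zero).comp htl
  · filter_upwards [hd, hb] with s hs1 hs2 x hx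
    rw [Metric.mem_ball] at hx
    have hsub : ∀ z, dist z x ≤ η → z ∈ O := fun z hz => hball z (by
      linarith [dist_triangle z x h₀])
    refine Complex.norm_deriv_le_of_forall_mem_sphere_norm_le hη ?_ fun z hz =>
      hs2 z (hsub z (Metric.mem_sphere.1 hz).le)
    refine (hs1.mono fun z hz => hsub z ?_).diffContOnCl
    rw [closure_ball x hη.ne'] at hz
    exact hz
  · filter_upwards [hd] with s hs x hx
    rw [Metric.mem_ball] at hx
    exact (hs.differentiableAt (hO.mem_nhds (hball x (by linarith)))).hasDerivAt

/-- A sequence of holomorphic functions on shrinking discs with stabilizing Taylor coefficients,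
vanishing at the origin. -/
structure SymbolFamily (ρ : ℝ) (J : ℕ → ℂ → ℂ) : Prop where
  bound : ∃ C : ℝ, 0 ≤ C ∧ ∀ N : ℕ, 1 ≤ N → ∀ h ∈ Metric.ball (0 : ℂ) (ρ / N), ‖J N h‖ ≤ C * ‖h‖
  diff : ∀ N : ℕ, 1 ≤ N → DifferentiableOn ℂ (J N) (Metric.ball 0 (ρ / N))
  stab : ∀ N : ℕ, 1 ≤ N → ∃ K : ℝ, ∃ η > 0, ∀ h : ℂ, ‖h‖ < η → ‖J (N + 1) h - J N h‖ ≤ K * ‖h‖ ^ N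

lemma SymbolFamily.add {ρ : ℝ} {J J' : ℕ → ℂ → ℂ} (H : SymbolFamily ρ J) (H' : SymbolFamily ρ J') :
    SymbolFamily ρ (fun N h => J N h + J' N h) := by
  refine ⟨?_, fun N hN => (H.diff N hN).add (H'.diff N hN), fun N hN => ?_⟩
  · obtain ⟨C, hC, h⟩ := H.bound
    obtain ⟨C', hC', h'⟩ := H'.bound
    refine ⟨C + C', by positivity, fun N hN z hz => (norm_add_le _ _).trans ?_⟩
    rw [add_mul]
    exact add_le_add (h N hN z hz) (h' N hN z hz)
  · obtain ⟨K, η, hη, h⟩ := H.stab N hN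
    obtain ⟨K', η', hη', h'⟩ := H'.stab N hN
    refine ⟨K + K', min η η', lt_min hη hη', fun z hz => ?_⟩
    rw [add_sub_add_comm, add_mul]
    exact (norm_add_le _ _).trans (add_le_add (h z (hz.trans_le (min_le_left _ _)))
      (h' z (hz.trans_le (min_le_right _ _))))

variable {m c E : ℝ} {V : ℂ → ℂ} {δ : ℝ} {U : Set ℂ} {C' r ρ B : ℝ}

lemma WkbDomain.phaseDensity_stab (D : WkbDomain m c E V δ U C')
    (H : RiccatiBounds m c E V δ U r ρ B) {z₀ e : ℂ} (he : ‖e‖ ≤ 1) {S : Set ℝ}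
    (hSm : MeasurableSet S) (hS : ∀ s ∈ S, Metric.closedBall (z₀ + s * e) r ⊆ U)
    (hω : IntegrableOn (fun s : ℝ => japaneseWeight δ (z₀ + s * e).re) S) {a b : ℕ} (ha : 1 ≤ a)
    (hab : a ≤ b) :
    ∃ K, ∃ η > 0, ∀ h : ℂ, ‖h‖ < η → ‖(∫ s in S, phaseDensity m c E V z₀ e b h s)
      - ∫ s in S, phaseDensity m c E V z₀ e a h s‖ ≤ K * ‖h‖ ^ a := by
  have hρ := H.hρ
  have hB := H.one_le
  have hC := D.one_le
  induction b, hab using Nat.le_induction with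
  | base => exact ⟨0, 1, one_pos, fun h _ => by simp⟩
  | succ n han ih =>
    obtain ⟨K, η, hη, ih⟩ := ih
    have hn : 1 ≤ n := ha.trans han
    have hn0 : (0 : ℝ) < n := by exact_mod_cast hn
    set W := ∫ s in S, japaneseWeight δ (z₀ + s * e).re with hW
    have hW0 : 0 ≤ W := integral_nonneg fun s => (japaneseWeight_pos _ _).le
    refine ⟨C' * B * (n / (2 * ρ)) ^ n * W + K, min η (min 1 (ρ / n)), by positivity,
      fun h hh => ?_⟩
    have hh1 : ‖h‖ < η := hh.trans_le (min_le_left _ _)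
    have hh2 : ‖h‖ ≤ 1 := (hh.trans_le ((min_le_right _ _).trans (min_le_left _ _))).le
    have hh3 : ‖h‖ * n ≤ ρ := by
      rw [← le_div_iff₀ hn0]
      exact (hh.trans_le ((min_le_right _ _).trans (min_le_right _ _))).le
    have hi : ∀ k ≤ n + 1, IntegrableOn (phaseDensity m c E V z₀ e k h) S := fun k hk =>
      D.integrableOn_phaseDensity H he hSm hS hω hn hh3 hk
    have key : ‖(∫ s in S, phaseDensity m c E V z₀ e (n + 1) h s)
        - ∫ s in S, phaseDensity m c E V z₀ e n h s‖
        ≤ C' * B * (n / (2 * ρ)) ^ n * W * ‖h‖ ^ a := by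
      rw [← integral_sub (hi _ le_rfl) (hi _ (by omega))]
      have e1 : C' * B * (n / (2 * ρ)) ^ n * W * ‖h‖ ^ a = ∫ s in S,
          C' * B * (n / (2 * ρ)) ^ n * ‖h‖ ^ a * japaneseWeight δ (z₀ + s * e).re := by
        rw [integral_const_mul]; ring
      rw [e1]
      refine norm_integral_le_of_norm_le (hω.const_mul _) ((ae_restrict_iff' hSm).2
        (Eventually.of_forall fun s hs => ?_))
      have h1 := H.diff n hn h hh3 _ (hS s hs) n le_rfl
      have h2 := D.norm_ν _ (hS s hs (Metric.mem_closedBall_self H.hr.le))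
      have h3 := japaneseWeight_le_one D.one_lt (z₀ + s * e).re
      have h4 := japaneseWeight_pos δ (z₀ + s * e).re
      rw [phaseDensity, phaseDensity, ← mul_sub, norm_mul, norm_mul]
      have h5 : ‖h‖ * (‖h‖ * n / (2 * ρ)) ^ n ≤ (n / (2 * ρ)) ^ n * ‖h‖ ^ a := by
        have e2 : (‖h‖ * n / (2 * ρ)) ^ n = (n / (2 * ρ)) ^ n * ‖h‖ ^ n := by
          rw [← mul_pow]; congr 1; ring
        rw [e2]
        have := pow_le_pow_of_le_one (norm_nonneg h) hh2 han
        calc ‖h‖ * ((n / (2 * ρ)) ^ n * ‖h‖ ^ n) ≤ 1 * ((n / (2 * ρ)) ^ n * ‖h‖ ^ a) := by gcongr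
          _ = _ := one_mul _
      have h6 : C' * japaneseWeight δ (z₀ + s * e).re ≤ C' := mul_le_of_le_one_right (by positivity) h3
      calc _ ≤ C' * 1 * (B * ‖h‖ * japaneseWeight δ (z₀ + s * e).re * (‖h‖ * n / (2 * ρ)) ^ n) :=
            mul_le_mul (mul_le_mul (h2.trans h6) he (norm_nonneg _) (by positivity)) h1
              (norm_nonneg _) (by positivity)
        _ = C' * B * japaneseWeight δ (z₀ + s * e).re * (‖h‖ * (‖h‖ * n / (2 * ρ)) ^ n) := by ring
        _ ≤ C' * B * japaneseWeight δ (z₀ + s * e).re * ((n / (2 * ρ)) ^ n * ‖h‖ ^ a) := by gcongr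
        _ = _ := by ring
    have hsplit := norm_add_le ((∫ s in S, phaseDensity m c E V z₀ e (n + 1) h s)
        - ∫ s in S, phaseDensity m c E V z₀ e n h s) ((∫ s in S, phaseDensity m c E V z₀ e n h s)
        - ∫ s in S, phaseDensity m c E V z₀ e a h s)
    rw [sub_add_sub_cancel] at hsplit
    rw [add_mul]
    exact hsplit.trans (add_le_add key (ih h hh1))

lemma WkbDomain.symbolFamily (D : WkbDomain m c E V δ U C')
    (H : RiccatiBounds m c E V δ U r ρ B) {z₀ e : ℂ} (he : ‖e‖ ≤ 1) {S : Set ℝ}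
    (hSm : MeasurableSet S) (hS : ∀ s ∈ S, Metric.closedBall (z₀ + s * e) r ⊆ U)
    (hω : IntegrableOn (fun s : ℝ => japaneseWeight δ (z₀ + s * e).re) S) {L : ℕ} (hL : 1 ≤ L)
    {ρ' : ℝ} (hρ' : L * ρ' ≤ ρ) :
    SymbolFamily ρ' (fun N h => ∫ s in S, phaseDensity m c E V z₀ e (L * N) h s) := by
  have hB := H.one_le
  have hC := D.one_le
  have hle : ∀ N : ℕ, 1 ≤ N → ∀ h ∈ Metric.ball (0 : ℂ) (ρ' / N), ‖h‖ * (L * N : ℕ) ≤ ρ :=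
    fun N hN h hh => by
      have hN0 : (0 : ℝ) < N := by exact_mod_cast hN
      rw [mem_ball_zero_iff, lt_div_iff₀ hN0] at hh
      push_cast
      have : (0 : ℝ) ≤ L := Nat.cast_nonneg L
      nlinarith
  have hLN : ∀ N : ℕ, 1 ≤ N → 1 ≤ L * N := fun N hN => one_le_mul hL hN
  refine ⟨?_, fun N hN => ?_, fun N hN => ?_⟩
  · refine ⟨C' * B * ∫ s in S, japaneseWeight δ (z₀ + s * e).re, mul_nonneg (by positivity)
      (integral_nonneg fun s => (japaneseWeight_pos _ _).le), fun N hN h hh => ?_⟩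
    have e1 : (C' * B * ∫ s in S, japaneseWeight δ (z₀ + s * e).re) * ‖h‖
        = ∫ s in S, C' * B * ‖h‖ * japaneseWeight δ (z₀ + s * e).re := by
      rw [integral_const_mul]; ring
    rw [e1]
    exact norm_integral_le_of_norm_le (hω.const_mul _) ((ae_restrict_iff' hSm).2
      (Eventually.of_forall fun s hs =>
        D.norm_phaseDensity_le H he (hS s hs) (hLN N hN) (hle N hN h hh) (by omega)))
  · have hN0 : (0 : ℝ) < N := by exact_mod_cast hN
    refine differentiableOn_integral_of_le (b := fun s : ℝ => C' * B * (ρ' / N) *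
      japaneseWeight δ (z₀ + s * e).re) Metric.isOpen_ball (fun h hh => ?_) ?_ ?_ (hω.const_mul _)
    · exact (D.integrableOn_phaseDensity H he hSm hS hω (hLN N hN) (hle N hN h hh)
        (by omega)).aestronglyMeasurable
    · refine (ae_restrict_iff' hSm).2 (Eventually.of_forall fun s hs => ?_)
      have hU : z₀ + s * e ∈ U := hS s hs (Metric.mem_closedBall_self H.hr.le)
      refine (Differentiable.const_mul (fun h => ?_) _).differentiableOn
      exact ((D.analytic_riccati (L * N)) (z₀ + s * e, h) ⟨hU, mem_univ _⟩).differentiableAt.comp h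
        (by fun_prop : DifferentiableAt ℂ (fun h : ℂ => (z₀ + s * e, h)) h)
    · refine (ae_restrict_iff' hSm).2 (Eventually.of_forall fun s hs h hh => ?_)
      refine (D.norm_phaseDensity_le H he (hS s hs) (hLN N hN) (hle N hN h hh) (by omega)).trans ?_
      have := (mem_ball_zero_iff.1 hh).le
      have := japaneseWeight_pos δ (z₀ + s * e).re
      gcongr
  · obtain ⟨K, η, hη, h⟩ := D.phaseDensity_stab H he hSm hS hω (a := L * N) (b := L * (N + 1))
      (hLN N hN) (Nat.mul_le_mul_left L (Nat.le_succ N))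
    refine ⟨|K|, min η 1, by positivity, fun z hz => ?_⟩
    refine (h z (hz.trans_le (min_le_left _ _))).trans ?_
    have := pow_le_pow_of_le_one (norm_nonneg z) (hz.trans_le (min_le_right _ _)).le
      (Nat.le_mul_of_pos_left N hL)
    calc K * ‖z‖ ^ (L * N) ≤ |K| * ‖z‖ ^ (L * N) := by gcongr; exact le_abs_self K
      _ ≤ |K| * ‖z‖ ^ N := by gcongr

end SymbolFamily

section TotalPhase

variable {m c E : ℝ} {V : ℂ → ℂ} {Vm t₁ δ Y y R C f₀ w κ : ℝ}

lemma integrableOn_japaneseWeight_segment (δ : ℝ) (z₀ e : ℂ) (a b : ℝ) :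
    IntegrableOn (fun s : ℝ => japaneseWeight δ (z₀ + s * e).re) (Ioc a b) := by
  have h : Continuous fun s : ℝ => japaneseWeight δ (z₀ + s * e).re :=
    (continuous_japaneseWeight δ).comp (Complex.continuous_re.comp (by fun_prop))
  exact (h.integrableOn_Icc (a := a) (b := b)).mono_set Ioc_subset_Icc_self

lemma integrableOn_japaneseWeight_real {δ : ℝ} (hδ : 1 < δ) (S : Set ℝ) :
    IntegrableOn (fun s : ℝ => japaneseWeight δ ((0 : ℂ) + s * 1).re) S := by
  have : ∀ s : ℝ, ((0 : ℂ) + s * 1).re = s := fun s => by simp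
  simp only [this]
  exact (integrable_japaneseWeight hδ).integrableOn

lemma symbolFamily_totalPhase {CL rL ρL BL CR rR ρR BR τ : ℝ}
    (DL : WkbDomain m c E V δ (leftDomain t₁ y R) CL)
    (HL : RiccatiBounds m c E V δ (leftDomain t₁ y R) rL ρL BL)
    (DR : WkbDomain m c E V δ (rightDomain t₁ y R τ) CR)
    (HR : RiccatiBounds m c E V δ (rightDomain t₁ y R τ) rR ρR BR)
    (hτ : 0 < τ) (hτR : τ ≤ R / 8) (hrL : rL < R / 4) (hrLτ : τ + rL < y)
    (hrRτ : τ / 2 + rR < τ) (hrRy : τ + rR < y) {L : ℕ} (hL : 1 ≤ L) {ρ : ℝ} (hρL : L * ρ ≤ ρL)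
    (hρR : ρ ≤ ρR) :
    SymbolFamily ρ (fun N h => totalPhase m c E V t₁ R τ (L * N) N h) := by
  have hδ := DL.one_lt
  have h1 := DL.symbolFamily HL (z₀ := 0) (e := 1) (by simp)
    (measurableSet_Iic (a := t₁ - R / 2)) (fun s hs => by
      simpa using closedBall_subset_leftDomain (y := y) hrL hs (s := 0) (by
        rw [abs_zero]; linarith)) (integrableOn_japaneseWeight_real hδ _) hL hρL
  have h2 := DL.symbolFamily HL (z₀ := ((t₁ - R / 2 : ℝ) : ℂ)) (e := I) (by simp)
    (measurableSet_Ioc (a := 0) (b := τ)) (fun s hs =>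
      closedBall_subset_leftDomain hrL le_rfl (by rw [abs_of_pos hs.1]; linarith [hs.2]))
    (integrableOn_japaneseWeight_segment _ _ _ _ _) hL hρL
  have h3 := DR.symbolFamily HR (z₀ := τ * I) (e := 1) (by simp)
    (measurableSet_Ioc (a := t₁ - R / 2) (b := t₁ + R / 2)) (fun s hs => by
      rw [mul_one, add_comm]
      exact closedBall_subset_rightDomain_of_above (abs_le.2 ⟨by linarith [hs.1], by linarith [hs.2]⟩)
        hτR hrRτ hτ HR.hr)
    (integrableOn_japaneseWeight_segment _ _ _ _ _) (L := 1) le_rfl (ρ' := ρ) (by simpa using hρR)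
  have h4 := DR.symbolFamily HR (z₀ := ((t₁ + R / 2 : ℝ) : ℂ)) (e := -I) (by simp)
    (measurableSet_Ioc (a := -τ) (b := 0)) (fun s hs => by
      have e : (((t₁ + R / 2 : ℝ) : ℂ) + s * -I : ℂ) = ((t₁ + R / 2 : ℝ) : ℂ) + ((-s : ℝ) : ℂ) * I := by
        push_cast; ring
      rw [e]
      exact closedBall_subset_rightDomain (by linarith) le_rfl
        (by rw [abs_neg, abs_of_nonpos hs.2]; linarith [hs.1]))
    (integrableOn_japaneseWeight_segment _ _ _ _ _) (L := 1) le_rfl (ρ' := ρ) (by simpa using hρR)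
  have h5 := DR.symbolFamily HR (z₀ := 0) (e := 1) (by simp)
    (measurableSet_Ioi (a := t₁ + R / 2)) (fun s hs =>
      closedBall_ofReal_subset_rightDomain (by linarith) (le_of_lt hs) (by linarith))
    (integrableOn_japaneseWeight_real hδ _) (L := 1) le_rfl (ρ' := ρ) (by simpa using hρR)
  have := (((h1.add h2).add h3).add h4).add h5
  simpa only [one_mul, totalPhase, pathPhase] using this

open ComplexConjugate in
/-- The exponentials of twice the odd part of a symbol family. -/
lemma SymbolFamily.exp {ρ : ℝ} {J : ℕ → ℂ → ℂ} (H : SymbolFamily ρ J) (hρ : 0 < ρ) :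
    (∀ N : ℕ, 1 ≤ N → DifferentiableOn ℂ (fun h => cexp (-(J N h - conj (J N (conj h)))))
      (Metric.ball 0 (ρ / N))) ∧
    (∃ M : ℝ, ∀ N : ℕ, 1 ≤ N → ∀ h ∈ Metric.ball (0 : ℂ) (ρ / N),
      ‖cexp (-(J N h - conj (J N (conj h))))‖ ≤ M) ∧
    (∀ N : ℕ, 1 ≤ N → ∃ K : ℝ, ∃ η > 0, ∀ h : ℂ, ‖h‖ < η →
      ‖cexp (-(J (N + 1) h - conj (J (N + 1) (conj h)))) - cexp (-(J N h - conj (J N (conj h))))‖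
        ≤ K * ‖h‖ ^ N) ∧
    ∀ N : ℕ, 1 ≤ N → cexp (-(J N 0 - conj (J N (conj 0)))) = 1 := by
  obtain ⟨C, hC, hb⟩ := H.bound
  have hcb : ∀ {h : ℂ} {s : ℝ}, h ∈ Metric.ball (0 : ℂ) s → conj h ∈ Metric.ball (0 : ℂ) s :=
    fun {h s} hh => by rwa [mem_ball_zero_iff, RCLike.norm_conj, ← mem_ball_zero_iff]
  have hbd : ∀ N : ℕ, 1 ≤ N → ∀ h ∈ Metric.ball (0 : ℂ) (ρ / N),
      ‖-(J N h - conj (J N (conj h)))‖ ≤ 2 * C * ‖h‖ := fun N hN h hh => by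
    rw [norm_neg]
    refine (norm_sub_le _ _).trans ?_
    have h1 := hb N hN h hh
    have h2 := hb N hN _ (hcb hh)
    rw [RCLike.norm_conj] at h2 ⊢
    linarith
  have hρN : ∀ N : ℕ, 1 ≤ N → ρ / N ≤ ρ := fun N hN =>
    div_le_self hρ.le (by exact_mod_cast hN)
  have hexp : ∀ N : ℕ, 1 ≤ N → ∀ h ∈ Metric.ball (0 : ℂ) (ρ / N),
      ‖cexp (-(J N h - conj (J N (conj h))))‖ ≤ Real.exp (2 * C * ρ) := fun N hN h hh => by
    refine (Complex.norm_exp_le_exp_norm _).trans (Real.exp_le_exp.2 ((hbd N hN h hh).trans ?_))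
    have := (mem_ball_zero_iff.1 hh).le.trans (hρN N hN)
    gcongr
  refine ⟨fun N hN h hh => ?_, ⟨_, hexp⟩, fun N hN => ?_, fun N hN => ?_⟩
  · have hd : ∀ z ∈ Metric.ball (0 : ℂ) (ρ / N), DifferentiableAt ℂ (J N) z := fun z hz =>
      (H.diff N hN).differentiableAt (Metric.isOpen_ball.mem_nhds hz)
    have h1 : DifferentiableAt ℂ (conj ∘ J N ∘ conj) h := by
      have := (hd _ (hcb hh)).conj_conj
      rwa [Complex.conj_conj] at this
    exact ((hd h hh).sub h1).neg.cexp.differentiableWithinAt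
  · obtain ⟨K, η, hη, hs⟩ := H.stab N hN
    have hN1 : (0 : ℝ) < (N + 1 : ℕ) := by positivity
    have hN0 : (0 : ℝ) < N := by exact_mod_cast hN
    refine ⟨Real.exp (2 * C * ρ) * (2 * (2 * K)), min (min η (ρ / (N + 1 : ℕ))) (1 / (4 * C + 1)),
      by positivity, fun h hh => ?_⟩
    have hh1 : ‖h‖ < η := hh.trans_le ((min_le_left _ _).trans (min_le_left _ _))
    have hh2 : h ∈ Metric.ball (0 : ℂ) (ρ / (N + 1 : ℕ)) :=
      mem_ball_zero_iff.2 (hh.trans_le ((min_le_left _ _).trans (min_le_right _ _)))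
    have hh3 : h ∈ Metric.ball (0 : ℂ) (ρ / N) := by
      refine Metric.ball_subset_ball (div_le_div_of_nonneg_left hρ.le hN0 ?_) hh2
      push_cast; linarith
    have hh4 : ‖h‖ * (4 * C + 1) ≤ 1 := by
      rw [← le_div_iff₀ (by positivity)]
      exact (hh.trans_le (min_le_right _ _)).le
    set a := -(J (N + 1) h - conj (J (N + 1) (conj h))) with ha
    set b := -(J N h - conj (J N (conj h))) with hb'
    have hab : ‖a - b‖ ≤ 2 * K * ‖h‖ ^ N := by
      have e : a - b = conj (J (N + 1) (conj h) - J N (conj h)) - (J (N + 1) h - J N h) := by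
        rw [ha, hb', map_sub]; ring
      rw [e]
      refine (norm_sub_le _ _).trans ?_
      have h1 := hs h hh1
      have h2 := hs (conj h) (by rwa [RCLike.norm_conj])
      rw [RCLike.norm_conj] at h2 ⊢
      linarith
    have hab1 : ‖a - b‖ ≤ 1 := by
      refine (norm_sub_le _ _).trans ?_
      have h1 := hbd (N + 1) (by omega) h hh2
      have h2 := hbd N hN h hh3
      nlinarith [norm_nonneg h]
    have e : cexp a - cexp b = cexp b * (cexp (a - b) - 1) := by
      rw [mul_sub_one, ← Complex.exp_add, add_sub_cancel]
    rw [e, norm_mul, mul_assoc]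
    refine mul_le_mul (hexp N hN h hh3) ?_ (norm_nonneg _) (Real.exp_pos _).le
    exact (Complex.norm_exp_sub_one_le hab1).trans (by linarith)
  · have h0 : (0 : ℂ) ∈ Metric.ball (0 : ℂ) (ρ / N) := by
      have : (0 : ℝ) < N := by exact_mod_cast hN
      exact Metric.mem_ball_self (by positivity)
    have h1 : J N 0 = 0 := by simpa using hb N hN 0 h0
    rw [map_zero, h1, map_zero, sub_zero, neg_zero, Complex.exp_zero]

set_option maxHeartbeats 1000000 in
open ComplexConjugate in
lemma DiracGeometry.exists_symbolFamily (G : DiracGeometry m c E V Vm t₁ δ Y y R C f₀ w κ)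
    (hm : 0 < m) (hc : 0 < c) (hE : m * c ^ 2 + Vm < E) :
    ∃ (ρ X σ h₀ : ℝ) (J : ℕ → ℂ → ℂ), 0 < ρ ∧ 0 < σ ∧ 0 < h₀ ∧ SymbolFamily ρ J ∧
      ∀ h : ℝ, 0 < h → h < h₀ → ∀ N : ℕ, 1 ≤ N → N * h ≤ ρ / 4 → ρ / 4 < (N + 1) * h →
      ∀ u : ℝ → ℂ × ℂ, IsDiracSolution h m c V E u → JostCond h m c E Vm 1 1 atBot u →
      ∀ (α : ℂ) (M : ℝ), (∀ x, ‖(u x).1 + α * conj (u x).1‖ ≤ M) →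
      ‖α + I * cexp (2 * I / h * (((∫ x in Iic t₁, Qsym m c E Vm V x)
          + Real.sqrt (Esym m c E Vm) * t₁ : ℝ) : ℂ)) * cexp (-(J N h - conj (J N h)))‖
        ≤ X * Real.exp (-σ / h) := by
  have hR := G.hR
  have hy := G.hy
  have hP : 0 < Real.sqrt C := Real.sqrt_pos.2 G.hC
  set P := Real.sqrt C with hPd
  set rL := min (min (y / 4) (R / 8)) 1 with hrLd
  have hrL0 : 0 < rL := by positivity
  have hrL1 : rL ≤ y / 4 := (min_le_left _ _).trans (min_le_left _ _)
  have hrL2 : rL ≤ R / 8 := (min_le_left _ _).trans (min_le_right _ _)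
  obtain ⟨CL, DL⟩ := G.exists_leftDomain hc
  obtain ⟨ρL, BL, HL⟩ := DL.exists_bounds hrL0 (min_le_right _ _)
  have hρL := HL.hρ
  set τ := min (min (y / 4) (R / 8)) (ρL / (64 * P)) with hτd
  have hτ : 0 < τ := by positivity
  have hτ1 : τ ≤ y / 4 := (min_le_left _ _).trans (min_le_left _ _)
  have hτ2 : τ ≤ R / 8 := (min_le_left _ _).trans (min_le_right _ _)
  have hτ3 : τ * (64 * P) ≤ ρL := by
    rw [← le_div_iff₀ (by positivity)]; exact min_le_right _ _
  obtain ⟨CR, DR⟩ := G.exists_rightDomain hc hτ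
  have hrR1 : min (τ / 4) 1 ≤ τ / 4 := min_le_left _ _
  obtain ⟨ρR, BR, HR⟩ := DR.exists_bounds (r := min (τ / 4) 1) (by positivity) (min_le_right _ _)
  have hρR := HR.hρ
  set ρ := min ρR (ρL / 4) with hρd
  have hρ : 0 < ρ := by positivity
  have hρ1 : ρ ≤ ρR := min_le_left _ _
  have hρ2 : ρ ≤ ρL / 4 := min_le_right _ _
  have hln : 1 / 2 < Real.log 2 := by have := Real.log_two_gt_d9; linarith
  have hln0 : 0 < Real.log 2 := by linarith
  set L := ⌈16 * P * τ / (ρ * Real.log 2)⌉₊ + 1 with hLd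
  have hL1 : 1 ≤ L := by omega
  have hLc : (L : ℝ) = ⌈16 * P * τ / (ρ * Real.log 2)⌉₊ + 1 := by rw [hLd]; push_cast; rfl
  have hLlo : 16 * P * τ ≤ (L - 1) * (ρ * Real.log 2) := by
    rw [← div_le_iff₀ (by positivity), hLc, add_sub_cancel_right]
    exact Nat.le_ceil _
  have hLhi : L * ρ ≤ ρL := by
    have h1 := Nat.ceil_lt_add_one (show 0 ≤ 16 * P * τ / (ρ * Real.log 2) by positivity)
    have h2 : 16 * P * τ / (ρ * Real.log 2) * ρ ≤ 32 * P * τ := by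
      have e : 16 * P * τ / (ρ * Real.log 2) * ρ = 16 * P * τ / Real.log 2 := by field_simp
      rw [e, div_le_iff₀ hln0]
      have : 0 < P * τ := by positivity
      nlinarith
    rw [hLc]
    nlinarith
  obtain ⟨X, hX, key⟩ := G.reflection_approx hm hc hE DL HL DR HR hτ hτ2 (by linarith) (by linarith)
    (by linarith) (by linarith)
  set σ := ρ * Real.log 2 / 4 with hσd
  have hσ : 0 < σ := by positivity
  refine ⟨ρ, 2 * X, σ, σ / (2 * X + 1), fun N h => totalPhase m c E V t₁ R τ (L * N) N h, hρ, hσ,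
    by positivity, symbolFamily_totalPhase DL HL DR HR hτ hτ2 (by linarith) (by linarith)
      (by linarith) (by linarith) hL1 hLhi hρ1, fun h hh hh₀ N hN hNh hNh' u hu hj α M hM => ?_⟩
  have hN1 : (1 : ℝ) ≤ N := by exact_mod_cast hN
  have hpow : ∀ n : ℕ, (1 / 2 : ℝ) ^ n = Real.exp (-(n * Real.log 2)) := fun n => by
    rw [Real.exp_neg, Real.exp_nat_mul, Real.exp_log two_pos, one_div, inv_pow]
  have hNσ : (1 / 2 : ℝ) ^ N ≤ 2 * Real.exp (-σ / h) := by
    have h1 : (1 / 2 : ℝ) ^ N = 2 * (1 / 2) ^ (N + 1) := by rw [pow_succ]; ring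
    rw [h1, hpow]
    gcongr
    rw [neg_div, neg_le_neg_iff, div_le_iff₀ hh, hσd]
    push_cast
    nlinarith
  have hsmall : (1 / 2 : ℝ) ^ N * X ≤ 1 := by
    have h1 : Real.exp (-σ / h) ≤ h / σ := by
      rw [neg_div, Real.exp_neg, inv_le_comm₀ (Real.exp_pos _) (by positivity), inv_div]
      linarith [Real.add_one_le_exp (σ / h)]
    rw [lt_div_iff₀ (by positivity)] at hh₀
    calc (1 / 2 : ℝ) ^ N * X ≤ 2 * (h / σ) * X := by
          gcongr; exact hNσ.trans (by gcongr)
      _ = h * (2 * X) / σ := by ring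
      _ ≤ 1 := by rw [div_le_one hσ]; nlinarith
  refine (key h hh N L hN hL1 ?_ ?_ ?_ hsmall u hu hj α M hM).trans ?_
  · push_cast
    have : (0 : ℝ) ≤ L := Nat.cast_nonneg L
    calc h * (L * N) = L * (N * h) := by ring
      _ ≤ L * (ρ / 4) := by gcongr
      _ ≤ ρL := by linarith
  · linarith
  · rw [hpow, hpow, ← Real.exp_add]
    gcongr
    have h1 : 2 * (P / h) * τ ≤ (L - 1) * N * Real.log 2 := by
      have e : 2 * (P / h) * τ = 2 * P * τ / h := by ring
      rw [e, div_le_iff₀ hh]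
      have h2 : ρ ≤ 8 * (N * h) := by nlinarith
      have hL0 : (0 : ℝ) ≤ L - 1 := by
        have : (1 : ℝ) ≤ L := by exact_mod_cast hL1
        linarith
      have h3 : (L - 1) * Real.log 2 * ρ ≤ (L - 1) * Real.log 2 * (8 * (N * h)) := by gcongr
      linarith
    push_cast
    linarith
  · calc (1 / 2 : ℝ) ^ N * X ≤ 2 * Real.exp (-σ / h) * X := by gcongr
      _ = _ := by ring

end TotalPhase

/-- **Scattering interpretation of total reflection** (Remark 2.6).  Under
assumption (A), `m > 0`, `E` in region II, a unique simple real zero `t₁` of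
`m²c⁴ − (V(x)−E)²`, with bounded incoming solution `u^in = ω_in^− + α_out^− ω_out^−`
and bounded outgoing solution `u^out = ω_out^− + α_in^− ω_in^−`:  if a bounded
solution `u` of `(H−E)u = 0` is written `u = A u^in` and `u = B u^out`, then
`B = 𝕊 A`, where the scalar scattering matrix is
`𝕊 = α_out^− = −i(1+hφ(h)) exp{(2i/h)(∫_{−∞}^{t₁} Q⁻ + √E⁻ t₁)}`. -/
theorem scattering_interpretation_total_reflection
    (m c Vm Vp E : ℝ) (V : ℂ → ℂ)
    (hA : AssumptionA V Vm Vp) (hm : 0 < m) (hc : 0 < c)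
    (hE1 : max (m * c ^ 2 + Vm) (Vp - m * c ^ 2) < E) (hE2 : E < Vp + m * c ^ 2)
    (t₁ : ℝ)
    (hzero : ∀ x : ℝ, m ^ 2 * c ^ 4 - ((V x).re - E) ^ 2 = 0 ↔ x = t₁)
    (hsimple : deriv (fun x : ℝ => m ^ 2 * c ^ 4 - ((V x).re - E) ^ 2) t₁ ≠ 0)
    (ωinm ωoutm : ℝ → ℝ → ℂ × ℂ)
    (hsol : ∀ h : ℝ, 0 < h →
      IsDiracSolution h m c V E (ωinm h) ∧ IsDiracSolution h m c V E (ωoutm h))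
    (hjost : ∀ h : ℝ, 0 < h →
      JostCond h m c E Vm 1 1 atBot (ωinm h) ∧
      JostCond h m c E Vm (-1) (-1) atBot (ωoutm h))
    (αout αin : ℝ → ℂ)
    -- `u^in = ω_in^− + α_out^− ω_out^−` is the bounded incoming solution
    (hin : ∀ h : ℝ, 0 < h → ∃ M : ℝ, ∀ x : ℝ, ‖ωinm h x + αout h • ωoutm h x‖ ≤ M)
    -- `u^out = ω_out^− + α_in^− ω_in^−` is the bounded outgoing solution
    (hout : ∀ h : ℝ, 0 < h → ∃ M : ℝ, ∀ x : ℝ, ‖ωoutm h x + αin h • ωinm h x‖ ≤ M) :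
    ∃ φ : ℝ → ℂ, IsCAS φ ∧
      ∃ h₀ > (0 : ℝ), ∀ h : ℝ, 0 < h → h < h₀ →
        -- the scalar scattering matrix `𝕊 = α_out^−` with its asymptotics
        αout h = -Complex.I * (1 + (h : ℂ) * φ h)
          * Complex.exp (2 * Complex.I / (h : ℂ)
            * ((((∫ t in Set.Iic t₁, Qsym m c E Vm V t)
                 + Real.sqrt (Esym m c E Vm) * t₁ : ℝ)) : ℂ)) ∧
        -- if `u = A u^in` and `u = B u^out` then `B = 𝕊 A`
        (∀ (A B : ℂ) (u : ℝ → ℂ × ℂ),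
          (∀ x : ℝ, u x = A • (ωinm h x + αout h • ωoutm h x)) →
          (∀ x : ℝ, u x = B • (ωoutm h x + αin h • ωinm h x)) →
          B = αout h * A) := by
  have hE : m * c ^ 2 + Vm < E := (max_lt_iff.1 hE1).1
  obtain ⟨δ, Y, y, R, C, f₀, w, κ, G⟩ := exists_diracGeometry hA hm hc hE1 hE2 hzero hsimple
  obtain ⟨ρ, X, σ, h₀, J, hρ, hσ, hh₀, hJ, key⟩ := G.exists_symbolFamily hm hc hE
  obtain ⟨hd, ⟨M, hM⟩, hstab, h0⟩ := hJ.exp hρ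
  set T : ℝ := (∫ t in Set.Iic t₁, Qsym m c E Vm V t) + Real.sqrt (Esym m c E Vm) * t₁ with hT
  have hphase : ∀ h : ℝ, ‖cexp (2 * I / h * (T : ℂ))‖ = 1 := fun h => by
    have e : 2 * I / (h : ℂ) * (T : ℂ) = ((2 / h * T : ℝ) : ℂ) * I := by push_cast; ring
    rw [e, Complex.norm_exp_ofReal_mul_I]
  obtain ⟨φ, hφ, h₁, hh₁, heq⟩ := exists_isCAS_of_approx
    (g := fun h => I * αout h * (cexp (2 * I / h * (T : ℂ)))⁻¹) hρ hσ hh₀ hd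
    (fun N hN h hh => (hM N hN h hh).trans (le_max_left M X)) hstab h0
    (fun h hh hh' N hN hNh hNh' => by
      obtain ⟨hu, hv⟩ := hsol h hh
      obtain ⟨hju, hjv⟩ := hjost h hh
      obtain ⟨K, hK⟩ := hin h hh
      have hb : ∀ x, ‖(ωinm h x).1 + αout h * (starRingEnd ℂ) (ωinm h x).1‖ ≤ K := fun x => by
        have := (norm_fst_le _).trans (hK x)
        rwa [Prod.fst_add, Prod.smul_fst, smul_eq_mul,
          jost_out_eq hu hv G.real hh hc hE hm hju hjv x] at this
      have hkey := key h hh hh' N hN hNh hNh' (ωinm h) hu hju (αout h) K hb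
      rw [Complex.conj_ofReal]
      set F := cexp (-(J N h - (starRingEnd ℂ) (J N h)))
      set e := cexp (2 * I / h * (T : ℂ)) with he
      have he0 : e ≠ 0 := Complex.exp_ne_zero _
      have hrw : I * αout h * e⁻¹ - F = I * e⁻¹ * (αout h + I * e * F) := by
        field_simp
        linear_combination (-e * F) * Complex.I_sq
      rw [hrw, norm_mul, norm_mul, norm_inv, Complex.norm_I, hphase h, inv_one, one_mul, one_mul]
      exact hkey.trans (mul_le_mul_of_nonneg_right (le_max_right M X) (Real.exp_nonneg _)))
  refine ⟨φ, hφ, h₁, hh₁, fun h hh hh' => ⟨?_, fun A B u hA' hB' => ?_⟩⟩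
  · rw [← heq h hh hh']
    have he0 := Complex.exp_ne_zero (2 * I / h * (T : ℂ))
    field_simp
    linear_combination (αout h) * Complex.I_sq
  · obtain ⟨hu, hv⟩ := hsol h hh
    obtain ⟨hju, hjv⟩ := hjost h hh
    exact reflection_relation hu hv hh hc hE hm hju hjv fun x => (hA' x).symm.trans (hB' x)
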